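/- arXiv:2010.11583 — 2 statements merged into one kernel-verified Lean document; each statement's English description precedes it below -/
import Mathlib

section
/- Let E be a complex Banach space with nontrivial Rademacher type, i.e., having Rademacher type s with constant T for some s ∈ (1,2] and T ∈ (0,∞). Let r ∈ (0,∞) and let h : 𝔻_r → ℂ be holomorphic on the disk 𝔻_r = { z ∈ ℂ : |z| < r }. Then for every p ∈ (1,∞) and α ∈ (0,∞) there exists C_h(α) = C_h(α,p,s,T) ∈ (0,∞) such that for every n ∈ ℕ and every function f : 𝒞_n → E, the function h(Δ^{−α}) f = ∑_{A ⊆ {1,…,n}, |A| > r^{−1/α}} h(|A|^{−α}) f̂(A) w_A satisfies ‖h(Δ^{−α}) f‖_{L_p(σ_n;E)} ≤ C_h(α) ‖f‖_{L_p(σ_n;E)}. -/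
open Finset MeasureTheory Real Filter

noncomputable section

/-- The discrete hypercube `𝒞_n = {-1,1}^n`, encoded as `Fin n → Bool`. -/
abbrev Cube (n : ℕ) := Fin n → Bool

/-- The sign `±1` associated to a boolean coordinate. -/
def sgn' (b : Bool) : ℝ := if b then 1 else -1

/-- Flip the `i`-th coordinate of a point of the hypercube. -/
def flipC {n : ℕ} (i : Fin n) (x : Cube n) : Cube n := Function.update x i (!(x i))

variable {E : Type*} [NormedAddCommGroup E]

/-- Expectation `E_{σ_n} f` with respect to the uniform probability measure on the cube. -/
def cubeAvg {n : ℕ} [NormedSpace ℝ E] (f : Cube n → E) : E :=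
  (2 ^ n : ℝ)⁻¹ • ∑ x : Cube n, f x

/-- The discrete partial derivative `∂_i f (ε) = (f(ε) - f(ε with i-th coordinate flipped))/2`. -/
def dparC {n : ℕ} [NormedSpace ℝ E] (i : Fin n) (f : Cube n → E) : Cube n → E :=
  fun x => (2 : ℝ)⁻¹ • (f x - f (flipC i x))

/-- The `L_p(σ_n; E)` norm of a function on the hypercube. -/
def cubeLp {n : ℕ} (p : ℝ) (f : Cube n → E) : ℝ :=
  ((2 ^ n : ℝ)⁻¹ * ∑ x : Cube n, ‖f x‖ ^ p) ^ (1 / p)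
/-- The Walsh function `w_A(ε) = ∏_{i ∈ A} ε_i`. -/
def walshC {n : ℕ} (A : Finset (Fin n)) (x : Cube n) : ℝ := ∏ i ∈ A, sgn' (x i)

/-- The Walsh–Fourier coefficient `f̂(A) ∈ E` of `f : 𝒞_n → E`. -/
def fhatC {n : ℕ} [NormedSpace ℝ E] (f : Cube n → E) (A : Finset (Fin n)) : E :=
  (2 ^ n : ℝ)⁻¹ • ∑ x : Cube n, walshC A x • f x

/-- The negative power of the hypercube Laplacian, defined spectrally:
`Δ^{-α} f = ∑_{∅ ≠ A} |A|^{-α} f̂(A) w_A`. -/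
def negLap {n : ℕ} [NormedSpace ℝ E] (α : ℝ) (f : Cube n → E) : Cube n → E :=
  fun x => ∑ A ∈ Finset.univ.filter (fun A : Finset (Fin n) => A ≠ ∅),
    (((A.card : ℝ) ^ (-α)) * walshC A x) • fhatC f A
/-- The spectrally defined operator `h(Δ^{-α})`, given by
`h(Δ^{-α}) f = ∑_{|A| > r^{-1/α}} h(|A|^{-α}) f̂(A) w_A`. -/
def holoMult {n : ℕ} [NormedSpace ℂ E] (h : ℂ → ℂ) (α r : ℝ) (f : Cube n → E) :
    Cube n → E :=
  fun x => ∑ A ∈ Finset.univ.filter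
      (fun A : Finset (Fin n) => r ^ (-1 / α) < (A.card : ℝ)),
    (h ((((A.card : ℝ) ^ (-α)) : ℝ) : ℂ) * ((walshC A x : ℝ) : ℂ)) • fhatC f A

set_option linter.unusedSectionVars false

section Calculus

variable {ι : Type*} [Fintype ι] {𝒜 : Type*} [NormedRing 𝒜] [NormedAlgebra ℂ 𝒜]

theorem norm_pow_one_sub_le {S : 𝒜} (h1 : ‖(1 : 𝒜)‖ ≤ 1) (hS : ‖S‖ ≤ 1) (n : ℕ) :
    ‖(1 - S) ^ n‖ ≤ 2 ^ n := by
  induction n with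
  | zero => simpa using h1
  | succ n ih =>
    rw [pow_succ, pow_succ]
    refine (norm_mul_le _ _).trans (mul_le_mul ih ?_ (norm_nonneg _) (by positivity))
    linarith [norm_sub_le (1 : 𝒜) S]

/-- If `(1 - S) ^ N` has norm less than `2 ^ N`, then the inverse of `1 + S` is bounded. -/
theorem norm_inv_one_add_le {S V : 𝒜} {N : ℕ} {ρ : ℝ} (h1 : ‖(1 : 𝒜)‖ ≤ 1) (hS : ‖S‖ ≤ 1)
    (hN : ‖(1 - S) ^ N‖ ≤ ρ) (hρ : ρ < 2 ^ N) (hV : (1 + S) * V = 1) :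
    ‖V‖ ≤ N * 2 ^ N / (2 ^ N - ρ) := by
  have key : ∀ n : ℕ, ‖(2 : ℂ) ^ n • V - (1 - S) ^ n * V‖ ≤ n * 2 ^ n := by
    intro n
    induction n with
    | zero => simp
    | succ n ih =>
      have e : (2 : ℂ) ^ (n + 1) • V - (1 - S) ^ (n + 1) * V
          = (2 : ℂ) • ((2 : ℂ) ^ n • V - (1 - S) ^ n * V) + (1 - S) ^ n := by
        have : (1 - S) * V = (2 : ℂ) • V - 1 := by
          calc (1 - S) * V = (2 : ℂ) • V - (1 + S) * V := by
                rw [add_mul, sub_mul, one_mul, two_smul]; abel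
            _ = _ := by rw [hV]
        rw [pow_succ (1 - S), mul_assoc, this, mul_sub, smul_sub, smul_smul, mul_smul_comm,
          pow_succ', mul_one]
        abel
      rw [e]
      refine (norm_add_le _ _).trans ?_
      have h2 := norm_pow_one_sub_le h1 hS n
      rw [norm_smul, Complex.norm_ofNat]
      push_cast
      have : (0 : ℝ) ≤ 2 ^ n := by positivity
      calc _ ≤ 2 * ((n : ℝ) * 2 ^ n) + 2 ^ n := by gcongr
        _ ≤ (n + 1) * 2 ^ (n + 1) := by rw [pow_succ]; nlinarith
  have h2 := key N
  have h3 : ‖(2 : ℂ) ^ N • V‖ ≤ N * 2 ^ N + ρ * ‖V‖ := by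
    calc _ = ‖((2 : ℂ) ^ N • V - (1 - S) ^ N * V) + (1 - S) ^ N * V‖ := by simp
      _ ≤ _ := norm_add_le_of_le h2 ((norm_mul_le _ _).trans (by gcongr))
  rw [norm_smul, norm_pow, Complex.norm_ofNat] at h3
  rw [le_div_iff₀ (by linarith)]
  linarith

/-- Uniform bound for the inverses of `1 + c S` with `0 ≤ c ≤ 1`. -/
theorem norm_inv_one_add_smul_le {S V W : 𝒜} {K c : ℝ} (hK : 0 < K) (h1 : ‖(1 : 𝒜)‖ ≤ 1)
    (hS : ‖S‖ ≤ 1) (hc0 : 0 ≤ c) (hc1 : c ≤ 1) (hV : ‖V‖ ≤ K) (hV1 : V * (1 + S) = 1)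
    (hW : (1 + (c : ℂ) • S) * W = 1) : ‖W‖ ≤ 2 * K := by
  have hcn : ‖((1 - c : ℝ) : ℂ)‖ = 1 - c := by
    rw [Complex.norm_real, Real.norm_of_nonneg (by linarith)]
  have hcn' : ‖(c : ℂ)‖ = c := by
    rw [Complex.norm_real, Real.norm_of_nonneg hc0]
  have hSW : ‖S * W‖ ≤ ‖W‖ := (norm_mul_le _ _).trans
    (mul_le_of_le_one_left (norm_nonneg _) hS)
  have e1 : W = 1 - (c : ℂ) • (S * W) := by
    rw [← hW, add_mul, smul_mul_assoc]; simp
  have e2 : W = V * (1 + ((1 - c : ℝ) : ℂ) • (S * W)) := by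
    calc W = V * ((1 + S) * W) := by rw [← mul_assoc, hV1, one_mul]
      _ = V * (W + S * W) := by rw [add_mul, one_mul]
      _ = V * (1 - (c : ℂ) • (S * W) + S * W) := by rw [← e1]
      _ = _ := by
        congr 1
        push_cast
        rw [sub_smul, one_smul]; abel
  have b1 : ‖W‖ ≤ 1 + c * ‖W‖ := by
    calc ‖W‖ = ‖1 - (c : ℂ) • (S * W)‖ := by rw [← e1]
      _ ≤ 1 + c * ‖W‖ := by
        refine norm_sub_le_of_le h1 ?_
        rw [norm_smul, hcn']; gcongr
  have b2 : ‖W‖ ≤ K * (1 + (1 - c) * ‖W‖) := by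
    calc ‖W‖ = ‖V * (1 + ((1 - c : ℝ) : ℂ) • (S * W))‖ := by rw [← e2]
      _ ≤ ‖V‖ * ‖1 + ((1 - c : ℝ) : ℂ) • (S * W)‖ := norm_mul_le _ _
      _ ≤ K * (1 + (1 - c) * ‖W‖) := by
        gcongr
        refine norm_add_le_of_le h1 ?_
        rw [norm_smul, hcn]
        have : 0 ≤ 1 - c := by linarith
        gcongr
  nlinarith [norm_nonneg W]

variable [CompleteSpace 𝒜] (M : (ι → ℂ) →ₐ[ℂ] 𝒜)

theorem norm_map_integral_le {Ω : Type*} [MeasurableSpace Ω] {μ : Measure Ω}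
    {φ : Ω → ι → ℂ} {g : Ω → ℝ} (hφ : ∀ i, Integrable (fun u => φ u i) μ) (hg : Integrable g μ)
    (h : ∀ᵐ u ∂μ, ‖M (φ u)‖ ≤ g u) : ‖M (fun i => ∫ u, φ u i ∂μ)‖ ≤ ∫ u, g u ∂μ := by
  have e : (fun i => ∫ u, φ u i ∂μ) = ∫ u, φ u ∂μ := by
    ext i
    rw [eval_integral hφ]
  have := (LinearMap.toContinuousLinearMap M.toLinearMap).integral_comp_comm
    (Integrable.of_eval hφ)
  simp only [LinearMap.coe_toContinuousLinearMap', AlgHom.toLinearMap_apply] at this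
  rw [e, ← this]
  exact norm_integral_le_of_norm_le hg h

theorem norm_map_le_of_hasSum {φ : ℕ → ι → ℂ} {ψ : ι → ℂ} {g : ℕ → ℝ} {b : ℝ}
    (hφ : ∀ i, HasSum (fun j => φ j i) (ψ i)) (hg : HasSum g b)
    (h : ∀ j, ‖M (φ j)‖ ≤ g j) : ‖M ψ‖ ≤ b := by
  have h1 : HasSum φ ψ := Pi.hasSum.2 hφ
  have := h1.mapL (LinearMap.toContinuousLinearMap M.toLinearMap)
  simp only [LinearMap.coe_toContinuousLinearMap', AlgHom.toLinearMap_apply] at this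
  exact this.norm_le_of_bounded hg h

/-- A contraction semigroup `exp (-t d)` in a functional calculus `M` whose generator has
spectrum `-d`, such that the powers `(1 - exp (-t d)) ^ N` are bounded by `ρ`. -/
structure IsSemigroupCalculus (N : ℕ) (ρ : ℝ) (d : ι → ℝ) : Prop where
  nonneg : ∀ i, 0 ≤ d i
  norm_le : ∀ t : ℝ, 0 ≤ t → ‖M (fun i => (rexp (-(t * d i)) : ℂ))‖ ≤ 1
  pow_le : ∀ t : ℝ, 0 ≤ t → ‖(1 - M (fun i => (rexp (-(t * d i)) : ℂ))) ^ N‖ ≤ ρ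

namespace IsSemigroupCalculus

variable {M} {N : ℕ} {ρ : ℝ} {d : ι → ℝ}

theorem smul (H : IsSemigroupCalculus M N ρ d) {c : ℝ} (hc : 0 ≤ c) :
    IsSemigroupCalculus M N ρ (fun i => c * d i) where
  nonneg i := mul_nonneg hc (H.nonneg i)
  norm_le t ht := by simpa only [mul_assoc] using H.norm_le (t * c) (mul_nonneg ht hc)
  pow_le t ht := by simpa only [mul_assoc] using H.pow_le (t * c) (mul_nonneg ht hc)

theorem norm_one_le (H : IsSemigroupCalculus M N ρ d) : ‖(1 : 𝒜)‖ ≤ 1 := by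
  have := H.norm_le 0 le_rfl
  simp only [zero_mul, neg_zero, Real.exp_zero, Complex.ofReal_one] at this
  rwa [show (fun _ : ι => (1 : ℂ)) = 1 from rfl, map_one] at this

theorem norm_inv_one_add_smul_exp_le (H : IsSemigroupCalculus M N ρ d) (hρ : ρ < 2 ^ N)
    {c t : ℝ} (hc0 : 0 ≤ c) (hc1 : c ≤ 1) (ht : 0 ≤ t) :
    ‖M (fun i => (1 + (c : ℂ) * (rexp (-(t * d i)) : ℂ))⁻¹)‖
      ≤ 2 * ((N + 1) * 2 ^ N / (2 ^ N - ρ)) := by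
  have hpos : (0 : ℝ) < 2 ^ N - ρ := by linarith
  have hne : ∀ i, ∀ c : ℝ, 0 ≤ c → (1 + (c : ℂ) * (rexp (-(t * d i)) : ℂ)) ≠ 0 := by
    intro i c hc
    have : (0 : ℝ) < 1 + c * rexp (-(t * d i)) := by positivity
    exact_mod_cast this.ne'
  have hV : (1 + M (fun i => (rexp (-(t * d i)) : ℂ))) *
      M (fun i => (1 + (rexp (-(t * d i)) : ℂ))⁻¹) = 1 := by
    rw [← map_one M, ← map_add, ← map_mul]
    congr 1
    ext i
    have := hne i 1 zero_le_one
    simp only [Complex.ofReal_one, one_mul] at this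
    simp only [Pi.mul_apply, Pi.add_apply, Pi.one_apply]
    exact mul_inv_cancel₀ this
  have hV' : M (fun i => (1 + (rexp (-(t * d i)) : ℂ))⁻¹) *
      (1 + M (fun i => (rexp (-(t * d i)) : ℂ))) = 1 := by
    rw [← map_one M, ← map_add, ← map_mul, mul_comm, map_mul, map_add, map_one]
    exact hV
  refine norm_inv_one_add_smul_le (S := M (fun i => (rexp (-(t * d i)) : ℂ))) (by positivity)
    H.norm_one_le (H.norm_le t ht) hc0 hc1 ?_ hV' ?_
  · refine (norm_inv_one_add_le H.norm_one_le (H.norm_le t ht) (H.pow_le t ht) hρ hV).trans ?_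
    gcongr
    linarith
  · rw [← map_one M, ← map_smul, ← map_add, ← map_mul]
    congr 1
    ext i
    simp only [Pi.mul_apply, Pi.add_apply, Pi.one_apply, Pi.smul_apply, smul_eq_mul]
    exact mul_inv_cancel₀ (hne i c hc0)

theorem norm_cexp_mul_le (H : IsSemigroupCalculus M N ρ d) (z : ℂ) {u : ℝ} (hu : 0 ≤ u) :
    ‖M (fun i => Complex.exp (-(z + d i) * u))‖ ≤ rexp (-z.re * u) := by
  have e : (fun i => Complex.exp (-(z + d i) * u))
      = Complex.exp (-z * u) • (fun i => (rexp (-(u * d i)) : ℂ)) := by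
    ext i
    simp only [Pi.smul_apply, smul_eq_mul, Complex.ofReal_exp, ← Complex.exp_add]
    congr 1
    push_cast
    ring
  rw [e, map_smul, norm_smul, Complex.norm_exp]
  have : (-z * u).re = -z.re * u := by simp
  rw [this]
  exact mul_le_of_le_one_right (Real.exp_pos _).le (H.norm_le u hu)

/-- Sectorial resolvent bound in the right half plane (Kato). -/
theorem norm_resolvent_mul_le (H : IsSemigroupCalculus M N ρ d) (hρ : ρ < 2 ^ N) {z : ℂ}
    (hz : 0 < z.re) :
    ‖M (fun i => (z + d i)⁻¹)‖ * ‖z‖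
      ≤ 2 + 2 * π * (2 * ((N + 1) * 2 ^ N / (2 ^ N - ρ))) := by
  have hpos : (0 : ℝ) < 2 ^ N - ρ := by linarith
  set K : ℝ := 2 * ((N + 1) * 2 ^ N / (2 ^ N - ρ)) with hK
  have hK0 : 0 ≤ K := by positivity
  have hre : ∀ i, 0 < (z + d i).re := fun i => by
    have := H.nonneg i
    simp; linarith
  have hre' : ∀ i, (-(z + d i)).re < 0 := fun i => by
    rw [Complex.neg_re]
    linarith [hre i]
  have hne : ∀ i, z + d i ≠ 0 := fun i h => by simpa [h] using hre i
  have hzn : ‖z‖ ≤ |z.re| + |z.im| := Complex.norm_le_abs_re_add_abs_im z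
  rw [abs_of_pos hz] at hzn
  rcases le_or_gt |z.im| z.re with hc | hc
  · have hb : ‖M (fun i => (z + d i)⁻¹)‖ ≤ 1 / z.re := by
      have e : (fun i => (z + d i)⁻¹)
          = fun i => ∫ u in Set.Ioi (0 : ℝ), Complex.exp (-(z + d i) * u) := by
        ext i
        rw [integral_exp_mul_complex_Ioi (hre' i)]
        simp only [Complex.ofReal_zero, mul_zero, Complex.exp_zero, neg_div_neg_eq, one_div]
      have e2 : 1 / z.re = ∫ u in Set.Ioi (0 : ℝ), rexp (-z.re * u) := by
        rw [integral_exp_mul_Ioi (by linarith)]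
        simp [neg_div_neg_eq]
      rw [e, e2]
      refine norm_map_integral_le M (fun i => ?_) ?_ ?_
      · exact integrableOn_exp_mul_complex_Ioi (hre' i) 0
      · exact integrableOn_exp_mul_Ioi (by linarith) 0
      · filter_upwards [ae_restrict_mem measurableSet_Ioi] with u hu
        exact H.norm_cexp_mul_le z (le_of_lt hu)
    calc _ ≤ 1 / z.re * (2 * z.re) := by
          gcongr
          linarith
      _ = 2 := by field_simp
      _ ≤ _ := by
        have := Real.pi_pos
        have : 0 ≤ 2 * π * K := by positivity
        linarith
  · have him : 0 < |z.im| := hz.trans hc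
    set t : ℝ := π / |z.im| with ht
    have ht0 : 0 < t := div_pos Real.pi_pos him
    have hexp : Complex.exp (-z * t) = -(rexp (-(z.re * t)) : ℂ) := by
      have hcos : Real.cos (z.im * t) = -1 ∧ Real.sin (z.im * t) = 0 := by
        rcases abs_cases z.im with ⟨h1, h2⟩ | ⟨h1, h2⟩
        · have : z.im * t = π := by rw [ht, h1]; rw [h1] at him; field_simp
          simp [this]
        · have : z.im * t = -π := by
            rw [ht, h1]; rw [h1] at him
            have : z.im ≠ 0 := by linarith
            field_simp
          simp [this]
      apply Complex.ext
      · simp [Complex.exp_re, hcos.1]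
      · simp [Complex.exp_im, hcos.2]
    have e : (fun i => (z + d i)⁻¹)
        = (fun i => ∫ u in Set.Ioc (0 : ℝ) t, Complex.exp (-(z + d i) * u))
          * (fun i => (1 + (rexp (-(z.re * t)) : ℂ) * (rexp (-(t * d i)) : ℂ))⁻¹) := by
      ext i
      have h1 : (1 + (rexp (-(z.re * t)) : ℂ) * (rexp (-(t * d i)) : ℂ)) ≠ 0 := by
        have : (0 : ℝ) < 1 + rexp (-(z.re * t)) * rexp (-(t * d i)) := by positivity
        exact_mod_cast this.ne'
      simp only [Pi.mul_apply]
      rw [← intervalIntegral.integral_of_le ht0.le,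
        integral_exp_mul_complex (neg_ne_zero.2 (hne i)), eq_mul_inv_iff_mul_eq₀ h1]
      have h2 : Complex.exp (-(z + d i) * t)
          = -((rexp (-(z.re * t)) : ℂ) * (rexp (-(t * d i)) : ℂ)) := by
        rw [show -(z + d i) * t = -z * t + ((-(t * d i) : ℝ) : ℂ) by push_cast; ring,
          Complex.exp_add, hexp, Complex.ofReal_exp (-(t * d i))]
        ring
      rw [h2]
      have := hne i
      simp only [Complex.ofReal_zero, mul_zero, Complex.exp_zero]
      field_simp
      ring
    have hF : ‖M (fun i => ∫ u in Set.Ioc (0 : ℝ) t, Complex.exp (-(z + d i) * u))‖ ≤ t := by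
      have e2 : t = ∫ u in Set.Ioc (0 : ℝ) t, (1 : ℝ) := by simp [ht0.le]
      conv_rhs => rw [e2]
      refine norm_map_integral_le M (fun i => ?_) ?_ ?_
      · exact (Continuous.integrableOn_Icc (by fun_prop)).mono_set Set.Ioc_subset_Icc_self
      · simp
      · filter_upwards [ae_restrict_mem measurableSet_Ioc] with u hu
        refine (H.norm_cexp_mul_le z hu.1.le).trans ?_
        rw [Real.exp_le_one_iff]
        nlinarith [hu.1]
    have hW := H.norm_inv_one_add_smul_exp_le hρ (c := rexp (-(z.re * t))) (Real.exp_pos _).le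
      (by rw [Real.exp_le_one_iff]; nlinarith) ht0.le
    rw [e, map_mul]
    calc _ ≤ (t * K) * (2 * |z.im|) := by
          gcongr
          · exact (norm_mul_le _ _).trans (mul_le_mul hF hW (norm_nonneg _) ht0.le)
          · linarith
      _ = 2 * π * K := by rw [ht]; field_simp
      _ ≤ _ := by linarith

end IsSemigroupCalculus

theorem one_add_sq_le_norm_sq {c ξ : ℝ} (hc : 1 ≤ c) :
    1 + ξ ^ 2 ≤ ‖(c : ℂ) + 2 * π * ξ * Complex.I‖ ^ 2 := by
  have h : (c : ℂ) + 2 * π * ξ * Complex.I = (c : ℂ) + (2 * π * ξ : ℝ) * Complex.I := by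
    push_cast; ring
  rw [h, ← Complex.normSq_eq_norm_sq, Complex.normSq_add_mul_I]
  have h2 : 1 ≤ (2 * π) ^ 2 := by nlinarith [Real.pi_gt_three]
  nlinarith [sq_nonneg ξ]

theorem integrable_div_cube {c : ℝ} (hc : 1 ≤ c) :
    Integrable (fun ξ : ℝ => 2 / ((c : ℂ) + 2 * π * ξ * Complex.I) ^ 3) := by
  have hne : ∀ ξ : ℝ, (c : ℂ) + 2 * π * ξ * Complex.I ≠ 0 := fun ξ h => by
    have := one_add_sq_le_norm_sq (ξ := ξ) hc
    rw [h] at this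
    simp at this
    nlinarith [sq_nonneg ξ]
  refine (integrable_inv_one_add_sq.const_mul 2).mono' ?_ ?_
  · refine Continuous.aestronglyMeasurable ?_
    exact continuous_const.div (by fun_prop) fun ξ => pow_ne_zero 3 (hne ξ)
  · refine Eventually.of_forall fun ξ => ?_
    have h1 := one_add_sq_le_norm_sq (ξ := ξ) hc
    set w := ‖(c : ℂ) + 2 * π * ξ * Complex.I‖ with hw
    have hw1 : 1 ≤ w := by
      by_contra h
      have : 0 ≤ w := norm_nonneg _
      nlinarith [sq_nonneg ξ]
    rw [norm_div, norm_pow, ← hw, Complex.norm_ofNat, div_eq_mul_inv]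
    gcongr
    nlinarith [sq_nonneg w]

theorem integrableOn_sq_mul_cexp {w : ℂ} (hw : 1 ≤ w.re) :
    IntegrableOn (fun x : ℝ => (x : ℂ) ^ 2 * Complex.exp (-(w * x))) (Set.Ioi 0) := by
  have h1 : IntegrableOn (fun x : ℝ => x ^ (2 : ℝ) * rexp (-w.re * x)) (Set.Ioi 0) := by
    simpa using integrableOn_rpow_mul_exp_neg_mul_rpow (s := 2) (p := 1) (b := w.re)
      (by norm_num) one_pos (by linarith)
  refine Integrable.mono' h1 (by fun_prop) (Eventually.of_forall fun x => le_of_eq ?_)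
  simp [Complex.norm_exp]

theorem integral_sq_mul_cexp {w : ℂ} (hw : 1 ≤ w.re) :
    ∫ x in Set.Ioi (0 : ℝ), (x : ℂ) ^ 2 * Complex.exp (-(w * x)) = 2 / w ^ 3 := by
  have hw0 : w ≠ 0 := fun h => by norm_num [h] at hw
  have hlim : ∀ k : ℕ, Tendsto (fun x : ℝ => (x : ℂ) ^ k * Complex.exp (-(w * x))) atTop
      (nhds 0) := by
    intro k
    rw [tendsto_zero_iff_norm_tendsto_zero]
    refine squeeze_zero' (Eventually.of_forall fun _ => norm_nonneg _) ?_
      (Real.tendsto_pow_mul_exp_neg_atTop_nhds_zero k)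
    filter_upwards [eventually_ge_atTop 0] with x hx
    rw [norm_mul, norm_pow, Complex.norm_real, Real.norm_of_nonneg hx, Complex.norm_exp]
    have : (-(w * x)).re ≤ -x := by simp; nlinarith
    gcongr
  have h := integral_Ioi_of_hasDerivAt_of_tendsto' (a := 0)
    (f := fun x : ℝ => -(1 / w) * ((x : ℂ) ^ 2 * Complex.exp (-(w * x)))
      + -(2 / w ^ 2) * ((x : ℂ) ^ 1 * Complex.exp (-(w * x)))
      + -(2 / w ^ 3) * ((x : ℂ) ^ 0 * Complex.exp (-(w * x))))
    (f' := fun x : ℝ => (x : ℂ) ^ 2 * Complex.exp (-(w * x))) (m := 0) ?_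
    (integrableOn_sq_mul_cexp hw) ?_
  · rw [h]; simp
  · intro x _
    have hE : HasDerivAt (fun x : ℝ => Complex.exp (-(w * x))) (Complex.exp (-(w * x)) * -w) x := by
      simpa using ((((hasDerivAt_id x).ofReal_comp).const_mul w).fun_neg).cexp
    have hx : HasDerivAt (fun x : ℝ => (x : ℂ)) 1 x := by
      simpa using (hasDerivAt_id x).ofReal_comp
    have hp : ∀ k : ℕ, HasDerivAt (fun x : ℝ => (x : ℂ) ^ k) (k * (x : ℂ) ^ (k - 1)) x := by
      intro k
      simpa using hx.fun_pow k
    have := ((((hp 2).mul hE).const_mul (-(1 / w))).add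
      (((hp 1).mul hE).const_mul (-(2 / w ^ 2)))).add (((hp 0).mul hE).const_mul (-(2 / w ^ 3)))
    refine this.congr_deriv ?_
    simp
    field_simp
    ring
  · simpa using ((((hlim 2).const_mul (-(1 / w))).add
      ((hlim 1).const_mul (-(2 / w ^ 2)))).add ((hlim 0).const_mul (-(2 / w ^ 3))))

/-- Fourier inversion for `x ↦ x₊ ^ 2 * exp (-c x)` at the point `1`. -/
theorem exp_neg_eq_integral {c : ℝ} (hc : 1 ≤ c) :
    (rexp (-c) : ℂ) = ∫ ξ : ℝ, Complex.exp (2 * π * ξ * Complex.I) *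
      (2 / ((c : ℂ) + 2 * π * ξ * Complex.I) ^ 3) := by
  have hc0 : 0 < c := by linarith
  set f : ℝ → ℂ := fun x => (((max x 0) ^ 2 * rexp (-c * x) : ℝ) : ℂ) with hf
  have hfc : Continuous f := by fun_prop
  have hind : ∀ g : ℝ → ℂ, (∫ x, g x * f x) = ∫ x in Set.Ioi (0 : ℝ), g x * f x := by
    intro g
    rw [← integral_indicator measurableSet_Ioi]
    congr 1
    ext x
    by_cases hx : 0 < x
    · simp [Set.indicator, hx]
    · simp [Set.indicator, hx, hf, max_eq_right (not_lt.1 hx)]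
  have hfi : Integrable f := by
    have h2 : IntegrableOn f (Set.Ioi 0) := by
      refine (integrableOn_sq_mul_cexp (w := c) (by simpa using hc)).congr_fun (fun x hx => ?_)
        measurableSet_Ioi
      simp [hf, max_eq_left (le_of_lt (Set.mem_Ioi.1 hx))]
    refine (integrableOn_iff_integrable_of_support_subset ?_).1 h2
    intro x hx
    by_contra h
    apply hx
    simp [hf, max_eq_right (not_lt.1 (Set.mem_Ioi.not.1 h))]
  have hF : FourierTransform.fourier f
      = fun ξ : ℝ => 2 / ((c : ℂ) + 2 * π * ξ * Complex.I) ^ 3 := by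
    ext ξ
    rw [Real.fourier_eq']
    simp only [smul_eq_mul]
    rw [hind]
    rw [← integral_sq_mul_cexp (by simpa using hc)]
    refine setIntegral_congr_fun measurableSet_Ioi fun x hx => ?_
    have hx' : max x 0 = x := max_eq_left (le_of_lt (Set.mem_Ioi.1 hx))
    simp only [hf, hx']
    push_cast
    rw [mul_left_comm, ← Complex.exp_add]
    congr 2
    simp
    ring
  have hinv := hfc.fourierInv_fourier_eq hfi (by rw [hF]; exact integrable_div_cube hc)
  have h1 := congrFun hinv 1
  rw [Real.fourierInv_eq', hF] at h1
  simp only [smul_eq_mul] at h1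
  have h2 : f 1 = (rexp (-c) : ℂ) := by simp [hf]
  rw [← h2, ← h1]
  congr 1
  ext ξ
  congr 2
  simp

namespace IsSemigroupCalculus

variable {M} {N : ℕ} {ρ : ℝ} {d : ι → ℝ}

theorem norm_mul_exp_neg_le (H : IsSemigroupCalculus M N ρ d) (hρ : ρ < 2 ^ N) {C : ℝ}
    (hC : C = 2 + 2 * π * (2 * ((N + 1) * 2 ^ N / (2 ^ N - ρ)))) :
    ‖M (fun i => (d i : ℂ) * (rexp (-d i) : ℂ))‖ ≤ 2 * rexp 1 * (1 + C) * C ^ 2 * π := by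
  have hC0 : 0 ≤ C := by
    have : (0 : ℝ) < 2 ^ N - ρ := by linarith
    rw [hC]; positivity
  set φ : ℝ → ι → ℂ := fun ξ i => (rexp 1 : ℂ) * d i * (Complex.exp (2 * π * ξ * Complex.I) *
      (2 / (((1 + d i : ℝ) : ℂ) + 2 * π * ξ * Complex.I) ^ 3)) with hφ
  have hd1 : ∀ i, 1 ≤ 1 + d i := fun i => by linarith [H.nonneg i]
  have e : (fun i => (d i : ℂ) * (rexp (-d i) : ℂ)) = fun i => ∫ ξ, φ ξ i := by
    ext i
    simp only [hφ]
    rw [integral_const_mul, ← exp_neg_eq_integral (hd1 i), mul_assoc, mul_left_comm]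
    congr 1
    rw [← Complex.ofReal_mul, ← Real.exp_add]
    congr 2
    ring
  have e2 : 2 * rexp 1 * (1 + C) * C ^ 2 * π
      = ∫ ξ : ℝ, 2 * rexp 1 * (1 + C) * C ^ 2 * (1 + ξ ^ 2)⁻¹ := by
    rw [integral_const_mul, integral_univ_inv_one_add_sq]
  rw [e, e2]
  refine norm_map_integral_le M (fun i => ?_) (integrable_inv_one_add_sq.const_mul _)
    (Eventually.of_forall fun ξ => ?_)
  · refine Integrable.const_mul ?_ _
    refine (integrable_div_cube (hd1 i)).bdd_mul (c := 1) (by fun_prop)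
      (Eventually.of_forall fun ξ => ?_)
    rw [show (2 : ℂ) * π * ξ * Complex.I = ((2 * π * ξ : ℝ) : ℂ) * Complex.I by push_cast; ring,
      Complex.norm_exp_ofReal_mul_I]
  · set z : ℂ := ((1 : ℝ) : ℂ) + 2 * π * ξ * Complex.I with hz
    have hzre : z.re = 1 := by simp [hz]
    have hR := H.norm_resolvent_mul_le hρ (z := z) (by rw [hzre]; exact one_pos)
    rw [← hC] at hR
    have hz2 : 1 + ξ ^ 2 ≤ ‖z‖ ^ 2 := one_add_sq_le_norm_sq le_rfl
    have hz0 : 0 < ‖z‖ := by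
      rw [norm_pos_iff]
      intro h
      simp [h] at hzre
    set R : ι → ℂ := fun i => (z + d i)⁻¹ with hRdef
    have hne : ∀ i, z + d i ≠ 0 := fun i h => by
      have := congrArg Complex.re h
      simp [hzre] at this
      linarith [H.nonneg i]
    have hφR : φ ξ = ((rexp 1 : ℂ) * Complex.exp (2 * π * ξ * Complex.I) * 2) •
        ((1 - z • R) * R ^ 2) := by
      ext i
      simp only [hφ, Pi.smul_apply, Pi.mul_apply, Pi.sub_apply, Pi.one_apply, Pi.pow_apply,
        smul_eq_mul, hRdef]
      have h := hne i
      rw [show (((1 + d i : ℝ) : ℂ) + 2 * π * ξ * Complex.I) = z + d i by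
        rw [hz]; push_cast; ring]
      field_simp
      ring
    have hRn : ‖M R‖ ≤ C / ‖z‖ := by rwa [le_div_iff₀ hz0]
    have hb1 : ‖M (1 - z • R)‖ ≤ 1 + C := by
      rw [map_sub, map_one, map_smul]
      refine norm_sub_le_of_le H.norm_one_le ?_
      rw [norm_smul, mul_comm]
      exact hR
    rw [hφR, map_smul, norm_smul, map_mul, map_pow]
    have hcn : ‖(rexp 1 : ℂ) * Complex.exp (2 * π * ξ * Complex.I) * 2‖ = 2 * rexp 1 := by
      rw [show (2 : ℂ) * π * ξ * Complex.I = ((2 * π * ξ : ℝ) : ℂ) * Complex.I by push_cast; ring,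
        norm_mul, norm_mul, Complex.norm_exp_ofReal_mul_I, Complex.norm_real,
        Real.norm_of_nonneg (Real.exp_pos 1).le, Complex.norm_ofNat]
      ring
    rw [hcn]
    calc 2 * rexp 1 * ‖M (1 - z • R) * M R ^ 2‖
        ≤ 2 * rexp 1 * ((1 + C) * (C / ‖z‖) ^ 2) := by
          gcongr
          refine (norm_mul_le _ _).trans (mul_le_mul hb1 ?_ (norm_nonneg _) (by positivity))
          exact (norm_pow_le' _ two_pos).trans (by gcongr)
      _ = 2 * rexp 1 * (1 + C) * C ^ 2 * (‖z‖ ^ 2)⁻¹ := by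
          field_simp
      _ ≤ _ := by gcongr

theorem norm_pow_mul_exp_neg_le (H : IsSemigroupCalculus M N ρ d) {C : ℝ}
    (hC : ∀ t : ℝ, 0 ≤ t →
      ‖M (fun i => ((t * d i : ℝ) : ℂ) * (rexp (-(t * d i)) : ℂ))‖ ≤ C)
    {a : ℝ} (ha : 0 < a) (j : ℕ) :
    ‖M (fun i => (d i : ℂ) ^ j * (rexp (-(a * d i)) : ℂ))‖ ≤ (C * j / a) ^ j := by
  rcases Nat.eq_zero_or_pos j with rfl | hj
  · simpa using H.norm_le a ha.le
  have hj' : (0 : ℝ) < j := by exact_mod_cast hj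
  have e : (fun i => (d i : ℂ) ^ j * (rexp (-(a * d i)) : ℂ)) = (((j / a : ℝ) : ℂ) ^ j) •
      (fun i => ((a / j * d i : ℝ) : ℂ) * (rexp (-(a / j * d i)) : ℂ)) ^ j := by
    ext i
    simp only [Pi.smul_apply, Pi.pow_apply, smul_eq_mul]
    rw [mul_pow, ← mul_assoc, ← mul_pow]
    congr 1
    · rw [← Complex.ofReal_mul]
      congr 2
      field_simp
    · rw [← Complex.ofReal_pow, ← Real.exp_nat_mul]
      congr 2
      field_simp
  rw [e, map_smul, map_pow, norm_smul, norm_pow, Complex.norm_real,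
    Real.norm_of_nonneg (by positivity)]
  calc _ ≤ (j / a) ^ j * C ^ j := by
        gcongr
        exact (norm_pow_le' _ hj).trans (pow_le_pow_left₀ (norm_nonneg _) (hC _ (by positivity)) _)
    _ = _ := by rw [← mul_pow]; congr 1; ring

/-- Bounded analytic extension of the semigroup to a vertical segment. -/
theorem norm_exp_complex_le (H : IsSemigroupCalculus M N ρ d) {C : ℝ}
    (hC : ∀ t : ℝ, 0 ≤ t →
      ‖M (fun i => ((t * d i : ℝ) : ℂ) * (rexp (-(t * d i)) : ℂ))‖ ≤ C)
    {a b : ℝ} (ha : 0 < a) (hab : |b| * C * rexp 1 ≤ a / 2) :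
    ‖M (fun i => Complex.exp (-(a + b * Complex.I) * d i))‖ ≤ 2 := by
  have hC0 : 0 ≤ C := (norm_nonneg _).trans (hC 0 le_rfl)
  refine norm_map_le_of_hasSum M
    (φ := fun j i => ((-b * Complex.I) ^ j / (j.factorial : ℂ)) *
      ((d i : ℂ) ^ j * (rexp (-(a * d i)) : ℂ))) (fun i => ?_) hasSum_geometric_two (fun j => ?_)
  · have h1 := NormedSpace.expSeries_div_hasSum_exp (𝔸 := ℂ) (-b * Complex.I * d i)
    rw [← Complex.exp_eq_exp_ℂ] at h1
    have h2 := h1.mul_right (rexp (-(a * d i)) : ℂ)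
    have h3 : Complex.exp (-(a + b * Complex.I) * d i)
        = Complex.exp (-b * Complex.I * d i) * (rexp (-(a * d i)) : ℂ) := by
      rw [Complex.ofReal_exp, ← Complex.exp_add]
      congr 1
      push_cast
      ring
    rw [h3]
    refine Eq.subst (motive := fun F => HasSum F _) (funext fun j => ?_) h2
    rw [mul_pow _ (d i : ℂ)]
    ring
  · have e : (fun i => ((-b * Complex.I) ^ j / (j.factorial : ℂ)) *
      ((d i : ℂ) ^ j * (rexp (-(a * d i)) : ℂ))) = ((-b * Complex.I) ^ j / (j.factorial : ℂ)) •
      (fun i => (d i : ℂ) ^ j * (rexp (-(a * d i)) : ℂ)) := by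
      ext i; simp
    have hn : ‖(-b * Complex.I) ^ j / (j.factorial : ℂ)‖ = |b| ^ j / j.factorial := by
      simp
    rw [e, map_smul, norm_smul, hn]
    have hf : (j : ℝ) ^ j / j.factorial ≤ rexp 1 ^ j := by
      rw [← Real.exp_nat_mul, mul_one]
      exact Real.pow_div_factorial_le_exp _ (Nat.cast_nonneg j) j
    calc _ ≤ |b| ^ j / j.factorial * (C * j / a) ^ j := by
          gcongr
          exact H.norm_pow_mul_exp_neg_le hC ha j
      _ = (|b| * C / a) ^ j * ((j : ℝ) ^ j / j.factorial) := by
          rw [div_pow, div_pow, mul_pow, mul_pow]; ring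
      _ ≤ (|b| * C / a) ^ j * rexp 1 ^ j := by gcongr
      _ = (|b| * C * rexp 1 / a) ^ j := by rw [← mul_pow]; congr 1; ring
      _ ≤ (1 / 2) ^ j := by
          refine pow_le_pow_left₀ (by positivity) ?_ _
          rw [div_le_iff₀ ha]
          linarith

end IsSemigroupCalculus

theorem integral_exp_two_pi_mul (m : ℤ) :
    ∫ θ in Set.Ioc (0 : ℝ) (2 * π), Complex.exp (m * Complex.I * θ)
      = if m = 0 then (2 * π : ℂ) else 0 := by
  rw [← intervalIntegral.integral_of_le (by positivity)]
  split_ifs with h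
  · simp [h]
  · rw [integral_exp_mul_complex (by simp [h])]
    have : Complex.exp (m * Complex.I * ((2 * π : ℝ) : ℂ)) = 1 := by
      rw [Complex.exp_eq_one_iff]
      exact ⟨m, by push_cast; ring⟩
    rw [this]
    simp

namespace IsSemigroupCalculus

variable {M} {N : ℕ} {ρ : ℝ} {d : ι → ℕ}

/-- Boundedness of the spectral projections (Pisier's `K`-convexity theorem). -/
theorem norm_proj_le (H : IsSemigroupCalculus M N ρ (fun i => (d i : ℝ))) {C : ℝ}
    (hC : ∀ t : ℝ, 0 ≤ t →
      ‖M (fun i => ((t * d i : ℝ) : ℂ) * (rexp (-(t * d i)) : ℂ))‖ ≤ C)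
    {a : ℝ} (ha : 0 < a) (hab : 2 * π * C * rexp 1 ≤ a / 2) (k : ℕ) :
    ‖M (fun i => if d i = k then 1 else 0)‖ ≤ 2 * rexp (k * a) := by
  have hC0 : 0 ≤ C := (norm_nonneg _).trans (hC 0 le_rfl)
  have hpi := Real.pi_pos
  set c : ℂ := (rexp (k * a) : ℂ) / (2 * π) with hc
  have hcn : ‖c‖ = rexp (k * a) / (2 * π) := by
    rw [hc, show (rexp (k * a) : ℂ) / (2 * π) = ((rexp (k * a) / (2 * π) : ℝ) : ℂ) by push_cast; rfl,
      Complex.norm_real, Real.norm_of_nonneg (by positivity)]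
  have e : (fun i => if d i = k then (1 : ℂ) else 0) = fun i =>
      ∫ θ in Set.Ioc (0 : ℝ) (2 * π), c * Complex.exp (k * θ * Complex.I) *
        Complex.exp (-(a + θ * Complex.I) * d i) := by
    ext i
    have e1 : ∀ θ : ℝ, c * Complex.exp (k * θ * Complex.I) *
        Complex.exp (-(a + θ * Complex.I) * d i) = (c * (rexp (-(a * d i)) : ℂ)) *
          Complex.exp (((k - d i : ℤ) : ℂ) * Complex.I * θ) := by
      intro θ
      rw [mul_assoc c, mul_assoc c, ← Complex.exp_add, Complex.ofReal_exp, ← Complex.exp_add]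
      congr 2
      push_cast
      ring
    simp only [e1]
    rw [integral_const_mul, integral_exp_two_pi_mul]
    by_cases hk : d i = k
    · have : (rexp (k * a) : ℂ) * (rexp (-(a * k)) : ℂ) = 1 := by
        rw [← Complex.ofReal_mul, ← Real.exp_add]
        simp [mul_comm]
      have hpi' : (π : ℂ) ≠ 0 := by exact_mod_cast hpi.ne'
      simp only [hk, sub_self, if_true, hc]
      rw [div_mul_eq_mul_div, this]
      field_simp
    · have : ((k : ℤ) - d i) ≠ 0 := by omega
      simp [hk, this]
  have e2 : 2 * rexp (k * a)
      = ∫ θ in Set.Ioc (0 : ℝ) (2 * π), rexp (k * a) / (2 * π) * 2 := by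
    simp [hpi.le]
    field_simp
  rw [e, e2]
  refine norm_map_integral_le M (fun i => ?_) (integrable_const _) ?_
  · exact (Continuous.integrableOn_Icc (by fun_prop)).mono_set Set.Ioc_subset_Icc_self
  · filter_upwards [ae_restrict_mem measurableSet_Ioc] with θ hθ
    have e3 : (fun i => c * Complex.exp (k * θ * Complex.I) *
        Complex.exp (-(a + θ * Complex.I) * d i)) = (c * Complex.exp (k * θ * Complex.I)) •
        (fun i => Complex.exp (-(a + θ * Complex.I) * ((d i : ℝ) : ℂ))) := by
      ext i; simp
    rw [e3, map_smul, norm_smul, norm_mul, hcn]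
    have : ‖Complex.exp (k * θ * Complex.I)‖ = 1 := by
      rw [show (k : ℂ) * θ * Complex.I = ((k * θ : ℝ) : ℂ) * Complex.I by push_cast; ring,
        Complex.norm_exp_ofReal_mul_I]
    rw [this, mul_one]
    gcongr
    refine H.norm_exp_complex_le hC ha (le_trans ?_ hab)
    rw [abs_of_pos hθ.1]
    gcongr
    exact hθ.2

theorem norm_tail_le (H : IsSemigroupCalculus M N ρ (fun i => (d i : ℝ))) {a : ℝ}
    (hproj : ∀ k : ℕ, ‖M (fun i => if d i = k then 1 else 0)‖ ≤ 2 * rexp (k * a)) (m : ℕ) :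
    ‖M (fun i => if m ≤ d i then 1 else 0)‖ ≤ 1 + ∑ k ∈ range m, 2 * rexp (k * a) := by
  have e : (fun i => if m ≤ d i then (1 : ℂ) else 0)
      = 1 - ∑ k ∈ range m, fun i => if d i = k then (1 : ℂ) else 0 := by
    ext i
    by_cases h : m ≤ d i
    · simp [h, h.not_gt]
    · simp [h, not_le.1 h]
  rw [e, map_sub, map_one, map_sum]
  have h1 := H.norm_one_le
  refine (norm_sub_le _ _).trans (add_le_add h1 ?_)
  exact norm_sum_le_of_le _ fun k _ => hproj k

theorem norm_tail_exp_le (H : IsSemigroupCalculus M N ρ (fun i => (d i : ℝ))) {a : ℝ}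
    (hproj : ∀ k : ℕ, ‖M (fun i => if d i = k then 1 else 0)‖ ≤ 2 * rexp (k * a)) {m : ℕ}
    (hm : 1 ≤ m) {t : ℝ} (ht : 0 ≤ t) :
    ‖M (fun i => if m ≤ d i then (rexp (-(t * d i)) : ℂ) else 0)‖
      ≤ ((1 + ∑ k ∈ range m, 2 * rexp (k * a)) * rexp (m * (a + 1)) + 4 * rexp (m * a))
        * rexp (-(t * m)) := by
  have hm' : (1 : ℝ) ≤ m := by exact_mod_cast hm
  set T₀ : ℝ := 1 + ∑ k ∈ range m, 2 * rexp (k * a) with hT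
  have hT0 : 0 ≤ T₀ := by positivity
  rw [add_mul, mul_assoc, mul_assoc, ← Real.exp_add, ← Real.exp_add]
  rcases le_total t (a + 1) with h | h
  · have e : (fun i => if m ≤ d i then (rexp (-(t * d i)) : ℂ) else 0)
        = (fun i => if m ≤ d i then (1 : ℂ) else 0) * fun i => (rexp (-(t * d i)) : ℂ) := by
      ext i
      simp
    rw [e, map_mul]
    calc _ ≤ T₀ * 1 := (norm_mul_le _ _).trans
          (mul_le_mul (H.norm_tail_le hproj m) (H.norm_le t ht) (norm_nonneg _) hT0)
      _ ≤ T₀ * rexp (m * (a + 1) + -(t * m)) := by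
          gcongr
          rw [Real.one_le_exp_iff]
          nlinarith
      _ ≤ _ := le_add_of_nonneg_right (by positivity)
  · refine le_trans ?_ (le_add_of_nonneg_left (by positivity))
    refine norm_map_le_of_hasSum M
      (φ := fun j i => (rexp (-(t * (m + j : ℕ))) : ℂ) * if d i = m + j then 1 else 0)
      (g := fun j => 2 * rexp (m * a + -(t * m)) * (1 / 2) ^ j) (fun i => ?_) ?_ (fun j => ?_)
    · by_cases hi : m ≤ d i
      · simp only [hi, if_true]
        have := hasSum_single (f := fun j => (rexp (-(t * (m + j : ℕ))) : ℂ) *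
          if d i = m + j then 1 else 0) (d i - m) (fun j hj => by
            have : d i ≠ m + j := by omega
            simp [this])
        simpa [Nat.add_sub_cancel' hi] using this
      · have : ∀ j, d i ≠ m + j := fun j => by omega
        simp [hi, this, hasSum_zero]
    · have := hasSum_geometric_two.mul_left (2 * rexp (m * a + -(t * m)))
      rwa [show 4 * rexp (m * a + -(t * m)) = 2 * rexp (m * a + -(t * m)) * 2 by ring]
    · have e : (fun i => (rexp (-(t * (m + j : ℕ))) : ℂ) * if d i = m + j then (1 : ℂ) else 0)
          = (rexp (-(t * (m + j : ℕ))) : ℂ) • fun i => if d i = m + j then (1 : ℂ) else 0 := by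
        ext i
        simp
      rw [e, map_smul, norm_smul, Complex.norm_real, Real.norm_of_nonneg (Real.exp_pos _).le]
      have h2 : rexp (-(t - a)) ≤ 1 / 2 := by
        have h3 : (2 : ℝ) ≤ rexp 1 := by linarith [Real.add_one_le_exp (1 : ℝ)]
        calc rexp (-(t - a)) ≤ rexp (-1) := Real.exp_le_exp.2 (by linarith)
          _ ≤ 1 / 2 := by
            rw [Real.exp_neg, ← one_div]
            exact one_div_le_one_div_of_le (by norm_num) h3
      calc _ ≤ rexp (-(t * (m + j : ℕ))) * (2 * rexp ((m + j : ℕ) * a)) := by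
            gcongr
            exact hproj _
        _ = 2 * rexp (m * a + -(t * m)) * rexp (-(t - a)) ^ j := by
            rw [← Real.exp_nat_mul, mul_assoc, ← Real.exp_add, mul_left_comm, ← Real.exp_add]
            congr 2
            push_cast
            ring
        _ ≤ _ := by gcongr

theorem norm_tail_rpow_le {K : ℝ} {m : ℕ} (hm : 1 ≤ m)
    (hK : ∀ t : ℝ, 0 ≤ t → ‖M (fun i => if m ≤ d i then (rexp (-(t * d i)) : ℂ) else 0)‖
      ≤ K * rexp (-(t * m))) {γ : ℝ} (hγ : 0 ≤ γ) :
    ‖M (fun i => if m ≤ d i then (((d i : ℝ) ^ (-γ) : ℝ) : ℂ) else 0)‖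
      ≤ K * (m : ℝ) ^ (-γ) := by
  have hm' : (0 : ℝ) < m := by exact_mod_cast hm
  rcases hγ.eq_or_lt with rfl | hγ
  · simpa using hK 0 le_rfl
  have hΓ := Real.Gamma_pos_of_pos hγ
  have key : ∀ k : ℝ, 0 < k → k ^ (-γ)
      = ∫ t in Set.Ioi (0 : ℝ), (Real.Gamma γ)⁻¹ * (t ^ (γ - 1) * rexp (-(k * t))) := by
    intro k hk
    rw [integral_const_mul, Real.integral_rpow_mul_exp_neg_mul_Ioi hγ hk, one_div,
      Real.inv_rpow hk.le, Real.rpow_neg hk.le]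
    field_simp
  have hint : ∀ k : ℝ, 0 < k → IntegrableOn (fun t : ℝ => (Real.Gamma γ)⁻¹ *
      (t ^ (γ - 1) * rexp (-(k * t)))) (Set.Ioi 0) := by
    intro k hk
    refine Integrable.const_mul ?_ _
    have := integrableOn_rpow_mul_exp_neg_mul_rpow (p := 1) (s := γ - 1) (b := k) (by linarith)
      one_pos hk
    simpa [neg_mul, IntegrableOn] using this
  have e : (fun i => if m ≤ d i then (((d i : ℝ) ^ (-γ) : ℝ) : ℂ) else 0)
      = fun i => ∫ t in Set.Ioi (0 : ℝ), (((Real.Gamma γ)⁻¹ * t ^ (γ - 1) : ℝ) : ℂ) *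
        if m ≤ d i then (rexp (-(t * d i)) : ℂ) else 0 := by
    ext i
    by_cases hi : m ≤ d i
    · have hd : (0 : ℝ) < d i := by exact_mod_cast hm.trans hi
      simp only [hi, if_true]
      rw [key _ hd, ← integral_complex_ofReal]
      congr 1
      ext t
      rw [← Complex.ofReal_mul, mul_assoc, mul_comm t]
    · simp [hi]
  rw [e, key _ hm', ← integral_const_mul]
  refine norm_map_integral_le M (fun i => ?_) ((hint _ hm').const_mul _) ?_
  · by_cases hi : m ≤ d i
    · have hd : (0 : ℝ) < d i := by exact_mod_cast hm.trans hi
      simp only [hi, if_true]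
      refine (hint _ hd).ofReal.congr (Eventually.of_forall fun t => ?_)
      simp only [Complex.coe_algebraMap]
      rw [← Complex.ofReal_mul, mul_assoc, mul_comm t]
    · simp [hi]
  · filter_upwards [ae_restrict_mem measurableSet_Ioi] with t ht
    have ht0 : 0 ≤ t := le_of_lt ht
    have e2 : (fun i => (((Real.Gamma γ)⁻¹ * t ^ (γ - 1) : ℝ) : ℂ) *
        if m ≤ d i then (rexp (-(t * d i)) : ℂ) else 0)
        = (((Real.Gamma γ)⁻¹ * t ^ (γ - 1) : ℝ) : ℂ) •
          fun i => if m ≤ d i then (rexp (-(t * d i)) : ℂ) else 0 := rfl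
    have hp := Real.rpow_nonneg ht0 (γ - 1)
    rw [e2, map_smul, norm_smul, Complex.norm_real, Real.norm_of_nonneg (by positivity)]
    calc _ ≤ (Real.Gamma γ)⁻¹ * t ^ (γ - 1) * (K * rexp (-(t * m))) := by
          gcongr
          exact hK t ht0
      _ = _ := by rw [mul_comm t]; ring

theorem norm_tail_powerSeries_le {K : ℝ} {m : ℕ} (hm : 1 ≤ m)
    (hK : ∀ t : ℝ, 0 ≤ t → ‖M (fun i => if m ≤ d i then (rexp (-(t * d i)) : ℂ) else 0)‖
      ≤ K * rexp (-(t * m))) {α : ℝ} (hα : 0 ≤ α) {h : ℂ → ℂ} {c : ℕ → ℂ}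
    (hc : ∀ z : ℂ, ‖z‖ ≤ (m : ℝ) ^ (-α) → HasSum (fun j => c j * z ^ j) (h z))
    (hs : Summable fun j => ‖c j‖ * ((m : ℝ) ^ (-α)) ^ j) :
    ‖M (fun i => if m ≤ d i then h (((d i : ℝ) ^ (-α) : ℝ) : ℂ) else 0)‖
      ≤ K * ∑' j, ‖c j‖ * ((m : ℝ) ^ (-α)) ^ j := by
  have hm' : (0 : ℝ) < m := by exact_mod_cast hm
  have hpow : ∀ (x : ℝ) (j : ℕ), 0 ≤ x → x ^ (-(α * j)) = (x ^ (-α)) ^ j := fun x j hx => by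
    rw [← Real.rpow_natCast, ← Real.rpow_mul hx, neg_mul]
  refine norm_map_le_of_hasSum M
    (φ := fun j => c j • fun i => if m ≤ d i then (((d i : ℝ) ^ (-(α * j)) : ℝ) : ℂ) else 0)
    (fun i => ?_) (hs.hasSum.mul_left K) (fun j => ?_)
  · by_cases hi : m ≤ d i
    · have hd : (m : ℝ) ≤ d i := by exact_mod_cast hi
      have := hc (((d i : ℝ) ^ (-α) : ℝ) : ℂ) (by
        rw [Complex.norm_real, Real.norm_of_nonneg (by positivity)]
        exact Real.rpow_le_rpow_of_nonpos hm' hd (by linarith))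
      simpa [hi, hpow] using this
    · simp [hi, hasSum_zero]
  · rw [map_smul, norm_smul]
    have := norm_tail_rpow_le hm hK (γ := α * j) (by positivity)
    rw [hpow _ _ hm'.le] at this
    calc _ ≤ ‖c j‖ * (K * ((m : ℝ) ^ (-α)) ^ j) := by gcongr
      _ = _ := by ring

end IsSemigroupCalculus

end Calculus

theorem exists_powerSeries_of_differentiableOn_ball {h : ℂ → ℂ} {r x : ℝ}
    (hh : DifferentiableOn ℂ h (Metric.ball 0 r)) (hx : 0 ≤ x) (hxr : x < r) :
    ∃ c : ℕ → ℂ, (∀ z : ℂ, ‖z‖ ≤ x → HasSum (fun j => c j * z ^ j) (h z)) ∧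
      Summable fun j => ‖c j‖ * x ^ j := by
  obtain ⟨y, hxy, hyr⟩ := exists_between hxr
  lift y to NNReal using hx.trans hxy.le
  have hy : 0 < y := by exact_mod_cast hx.trans_lt hxy
  have hp := (hh.mono (Metric.closedBall_subset_ball hyr)).hasFPowerSeriesOnBall hy
  refine ⟨(cauchyPowerSeries h 0 y).coeff, fun z hz => ?_, ?_⟩
  · have := hp.hasSum (y := z) (by
      rw [Metric.eball_coe]
      simpa using hz.trans_lt hxy)
    simpa [mul_comm] using this
  · lift x to NNReal using hx
    have := (cauchyPowerSeries h 0 y).summable_norm_mul_pow (r := x)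
      (lt_of_lt_of_le (by exact_mod_cast hxy) hp.r_le)
    simpa using this

/-- Uniform boundedness of `h (d ^ (-α))` in functional calculi of bounded analytic semigroups
with integer spectrum. -/
theorem IsSemigroupCalculus.exists_norm_holomorphic_le {N : ℕ} {ρ : ℝ} (hρ : ρ < 2 ^ N) {h : ℂ → ℂ}
    {r α : ℝ} (hr : 0 < r) (hα : 0 < α) (hh : DifferentiableOn ℂ h (Metric.ball 0 r)) :
    ∃ C : ℝ, 0 < C ∧ ∀ {ι : Type*} [Fintype ι] {𝒜 : Type*} [NormedRing 𝒜] [NormedAlgebra ℂ 𝒜]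
      [CompleteSpace 𝒜] (M : (ι → ℂ) →ₐ[ℂ] 𝒜) (d : ι → ℕ),
      IsSemigroupCalculus M N ρ (fun i => (d i : ℝ)) →
      ‖M (fun i => if r ^ (-1 / α) < (d i : ℝ) then h (((d i : ℝ) ^ (-α) : ℝ) : ℂ) else 0)‖
        ≤ C := by
  set C₁ : ℝ := 2 + 2 * π * (2 * ((N + 1) * 2 ^ N / (2 ^ N - ρ))) with hC₁
  set C₂ : ℝ := 2 * rexp 1 * (1 + C₁) * C₁ ^ 2 * π with hC₂
  have hpos : (0 : ℝ) < 2 ^ N - ρ := by linarith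
  have hC₁0 : 0 ≤ C₁ := by positivity
  have hC₂0 : 0 ≤ C₂ := by positivity
  set a : ℝ := 2 * (2 * π * C₂ * rexp 1) + 1 with ha
  have ha0 : 0 < a := by positivity
  set m : ℕ := ⌊r ^ (-1 / α)⌋₊ + 1 with hm
  have hm1 : 1 ≤ m := by omega
  have hm0 : (0 : ℝ) < m := by exact_mod_cast hm1
  have hr0 : 0 < r ^ (-1 / α) := by positivity
  have hmr : (m : ℝ) ^ (-α) < r := by
    have h1 : r ^ (-1 / α) < m := by
      rw [hm, Nat.cast_add_one]
      exact Nat.lt_floor_add_one _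
    have h2 := Real.rpow_lt_rpow_of_neg hr0 h1 (neg_neg_of_pos hα)
    rwa [← Real.rpow_mul hr.le, show -1 / α * -α = 1 by field_simp, Real.rpow_one] at h2
  have hiff : ∀ k : ℕ, r ^ (-1 / α) < (k : ℝ) ↔ m ≤ k := fun k => by
    rw [hm, Nat.add_one_le_iff, Nat.floor_lt hr0.le]
  obtain ⟨c, hc, hs⟩ := exists_powerSeries_of_differentiableOn_ball hh (by positivity) hmr
  set K : ℝ := (1 + ∑ k ∈ range m, 2 * rexp (k * a)) * rexp (m * (a + 1)) + 4 * rexp (m * a)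
    with hK
  have hK0 : 0 < K := by positivity
  have hS0 : 0 ≤ ∑' j, ‖c j‖ * ((m : ℝ) ^ (-α)) ^ j := tsum_nonneg fun j => by positivity
  refine ⟨K * ∑' j, ‖c j‖ * ((m : ℝ) ^ (-α)) ^ j + 1, by positivity, ?_⟩
  intro ι _ 𝒜 _ _ _ M d H
  simp only [hiff]
  refine le_add_of_le_of_nonneg ?_ zero_le_one
  refine IsSemigroupCalculus.norm_tail_powerSeries_le hm1 (fun t ht => ?_) hα.le hc hs
  refine H.norm_tail_exp_le (fun k => ?_) hm1 ht
  refine H.norm_proj_le (fun t ht => ?_) ha0 ?_ k (C := C₂)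
  · exact (H.smul ht).norm_mul_exp_neg_le hρ hC₁
  · rw [ha]; linarith

theorem Real.rpow_sum_le_sum_rpow {ι : Type*} (s : Finset ι) {a : ι → ℝ} (ha : ∀ i, 0 ≤ a i)
    {θ : ℝ} (h0 : 0 < θ) (h1 : θ ≤ 1) : (∑ i ∈ s, a i) ^ θ ≤ ∑ i ∈ s, a i ^ θ := by
  classical
  induction s using Finset.induction_on with
  | empty => simp [h0.ne']
  | insert i s hi ih =>
    rw [sum_insert hi, sum_insert hi]
    have h2 := NNReal.rpow_add_le_add_rpow ⟨a i, ha i⟩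
      ⟨∑ j ∈ s, a j, sum_nonneg fun j _ => ha j⟩ h0.le h1
    have h3 : (a i + ∑ j ∈ s, a j) ^ θ ≤ a i ^ θ + (∑ j ∈ s, a j) ^ θ := by
      exact_mod_cast h2
    linarith

/-- `E` has Rademacher type `s` with constant `T`. -/
def HasRademacherType (E : Type*) [NormedAddCommGroup E] [NormedSpace ℝ E] (s T : ℝ) : Prop :=
  ∀ (m : ℕ) (v : Fin m → E), (2 ^ m : ℝ)⁻¹ * ∑ ε : Cube m, ‖∑ i, sgn' (ε i) • v i‖ ^ s
    ≤ T ^ s * ∑ i, ‖v i‖ ^ s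

theorem abs_sgn' (b : Bool) : |sgn' b| = 1 := by
  cases b <;> simp [sgn']

section RademacherType

variable {E : Type*} [NormedAddCommGroup E] [NormedSpace ℝ E] {s T : ℝ}

theorem HasRademacherType.of_le (H : HasRademacherType E s T) (hT : 0 ≤ T) {s' : ℝ} (h0 : 0 < s')
    (hs : s' ≤ s) : HasRademacherType E s' T := by
  intro m v
  have hs0 : 0 < s := h0.trans_le hs
  have h1 : (1 : ℝ) ≤ s / s' := (one_le_div h0).2 hs
  have hJ := Real.rpow_arith_mean_le_arith_mean_rpow (univ : Finset (Cube m))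
    (fun _ => (2 ^ m : ℝ)⁻¹) (fun ε => ‖∑ i, sgn' (ε i) • v i‖ ^ s')
    (fun _ _ => by positivity) (by simp) (fun _ _ => by positivity) h1
  simp only [← mul_sum, ← Real.rpow_mul (norm_nonneg _), mul_div_cancel₀ s h0.ne'] at hJ
  have h2 := hJ.trans (H m v)
  have h3 := Real.rpow_le_rpow (by positivity) h2 (z := s' / s) (by positivity)
  rw [← Real.rpow_mul (by positivity), show s / s' * (s' / s) = 1 by field_simp, Real.rpow_one,
    Real.mul_rpow (by positivity) (by positivity), ← Real.rpow_mul hT,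
    mul_div_cancel₀ s' hs0.ne'] at h3
  refine h3.trans ?_
  gcongr
  refine (Real.rpow_sum_le_sum_rpow _ (fun i => by positivity) (by positivity)
    ((div_le_one hs0).2 hs)).trans (le_of_eq ?_)
  refine sum_congr rfl fun i _ => ?_
  rw [← Real.rpow_mul (norm_nonneg _), mul_div_cancel₀ s' hs0.ne']

theorem rpow_sum_mul_sum_rpow_le {N : ℕ} {a : Fin N → ℝ} (ha : ∀ i, 0 ≤ a i) {s p : ℝ}
    (hs : 1 ≤ s) (hsp : s ≤ p) :
    (∑ i, a i) ^ (p - s) * ∑ i, a i ^ s ≤ (N : ℝ) ^ (p - s) * ∑ i, a i ^ p := by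
  rcases Nat.eq_zero_or_pos N with rfl | hN
  · simp
  have hN' : (0 : ℝ) < N := by exact_mod_cast hN
  have hs0 : 0 < s := by linarith
  have hp0 : 0 < p := by linarith
  set Q : ℝ := (N : ℝ)⁻¹ * ∑ i, a i ^ p with hQ
  have hQ0 : 0 ≤ Q := mul_nonneg (by positivity) (sum_nonneg fun i _ => Real.rpow_nonneg (ha i) _)
  have hw : ∑ _i : Fin N, (N : ℝ)⁻¹ = 1 := by simp [hN'.ne']
  have h1 : ((N : ℝ)⁻¹ * ∑ i, a i) ^ p ≤ Q := by
    have := Real.rpow_arith_mean_le_arith_mean_rpow (univ : Finset (Fin N))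
      (fun _ => (N : ℝ)⁻¹) a (fun _ _ => by positivity) hw (fun i _ => ha i)
      (hs.trans hsp)
    simpa only [← mul_sum] using this
  have h2 : ((N : ℝ)⁻¹ * ∑ i, a i ^ s) ^ (p / s) ≤ Q := by
    have := Real.rpow_arith_mean_le_arith_mean_rpow (univ : Finset (Fin N))
      (fun _ => (N : ℝ)⁻¹) (fun i => a i ^ s) (fun _ _ => by positivity) hw
      (fun i _ => Real.rpow_nonneg (ha i) _) ((one_le_div hs0).2 hsp)
    simpa only [← mul_sum, ← Real.rpow_mul (ha _), mul_div_cancel₀ p hs0.ne'] using this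
  have hA0 : 0 ≤ (N : ℝ)⁻¹ * ∑ i, a i := mul_nonneg (by positivity) (sum_nonneg fun i _ => ha i)
  have hB0 : 0 ≤ (N : ℝ)⁻¹ * ∑ i, a i ^ s :=
    mul_nonneg (by positivity) (sum_nonneg fun i _ => Real.rpow_nonneg (ha i) _)
  have h3 : ((N : ℝ)⁻¹ * ∑ i, a i) ^ (p - s) ≤ Q ^ ((p - s) / p) := by
    have := Real.rpow_le_rpow (by positivity) h1 (z := (p - s) / p)
      (div_nonneg (by linarith) hp0.le)
    rwa [← Real.rpow_mul hA0, mul_div_cancel₀ _ hp0.ne'] at this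
  have h4 : (N : ℝ)⁻¹ * ∑ i, a i ^ s ≤ Q ^ (s / p) := by
    have := Real.rpow_le_rpow (by positivity) h2 (z := s / p) (by positivity)
    rwa [← Real.rpow_mul hB0, show p / s * (s / p) = 1 by field_simp, Real.rpow_one] at this
  have h5 := mul_le_mul h3 h4 hB0 (by positivity)
  rw [← Real.rpow_add_of_nonneg hQ0 (div_nonneg (by linarith) hp0.le) (by positivity),
    show (p - s) / p + s / p = 1 by field_simp; ring, Real.rpow_one, hQ,
    Real.mul_rpow (by positivity) (sum_nonneg fun i _ => ha i), Real.inv_rpow hN'.le] at h5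
  have h6 : 0 < (N : ℝ) ^ (p - s) := by positivity
  calc _ = (N : ℝ) ^ (p - s) * N * (((N : ℝ) ^ (p - s))⁻¹ * (∑ i, a i) ^ (p - s) *
        ((N : ℝ)⁻¹ * ∑ i, a i ^ s)) := by field_simp
    _ ≤ (N : ℝ) ^ (p - s) * N * ((N : ℝ)⁻¹ * ∑ i, a i ^ p) := by gcongr
    _ = _ := by field_simp

theorem HasRademacherType.sum_rpow_le (H : HasRademacherType E s T) (hT : 0 ≤ T) (hs : 1 ≤ s)
    {p : ℝ} (hsp : s ≤ p) {N : ℕ} (v : Fin N → E) :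
    ∑ ε : Cube N, ‖∑ i, sgn' (ε i) • v i‖ ^ p
      ≤ 2 ^ N * ((N : ℝ) ^ (p - s) * T ^ s * ∑ i, ‖v i‖ ^ p) := by
  have h1 : ∀ ε : Cube N, ‖∑ i, sgn' (ε i) • v i‖ ^ p
      ≤ (∑ i, ‖v i‖) ^ (p - s) * ‖∑ i, sgn' (ε i) • v i‖ ^ s := fun ε => by
    have h2 : ‖∑ i, sgn' (ε i) • v i‖ ≤ ∑ i, ‖v i‖ :=
      norm_sum_le_of_le _ fun i _ => by simp [norm_smul, abs_sgn']
    calc _ = ‖∑ i, sgn' (ε i) • v i‖ ^ (p - s) * ‖∑ i, sgn' (ε i) • v i‖ ^ s := by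
          rw [← Real.rpow_add_of_nonneg (norm_nonneg _) (by linarith) (by linarith),
            sub_add_cancel]
      _ ≤ _ := by
          gcongr
  have h3 := H N v
  rw [inv_mul_le_iff₀ (by positivity)] at h3
  calc _ ≤ ∑ ε : Cube N, (∑ i, ‖v i‖) ^ (p - s) * ‖∑ i, sgn' (ε i) • v i‖ ^ s :=
        sum_le_sum fun ε _ => h1 ε
    _ = (∑ i, ‖v i‖) ^ (p - s) * ∑ ε : Cube N, ‖∑ i, sgn' (ε i) • v i‖ ^ s := by rw [mul_sum]
    _ ≤ (∑ i, ‖v i‖) ^ (p - s) * (2 ^ N * (T ^ s * ∑ i, ‖v i‖ ^ s)) := by gcongr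
    _ = 2 ^ N * T ^ s * ((∑ i, ‖v i‖) ^ (p - s) * ∑ i, ‖v i‖ ^ s) := by ring
    _ ≤ 2 ^ N * T ^ s * ((N : ℝ) ^ (p - s) * ∑ i, ‖v i‖ ^ p) := by
        have := rpow_sum_mul_sum_rpow_le (fun i => norm_nonneg (v i)) hs hsp
        gcongr
    _ = _ := by ring

/-- Nontrivial type passes to finite `ℓ_p` sums: some choice of signs produces cancellation. -/
theorem HasRademacherType.exists_sum_rpow_le (H : HasRademacherType E s T) (hT : 0 ≤ T)
    (hs : 1 ≤ s) {p : ℝ} (hsp : s ≤ p) {N : ℕ} (hN : 2 ^ p * T ^ s ≤ (N : ℝ) ^ (s - 1))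
    (hN0 : 0 < N) {κ : Type*} [Fintype κ] (F : Fin N → κ → E) {B : ℝ}
    (hF : ∀ j, ∑ x, ‖F j x‖ ^ p ≤ B) :
    ∃ ε : Cube N, ∑ x, ‖∑ j, sgn' (ε j) • F j x‖ ^ p ≤ ((N : ℝ) / 2) ^ p * B := by
  have hN' : (0 : ℝ) < N := by exact_mod_cast hN0
  have hB : 0 ≤ B := (sum_nonneg fun x _ => by positivity).trans (hF ⟨0, hN0⟩)
  have h1 : ∑ ε : Cube N, ∑ x, ‖∑ j, sgn' (ε j) • F j x‖ ^ p
      ≤ ∑ _ε : Cube N, ((N : ℝ) / 2) ^ p * B := by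
    rw [sum_comm]
    calc _ ≤ ∑ x, 2 ^ N * ((N : ℝ) ^ (p - s) * T ^ s * ∑ i, ‖F i x‖ ^ p) :=
          sum_le_sum fun x _ => H.sum_rpow_le hT hs hsp fun j => F j x
      _ = 2 ^ N * ((N : ℝ) ^ (p - s) * T ^ s * ∑ i, ∑ x, ‖F i x‖ ^ p) := by
          rw [← mul_sum, ← mul_sum, sum_comm]
      _ ≤ 2 ^ N * ((N : ℝ) ^ (p - s) * T ^ s * (N * B)) := by
          gcongr
          exact (sum_le_sum fun i _ => hF i).trans (by simp)
      _ ≤ 2 ^ N * (((N : ℝ) / 2) ^ p * B) := by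
          rw [← mul_assoc _ (N : ℝ) B]
          gcongr
          have e : (N : ℝ) ^ (p - s) * (N : ℝ) ^ (s - 1) * N = (N : ℝ) ^ p := by
            nth_rw 3 [← Real.rpow_one (N : ℝ)]
            rw [← Real.rpow_add hN', ← Real.rpow_add hN']
            congr 1
            ring
          have h2 : (0 : ℝ) < 2 ^ p := by positivity
          rw [Real.div_rpow hN'.le zero_le_two, le_div_iff₀ h2, ← e]
          calc (N : ℝ) ^ (p - s) * T ^ s * N * 2 ^ p
              = (N : ℝ) ^ (p - s) * (2 ^ p * T ^ s) * N := by ring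
            _ ≤ _ := by gcongr
      _ = _ := by simp
  obtain ⟨ε, -, hε⟩ := exists_le_of_sum_le univ_nonempty h1
  exact ⟨ε, hε⟩

end RademacherType

theorem norm_map_prod_le {ι κ 𝒜 : Type*} [NormedRing 𝒜] [NormedAlgebra ℂ 𝒜]
    (M : (ι → ℂ) →ₐ[ℂ] 𝒜) (h1 : ‖(1 : 𝒜)‖ ≤ 1) {u : κ → ι → ℂ} (hu : ∀ j, ‖M (u j)‖ ≤ 1)
    (s : Finset κ) : ‖M (∏ j ∈ s, u j)‖ ≤ 1 := by
  classical
  induction s using Finset.induction_on with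
  | empty => simpa using h1
  | insert j s hj ih =>
    rw [prod_insert hj, map_mul]
    exact (norm_mul_le _ _).trans (mul_le_one₀ (hu j) (norm_nonneg _) ih)

section ProdOneSub

variable {R κ : Type*} [CommRing R]

theorem prod_one_sub_eq_sum [Fintype κ] [DecidableEq κ] (u : κ → R) :
    ∏ j, (1 - u j) = ∑ A : Finset κ, (-1) ^ A.card * ∏ j ∈ A, u j := by
  have := prod_add (fun j => -u j) (fun _ => (1 : R)) univ
  simp only [prod_const_one, mul_one, powerset_univ, prod_neg] at this
  rw [← this]
  exact prod_congr rfl fun j _ => by ring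

theorem mul_prod_insert_of_idempotent [DecidableEq κ] {u : κ → R} (hu : ∀ j, u j * u j = u j)
    (B : Finset κ) (j : κ) : (∏ i ∈ B, u i) * u j = ∏ i ∈ insert j B, u i := by
  by_cases hj : j ∈ B
  · rw [insert_eq_of_mem hj, ← mul_prod_erase B u hj, mul_right_comm, hu]
  · rw [prod_insert hj, mul_comm]

theorem neg_one_pow_mul_prod_mul_sign [DecidableEq κ] {u : κ → R} (hu : ∀ j, u j * u j = u j)
    (ε : κ → Bool) {B : Finset κ} (hB : ∀ j, j ∈ B ↔ ε j = true) (j : κ) :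
    (-1) ^ B.card * (∏ i ∈ B, u i) * ((if ε j then 1 else -1) * u j)
      = (-1) ^ (insert j B).card * ∏ i ∈ insert j B, u i := by
  rw [← mul_prod_insert_of_idempotent hu]
  by_cases hj : j ∈ B
  · rw [insert_eq_of_mem hj, (hB j).1 hj]
    simp only [if_true]
    ring
  · have : ε j = false := by simpa [hB] using hj
    rw [card_insert_of_notMem hj, this]
    simp only [Bool.false_eq_true, if_false]
    ring

end ProdOneSub

/-- A product of `1 - u j` with `u j` idempotent and contractive does not attain the trivial bound
at a vector where some signed sum of the `u j` has cancellation. -/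
theorem norm_map_prod_one_sub_apply_le {ι X : Type*} [NormedAddCommGroup X] [NormedSpace ℂ X]
    (M : (ι → ℂ) →ₐ[ℂ] (X →L[ℂ] X)) {N : ℕ} (hN : 0 < N) {u : Fin N → ι → ℂ}
    (hu : ∀ j, u j * u j = u j) (hM : ∀ j, ‖M (u j)‖ ≤ 1) {F : X} {ε : Cube N}
    (hε : ‖∑ j, ((sgn' (ε j) : ℝ) : ℂ) • M (u j) F‖ ≤ N / 2 * ‖F‖) :
    ‖M (∏ j, (1 - u j)) F‖ ≤ (2 ^ N - 1 / 2) * ‖F‖ := by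
  have hN' : (0 : ℝ) < N := by exact_mod_cast hN
  have h1 : ‖(1 : X →L[ℂ] X)‖ ≤ 1 := ContinuousLinearMap.norm_id_le
  have hMA : ∀ A : Finset (Fin N), ‖M ((-1) ^ A.card * ∏ i ∈ A, u i)‖ ≤ 1 := fun A => by
    rcases neg_one_pow_eq_or (ι → ℂ) A.card with h | h <;>
      simpa [h] using norm_map_prod_le M h1 hM A
  set B : Finset (Fin N) := univ.filter fun j => ε j = true with hB
  set Y : ι → ℂ := ∏ j, (1 - u j) with hY
  set Z : Fin N → ι → ℂ := fun j => (-1) ^ (insert j B).card * ∏ i ∈ insert j B, u i with hZ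
  have hYZ : ∀ j, ‖M (Y - Z j)‖ ≤ 2 ^ N - 1 := fun j => by
    have e : Y - Z j = ∑ A ∈ univ.erase (insert j B), (-1) ^ A.card * ∏ i ∈ A, u i := by
      rw [hY, prod_one_sub_eq_sum, ← add_sum_erase _ _ (mem_univ (insert j B)), hZ]
      simp
    rw [e, map_sum]
    refine (norm_sum_le_of_le _ fun A _ => hMA A).trans (le_of_eq ?_)
    rw [sum_const, card_erase_of_mem (mem_univ _), card_univ, Fintype.card_finset,
      Fintype.card_fin, nsmul_eq_mul, mul_one, Nat.cast_sub Nat.one_le_two_pow]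
    simp
  have hsum : M (∑ j, Z j) F
      = M ((-1) ^ B.card * ∏ i ∈ B, u i) (∑ j, ((sgn' (ε j) : ℝ) : ℂ) • M (u j) F) := by
    have e : ∑ j, Z j = ((-1) ^ B.card * ∏ i ∈ B, u i) *
        ∑ j, ((sgn' (ε j) : ℝ) : ℂ) • u j := by
      rw [mul_sum]
      refine sum_congr rfl fun j _ => ?_
      rw [hZ]
      simp only
      rw [← neg_one_pow_mul_prod_mul_sign hu ε (B := B) (by simp [hB])]
      congr 1
      ext i
      cases ε j <;> simp [sgn']
    rw [e, map_mul, map_sum, mul_apply_eq_comp]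
    simp only [map_smul, _root_.sum_apply, _root_.smul_apply]
  have hNY : (N : ℂ) • M Y F = ∑ j, M (Y - Z j) F + M (∑ j, Z j) F := by
    rw [map_sum, _root_.sum_apply, ← sum_add_distrib]
    simp [Nat.cast_smul_eq_nsmul]
  have h3 : N * ‖M Y F‖ ≤ N * ((2 ^ N - 1) * ‖F‖) + N / 2 * ‖F‖ := by
    have : ‖(N : ℂ) • M Y F‖ = N * ‖M Y F‖ := by simp [norm_smul]
    rw [← this, hNY]
    refine (norm_add_le _ _).trans (add_le_add ?_ ?_)
    · refine (norm_sum_le_of_le _ fun j _ => (M (Y - Z j)).le_of_opNorm_le (hYZ j) F).trans ?_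
      simp
    · rw [hsum]
      refine ((M _).le_of_opNorm_le (hMA B) _).trans ?_
      rwa [one_mul]
  refine le_of_mul_le_mul_left (h3.trans (le_of_eq ?_)) hN'
  ring

section SubsetSymbols

variable {n : ℕ} {𝒜 : Type*} [NormedRing 𝒜] [NormedAlgebra ℂ 𝒜]
  (M : (Finset (Fin n) → ℂ) →ₐ[ℂ] 𝒜)

/-- Contractivity of conditional expectations, given that coordinate flips are contractive. -/
theorem norm_map_subset_le (h1 : ‖(1 : 𝒜)‖ ≤ 1)
    (hflip : ∀ i, ‖M (fun A => if i ∈ A then -1 else 1)‖ ≤ 1) (S : Finset (Fin n)) :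
    ‖M (fun A => if A ⊆ S then 1 else 0)‖ ≤ 1 := by
  have e : (fun A : Finset (Fin n) => if A ⊆ S then (1 : ℂ) else 0)
      = ∏ i ∈ Sᶜ, ((2 : ℂ)⁻¹ • (1 + fun A => if i ∈ A then -1 else 1)) := by
    ext A
    rw [Finset.prod_apply]
    have h2 : ∀ i, ((2 : ℂ)⁻¹ • (1 + fun A : Finset (Fin n) => if i ∈ A then (-1 : ℂ) else 1)) A
        = if i ∉ A then 1 else 0 := fun i => by
      by_cases hi : i ∈ A <;> simp [hi]
      norm_num
    simp only [h2, prod_boole]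
    congr 1
    simp only [mem_compl, eq_iff_iff, subset_iff]
    exact forall_congr' fun i => not_imp_not.symm
  rw [e]
  refine norm_map_prod_le M h1 (fun i => ?_) _
  rw [map_smul, map_add, map_one, norm_smul]
  have := (norm_add_le _ _).trans (add_le_add h1 (hflip i))
  norm_num
  linarith

theorem exp_neg_mul_card_eq_sum (t : ℝ) :
    (fun A : Finset (Fin n) => (rexp (-(t * A.card)) : ℂ))
      = ∑ S : Finset (Fin n), ((rexp (-t) ^ S.card * (1 - rexp (-t)) ^ Sᶜ.card : ℝ) : ℂ) •
        fun A => if A ⊆ S then (1 : ℂ) else 0 := by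
  ext A
  have h := prod_add (fun _ : Fin n => (rexp (-t) : ℂ))
    (fun i => (1 - rexp (-t) : ℂ) * if i ∉ A then 1 else 0) univ
  have h2 : ∀ i, (rexp (-t) : ℂ) + (1 - rexp (-t) : ℂ) * (if i ∉ A then 1 else 0)
      = if i ∈ A then (rexp (-t) : ℂ) else 1 := fun i => by
    by_cases hi : i ∈ A <;> simp [hi]
  simp only [h2, prod_ite_mem, univ_inter, prod_const, powerset_univ, prod_mul_distrib,
    prod_boole] at h
  rw [Finset.sum_apply, mul_comm t, ← mul_neg, Real.exp_nat_mul, Complex.ofReal_pow, h]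
  refine sum_congr rfl fun S _ => ?_
  have h3 : (∀ i ∈ univ \ S, i ∉ A) ↔ A ⊆ S := by
    simp only [Finset.mem_sdiff, mem_univ, true_and, subset_iff]
    exact forall_congr' fun i => not_imp_not
  simp only [h3, Pi.smul_apply, smul_eq_mul, compl_eq_univ_sdiff]
  push_cast
  ring

theorem sum_exp_neg_weights (t : ℝ) :
    ∑ S : Finset (Fin n), rexp (-t) ^ S.card * (1 - rexp (-t)) ^ Sᶜ.card = 1 := by
  have := congr_fun (exp_neg_mul_card_eq_sum (n := n) t) ∅
  simp only [card_empty, Nat.cast_zero, mul_zero, neg_zero, Real.exp_zero, Finset.sum_apply,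
    Pi.smul_apply, empty_subset, if_true, smul_eq_mul, mul_one] at this
  exact_mod_cast this.symm

theorem isSemigroupCalculus_card (h1 : ‖(1 : 𝒜)‖ ≤ 1)
    (hflip : ∀ i, ‖M (fun A => if i ∈ A then -1 else 1)‖ ≤ 1) {N : ℕ} {ρ : ℝ}
    (hprod : ∀ S : Fin N → Finset (Fin n),
      ‖M (∏ j, (1 - fun A => if A ⊆ S j then 1 else 0))‖ ≤ ρ) :
    IsSemigroupCalculus M N ρ (fun A => (A.card : ℝ)) := by
  have hw : ∀ t : ℝ, 0 ≤ t → ∀ S : Finset (Fin n),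
      0 ≤ rexp (-t) ^ S.card * (1 - rexp (-t)) ^ Sᶜ.card := fun t ht S => by
    have : 0 ≤ 1 - rexp (-t) := by simpa using ht
    positivity
  refine ⟨fun A => by positivity, fun t ht => ?_, fun t ht => ?_⟩
  · rw [exp_neg_mul_card_eq_sum, map_sum]
    refine (norm_sum_le_of_le (f := fun S : Finset (Fin n) => _)
      (n := fun S => rexp (-t) ^ S.card * (1 - rexp (-t)) ^ Sᶜ.card) _ fun S _ => ?_).trans
      (sum_exp_neg_weights t).le
    rw [map_smul, norm_smul, Complex.norm_real, Real.norm_of_nonneg (hw t ht S)]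
    exact mul_le_of_le_one_right (hw t ht S) (norm_map_subset_le M h1 hflip S)
  · have e : (1 : Finset (Fin n) → ℂ) - (fun A => (rexp (-(t * A.card)) : ℂ))
        = ∑ S : Finset (Fin n), ((rexp (-t) ^ S.card * (1 - rexp (-t)) ^ Sᶜ.card : ℝ) : ℂ) •
          (1 - fun A => if A ⊆ S then (1 : ℂ) else 0) := by
      simp only [smul_sub, sum_sub_distrib]
      rw [← exp_neg_mul_card_eq_sum, ← sum_smul, ← Complex.ofReal_sum, sum_exp_neg_weights,
        Complex.ofReal_one, one_smul]
    rw [← map_one M, ← map_sub, ← map_pow, e, Fintype.sum_pow, map_sum]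
    refine (norm_sum_le_of_le _ (fun S _ => ?_) (n := fun S : Fin N → Finset (Fin n) =>
      (∏ j, rexp (-t) ^ (S j).card * (1 - rexp (-t)) ^ (S j)ᶜ.card) * ρ)).trans (le_of_eq ?_)
    · rw [prod_smul, map_smul, norm_smul, ← Complex.ofReal_prod, Complex.norm_real,
        Real.norm_of_nonneg (prod_nonneg fun j _ => hw t ht _)]
      exact mul_le_mul_of_nonneg_left (hprod S) (prod_nonneg fun j _ => hw t ht _)
    · rw [← sum_mul, ← Fintype.sum_pow (fun S : Finset (Fin n) =>
        rexp (-t) ^ S.card * (1 - rexp (-t)) ^ Sᶜ.card), sum_exp_neg_weights, one_pow, one_mul]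

end SubsetSymbols

section Walsh

variable {n : ℕ}

theorem walshC_flipC (i : Fin n) (A : Finset (Fin n)) (x : Cube n) :
    walshC A (flipC i x) = (if i ∈ A then -1 else 1) * walshC A x := by
  have h : ∀ j, sgn' (flipC i x j) = (if j = i then -1 else 1) * sgn' (x j) := fun j => by
    by_cases hj : j = i
    · subst hj
      cases hx : x j <;> simp [flipC, sgn', hx]
    · simp [flipC, hj]
  simp only [walshC, h, prod_mul_distrib, prod_ite_eq']

theorem flipC_flipC (i : Fin n) (x : Cube n) : flipC i (flipC i x) = x := by
  simp [flipC]

theorem sum_walshC_mul_walshC (x y : Cube n) :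
    ∑ A : Finset (Fin n), walshC A x * walshC A y = if x = y then 2 ^ n else 0 := by
  have h := prod_add (fun i : Fin n => sgn' (x i) * sgn' (y i)) (fun _ => 1) univ
  simp only [prod_const_one, mul_one, powerset_univ, prod_mul_distrib] at h
  simp only [walshC]
  rw [← h]
  have h2 : ∀ i, sgn' (x i) * sgn' (y i) + 1 = if x i = y i then 2 else 0 := fun i => by
    cases x i <;> cases y i <;> norm_num [sgn']
  simp only [h2]
  split_ifs with hxy
  · simp [hxy]
  · obtain ⟨i, hi⟩ := Function.ne_iff.1 hxy
    exact prod_eq_zero (mem_univ i) (by simp [hi])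

theorem sum_walshC_mul_walshC_cube (A B : Finset (Fin n)) :
    ∑ x : Cube n, walshC A x * walshC B x = if A = B then 2 ^ n else 0 := by
  split_ifs with h
  · subst h
    have : ∀ x : Cube n, walshC A x * walshC A x = 1 := fun x => by
      rw [walshC, ← prod_mul_distrib]
      exact prod_eq_one fun i _ => by cases x i <;> simp [sgn']
    simp [this]
  · obtain ⟨i, hi⟩ : ∃ i, ¬(i ∈ A ↔ i ∈ B) := by
      by_contra! h'
      exact h (Finset.ext h')
    have e : ∑ x : Cube n, walshC A (flipC i x) * walshC B (flipC i x)
        = ∑ x : Cube n, walshC A x * walshC B x :=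
      Equiv.sum_comp (Function.Involutive.toPerm (flipC i) (flipC_flipC i))
        (fun x => walshC A x * walshC B x)
    have e2 : ∑ x : Cube n, walshC A (flipC i x) * walshC B (flipC i x)
        = -∑ x : Cube n, walshC A x * walshC B x := by
      rw [← sum_neg_distrib]
      refine sum_congr rfl fun x _ => ?_
      rw [walshC_flipC, walshC_flipC]
      by_cases hA : i ∈ A <;> by_cases hB : i ∈ B <;> simp_all
    linarith

/-- The kernel of the Walsh multiplier with symbol `φ`. -/
def walshKernel (φ : Finset (Fin n) → ℂ) (x y : Cube n) : ℂ :=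
  (2 ^ n : ℂ)⁻¹ * ∑ A : Finset (Fin n), φ A * walshC A x * walshC A y

theorem walshKernel_one (x y : Cube n) : walshKernel 1 x y = if x = y then 1 else 0 := by
  have h := sum_walshC_mul_walshC x y
  have h2 : ∑ A : Finset (Fin n), (walshC A x : ℂ) * walshC A y = if x = y then 2 ^ n else 0 := by
    have := congrArg (fun t : ℝ => (t : ℂ)) h
    push_cast at this
    rw [this]
    split_ifs <;> simp
  simp only [walshKernel, Pi.one_apply, one_mul, h2]
  split_ifs <;> simp

theorem walshKernel_add (φ ψ : Finset (Fin n) → ℂ) (x y : Cube n) :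
    walshKernel (φ + ψ) x y = walshKernel φ x y + walshKernel ψ x y := by
  simp only [walshKernel, Pi.add_apply, add_mul, sum_add_distrib, mul_add]

theorem walshKernel_smul (c : ℂ) (φ : Finset (Fin n) → ℂ) (x y : Cube n) :
    walshKernel (c • φ) x y = c * walshKernel φ x y := by
  simp only [walshKernel, Pi.smul_apply, smul_eq_mul, mul_assoc, ← mul_sum]
  ring

theorem walshKernel_mul (φ ψ : Finset (Fin n) → ℂ) (x z : Cube n) :
    ∑ y, walshKernel φ x y * walshKernel ψ y z = walshKernel (φ * ψ) x z := by
  have h : ∀ A B : Finset (Fin n), ∑ y : Cube n, (walshC A y : ℂ) * walshC B y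
      = if A = B then 2 ^ n else 0 := fun A B => by
    have := congrArg (fun t : ℝ => (t : ℂ)) (sum_walshC_mul_walshC_cube A B)
    push_cast at this
    rw [this]
    split_ifs <;> simp
  calc ∑ y, walshKernel φ x y * walshKernel ψ y z
      = ∑ y : Cube n, ∑ A : Finset (Fin n), ∑ B : Finset (Fin n), (2 ^ n : ℂ)⁻¹ * (2 ^ n : ℂ)⁻¹ *
          (φ A * ψ B * walshC A x * walshC B z) * ((walshC A y : ℂ) * walshC B y) := by
        refine sum_congr rfl fun y _ => ?_
        rw [walshKernel, walshKernel, mul_mul_mul_comm, sum_mul_sum, mul_sum]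
        refine sum_congr rfl fun A _ => ?_
        rw [mul_sum]
        exact sum_congr rfl fun B _ => by ring
    _ = ∑ A : Finset (Fin n), ∑ B : Finset (Fin n), (2 ^ n : ℂ)⁻¹ * (2 ^ n : ℂ)⁻¹ *
          (φ A * ψ B * walshC A x * walshC B z) * (if A = B then 2 ^ n else 0) := by
        rw [sum_comm]
        refine sum_congr rfl fun A _ => ?_
        rw [sum_comm]
        refine sum_congr rfl fun B _ => ?_
        rw [← mul_sum, h]
    _ = _ := by
        rw [walshKernel, mul_sum]
        refine sum_congr rfl fun A _ => ?_
        simp only [mul_ite, mul_zero, sum_ite_eq, mem_univ, if_true, Pi.mul_apply]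
        field_simp

theorem walshKernel_flip (i : Fin n) (x y : Cube n) :
    walshKernel (fun A => if i ∈ A then -1 else 1) x y = if flipC i x = y then 1 else 0 := by
  rw [← walshKernel_one, walshKernel, walshKernel]
  congr 1
  refine sum_congr rfl fun A _ => ?_
  rw [walshC_flipC]
  by_cases hi : i ∈ A <;> simp [hi]

end Walsh

section CubeMultiplier

variable {n : ℕ} {E : Type*} [NormedAddCommGroup E] [NormedSpace ℂ E]

/-- The space `L_p` of the cube with counting measure. -/
abbrev CubeLpSpace (n : ℕ) (E : Type*) [NormedAddCommGroup E] (p : ℝ) :=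
  PiLp (ENNReal.ofReal p) (fun _ : Cube n => E)

variable {p : ℝ} [Fact (1 ≤ ENNReal.ofReal p)]

theorem CubeLpSpace.norm_eq (hp : 0 < p) (F : CubeLpSpace n E p) :
    ‖F‖ = (∑ x, ‖F x‖ ^ p) ^ (1 / p) := by
  have := PiLp.norm_eq_sum (p := ENNReal.ofReal p) (by rwa [ENNReal.toReal_ofReal hp.le]) F
  rwa [ENNReal.toReal_ofReal hp.le] at this

theorem CubeLpSpace.norm_rpow (hp : 0 < p) (F : CubeLpSpace n E p) :
    ‖F‖ ^ p = ∑ x, ‖F x‖ ^ p := by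
  rw [CubeLpSpace.norm_eq hp, ← Real.rpow_mul (by positivity), one_div_mul_cancel hp.ne',
    Real.rpow_one]

/-- The functional calculus of Walsh multipliers on the `L_p` space of the cube. -/
def walshMultiplier (n : ℕ) (E : Type*) [NormedAddCommGroup E] [NormedSpace ℂ E] (p : ℝ)
    [Fact (1 ≤ ENNReal.ofReal p)] :
    (Finset (Fin n) → ℂ) →ₐ[ℂ] (CubeLpSpace n E p →L[ℂ] CubeLpSpace n E p) :=
  AlgHom.ofLinearMap
    { toFun := fun φ =>
        { toFun := fun F => WithLp.toLp _ fun x => ∑ y, walshKernel φ x y • F y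
          map_add' := fun F G => by
            ext x
            simp [smul_add, sum_add_distrib]
          map_smul' := fun c F => by
            ext x
            simp [smul_sum, smul_comm c]
          cont := by
            refine (PiLp.continuous_toLp _ _).comp (continuous_pi fun x => ?_)
            fun_prop }
      map_add' := fun φ ψ => by
        ext F x
        simp [walshKernel_add, add_smul, sum_add_distrib]
      map_smul' := fun c φ => by
        ext F x
        simp [walshKernel_smul, mul_smul, smul_sum] }
    (by
      ext F x
      simp [walshKernel_one])
    (fun φ ψ => by
      ext F x
      simp only [LinearMap.coe_mk, AddHom.coe_mk, ContinuousLinearMap.coe_mk', mul_apply_eq_comp,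
        smul_sum, smul_smul]
      rw [sum_comm]
      refine sum_congr rfl fun z _ => ?_
      rw [← walshKernel_mul, sum_smul])

theorem walshMultiplier_apply (φ : Finset (Fin n) → ℂ) (F : CubeLpSpace n E p) (x : Cube n) :
    walshMultiplier n E p φ F x = ∑ y, walshKernel φ x y • F y := rfl

theorem norm_walshMultiplier_flip_le (hp : 0 < p) (i : Fin n) :
    ‖walshMultiplier n E p (fun A => if i ∈ A then -1 else 1)‖ ≤ 1 := by
  refine ContinuousLinearMap.opNorm_le_bound _ zero_le_one fun F => ?_
  rw [one_mul, CubeLpSpace.norm_eq hp, CubeLpSpace.norm_eq hp]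
  simp only [walshMultiplier_apply, walshKernel_flip, ite_smul, one_smul, zero_smul, sum_ite_eq,
    mem_univ, if_true]
  exact le_of_eq (congrArg (· ^ (1 / p)) (Equiv.sum_comp
    (Function.Involutive.toPerm (flipC i) (flipC_flipC i)) (fun x => ‖F x‖ ^ p)))

/-- Type yields a uniform improvement over the trivial bound for products of complements of
conditional expectations. -/
theorem norm_walshMultiplier_prod_le {s T : ℝ} (H : HasRademacherType E s T) (hT : 0 ≤ T)
    (hs : 1 ≤ s) (hsp : s ≤ p) {N : ℕ} (hN : 2 ^ p * T ^ s ≤ (N : ℝ) ^ (s - 1)) (hN0 : 0 < N)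
    (S : Fin N → Finset (Fin n)) :
    ‖walshMultiplier n E p (∏ j, (1 - fun A => if A ⊆ S j then 1 else 0))‖ ≤ 2 ^ N - 1 / 2 := by
  have hp : 0 < p := by linarith
  have hle : ∀ j, ‖walshMultiplier n E p (fun A => if A ⊆ S j then 1 else 0)‖ ≤ 1 := fun j =>
    norm_map_subset_le _ ContinuousLinearMap.norm_id_le (norm_walshMultiplier_flip_le hp) _
  have h2N : (1 : ℝ) ≤ 2 ^ N := one_le_pow₀ one_le_two
  refine ContinuousLinearMap.opNorm_le_bound _ (by linarith) fun F => ?_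
  obtain ⟨ε, hε⟩ := H.exists_sum_rpow_le hT hs hsp hN hN0 (B := ‖F‖ ^ p)
    (fun j x => walshMultiplier n E p (fun A => if A ⊆ S j then 1 else 0) F x) (fun j => by
      rw [← CubeLpSpace.norm_rpow hp]
      gcongr
      simpa using ContinuousLinearMap.le_of_opNorm_le _ (hle j) F)
  refine norm_map_prod_one_sub_apply_le _ hN0 (ε := ε) (fun j => ?_) hle ?_
  · ext A
    simp
  · refine (Real.rpow_le_rpow_iff (norm_nonneg _) (by positivity) hp).1 ?_
    rw [CubeLpSpace.norm_rpow hp, Real.mul_rpow (by positivity) (norm_nonneg _)]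
    refine le_trans (le_of_eq (sum_congr rfl fun x _ => ?_)) hε
    simp

theorem isSemigroupCalculus_walshMultiplier {s T : ℝ} (H : HasRademacherType E s T) (hT : 0 ≤ T)
    (hs : 1 ≤ s) (hsp : s ≤ p) {N : ℕ} (hN : 2 ^ p * T ^ s ≤ (N : ℝ) ^ (s - 1)) (hN0 : 0 < N) :
    IsSemigroupCalculus (walshMultiplier n E p) N (2 ^ N - 1 / 2) (fun A => (A.card : ℝ)) :=
  isSemigroupCalculus_card _ ContinuousLinearMap.norm_id_le
    (norm_walshMultiplier_flip_le (by linarith))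
    (norm_walshMultiplier_prod_le H hT hs hsp hN hN0)

theorem walshMultiplier_eq_holoMult (h : ℂ → ℂ) (α r : ℝ) (F : CubeLpSpace n E p) (x : Cube n) :
    walshMultiplier n E p (fun A => if r ^ (-1 / α) < (A.card : ℝ) then
      h ((((A.card : ℝ) ^ (-α)) : ℝ) : ℂ) else 0) F x = holoMult h α r F x := by
  simp only [walshMultiplier_apply, holoMult, fhatC, walshKernel, smul_sum, sum_filter]
  simp only [mul_sum, sum_smul]
  rw [sum_comm]
  refine sum_congr rfl fun A _ => ?_
  split_ifs with hA
  · refine sum_congr rfl fun y _ => ?_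
    rw [← Complex.coe_smul, ← Complex.coe_smul, smul_smul, smul_smul]
    congr 1
    push_cast
    ring
  · simp

theorem cubeLp_eq (hp : 0 < p) (F : CubeLpSpace n E p) :
    cubeLp p (fun x => F x) = ((2 ^ n : ℝ)⁻¹) ^ (1 / p) * ‖F‖ := by
  rw [cubeLp, CubeLpSpace.norm_eq hp, Real.mul_rpow (by positivity) (by positivity)]

end CubeMultiplier

/-- **Vector-valued Meyer multiplier theorem** (Theorem 9).  Let `E` be a complex Banach space
of Rademacher type `s` for some `s ∈ (1,2]` with constant `T`, let `r ∈ (0,∞)` and let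
`h : 𝔻_r → ℂ` be holomorphic.  Then for every `p ∈ (1,∞)` and `α ∈ (0,∞)` there is
`C_h(α) = C_h(α,p,s,T) ∈ (0,∞)` such that every `f : 𝒞_n → E` satisfies
`‖h(Δ^{-α}) f‖_p ≤ C_h(α) ‖f‖_p`. -/
theorem vector_valued_meyer_multiplier
    (E : Type*) [NormedAddCommGroup E] [NormedSpace ℂ E] [CompleteSpace E]
    (s T : ℝ) (hs : 1 < s) (hs2 : s ≤ 2) (hT : 0 < T)
    (htype : ∀ (m : ℕ) (v : Fin m → E),
      (2 ^ m : ℝ)⁻¹ * ∑ ε : Cube m, ‖∑ i, sgn' (ε i) • v i‖ ^ s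
        ≤ T ^ s * ∑ i, ‖v i‖ ^ s)
    (r : ℝ) (hr : 0 < r) (h : ℂ → ℂ)
    (hhol : DifferentiableOn ℂ h (Metric.ball (0 : ℂ) r))
    (p : ℝ) (hp : 1 < p) (α : ℝ) (hα : 0 < α) :
    ∃ C : ℝ, 0 < C ∧ ∀ (n : ℕ) (f : Cube n → E),
      cubeLp p (holoMult h α r f) ≤ C * cubeLp p f := by
  have : Fact (1 ≤ ENNReal.ofReal p) := ⟨by simpa using hp.le⟩
  have hp0 : 0 < p := by linarith
  have hs' : 1 < min s p := lt_min hs hp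
  have H : HasRademacherType E (min s p) T :=
    HasRademacherType.of_le (s := s) htype hT.le (by linarith) (min_le_left _ _)
  obtain ⟨N, hN, hN0⟩ : ∃ N : ℕ, 2 ^ p * T ^ min s p ≤ (N : ℝ) ^ (min s p - 1) ∧ 0 < N :=
    ((((tendsto_rpow_atTop (sub_pos.2 hs')).comp tendsto_natCast_atTop_atTop).eventually_ge_atTop
      _).and (eventually_gt_atTop 0)).exists
  obtain ⟨C, hC, hbound⟩ := IsSemigroupCalculus.exists_norm_holomorphic_le
    (N := N) (ρ := 2 ^ N - 1 / 2) (by linarith) hr hα hhol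
  refine ⟨C, hC, fun n f => ?_⟩
  have h1 := hbound (walshMultiplier n E p) (fun A => A.card)
    (isSemigroupCalculus_walshMultiplier H hT.le hs'.le (min_le_right _ _) hN hN0)
  have h2 := ContinuousLinearMap.le_of_opNorm_le _ h1 (WithLp.toLp _ f)
  have h3 := cubeLp_eq hp0 (WithLp.toLp _ f : CubeLpSpace n E p)
  have h4 := cubeLp_eq hp0 (walshMultiplier n E p (fun A => if r ^ (-1 / α) < (A.card : ℝ) then
      h ((((A.card : ℝ) ^ (-α)) : ℝ) : ℂ) else 0) (WithLp.toLp _ f))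
  simp only [walshMultiplier_eq_holoMult] at h4
  calc cubeLp p (holoMult h α r f) = _ := h4
    _ ≤ ((2 ^ n : ℝ)⁻¹) ^ (1 / p) * (C * ‖(WithLp.toLp _ f : CubeLpSpace n E p)‖) := by gcongr
    _ = C * cubeLp p f := by
      rw [mul_left_comm, ← h3]

end
end

section
/- For every p ∈ (1,∞) there exists C_p ∈ (0,∞), depending only on p, such that the following holds for every complex Banach space (E,‖·‖_E) and every n ∈ ℕ: every smooth function f : ℝ^n → E whose norm together with the norms of all its partial derivatives grow at most polynomially satisfies ‖f − E_{γ_n} f‖_{L_p(γ_n;E)} ≤ C_p ‖∇f‖_{L_p(γ_n;E)} / (1 + √(log(‖∇f‖_{L_p(γ_n;E)} / ‖∇f‖_{L_1(γ_n;E)}))), with the convention that the right-hand side is 0 when ∇f vanishes identically. -/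
open Finset MeasureTheory Real Filter

noncomputable section

variable {E : Type*} [NormedAddCommGroup E]

/-- The standard Gaussian probability measure `γ_n` on `ℝ^n`. -/
def gauss (n : ℕ) : Measure (Fin n → ℝ) :=
  Measure.pi fun _ => ProbabilityTheory.gaussianReal 0 1

/-- The `L_p(γ_n; E)` norm of a function on Gauss space. -/
def gaussLp {n : ℕ} (p : ℝ) (f : (Fin n → ℝ) → E) : ℝ :=
  (∫ x, ‖f x‖ ^ p ∂gauss n) ^ (1 / p)

/-- `f` and all of its derivatives grow at most polynomially. -/
def PolyGrowth {n : ℕ} [NormedSpace ℝ E] (f : (Fin n → ℝ) → E) : Prop :=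
  ∀ m : ℕ, ∃ (c : ℝ) (k : ℕ), ∀ x, ‖iteratedFDeriv ℝ m f x‖ ≤ c * (1 + ‖x‖) ^ k
/-- The Gaussian gradient norm
`‖∇f‖_{L_p(γ_n;E)} = (∫∫ ‖∑_i y_i ∂_i f(x)‖^p dγ_n(x) dγ_n(y))^{1/p}`. -/
def gaussGradLp {n : ℕ} [NormedSpace ℝ E] (p : ℝ) (f : (Fin n → ℝ) → E) : ℝ :=
  (∫ y, ∫ x, ‖∑ i, y i • fderiv ℝ f x (Pi.single i 1)‖ ^ p ∂gauss n ∂gauss n) ^ (1 / p)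

open scoped ENNReal

lemma rpow_neg_convex_combination_le {x y w v s : ℝ} (hx : 0 < x) (hy : 0 < y) (hw : 0 ≤ w)
    (hv : 0 ≤ v) (hwv : w + v = 1) (hs : 0 ≤ s) :
    (w * x + v * y) ^ (-s) ≤ w * x ^ (-s) + v * y ^ (-s) := by
  have hpos : 0 < w * x + v * y := by
    rcases hw.eq_or_lt with rfl | hw'
    · simp at hwv; subst hwv; simpa using hy
    · positivity
  have hlog : w * log x + v * log y ≤ log (w * x + v * y) := by
    simpa using strictConcaveOn_log_Ioi.concaveOn.2 hx hy hw hv hwv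
  rw [rpow_def_of_pos hpos, rpow_def_of_pos hx, rpow_def_of_pos hy]
  calc rexp (log (w * x + v * y) * -s)
      ≤ rexp (w * (log x * -s) + v * (log y * -s)) := by
        apply exp_le_exp.2; nlinarith
    _ ≤ _ := by
        simpa using convexOn_exp.2 (Set.mem_univ (log x * -s)) (Set.mem_univ (log y * -s)) hw hv hwv

lemma one_sub_mul_le_rpow_neg {x s : ℝ} (hx : 0 < x) (hs : 0 ≤ s) :
    1 - s * (x - 1) ≤ x ^ (-s) := by
  rw [rpow_def_of_pos hx]
  have h1 := add_one_le_exp (log x * -s)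
  have h2 := log_le_sub_one_of_pos hx
  nlinarith

/-- Symmetrised negative powers around `1` increase with the exponent and with the spread. -/
lemma rpow_neg_add_rpow_neg_le {b ρ s t : ℝ} (hb : |b| < 1) (hρ0 : 0 ≤ ρ) (hρ1 : ρ ≤ 1)
    (hs : 0 ≤ s) (hst : s ≤ t) :
    (1 + ρ * b) ^ (-s) + (1 - ρ * b) ^ (-s) ≤ (1 + b) ^ (-t) + (1 - b) ^ (-t) := by
  obtain ⟨hb1, hb2⟩ := abs_lt.1 hb
  have hp : 0 < 1 + b := by linarith
  have hm : 0 < 1 - b := by linarith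
  have spread : (1 + ρ * b) ^ (-s) + (1 - ρ * b) ^ (-s) ≤ (1 + b) ^ (-s) + (1 - b) ^ (-s) := by
    have h1 := rpow_neg_convex_combination_le (w := (1 + ρ) / 2) (v := (1 - ρ) / 2) hp hm
      (by linarith) (by linarith) (by ring) hs
    have h2 := rpow_neg_convex_combination_le (w := (1 - ρ) / 2) (v := (1 + ρ) / 2) hp hm
      (by linarith) (by linarith) (by ring) hs
    have e1 : (1 + ρ) / 2 * (1 + b) + (1 - ρ) / 2 * (1 - b) = 1 + ρ * b := by ring
    have e2 : (1 - ρ) / 2 * (1 + b) + (1 + ρ) / 2 * (1 - b) = 1 - ρ * b := by ring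
    rw [e1] at h1
    rw [e2] at h2
    linarith
  refine spread.trans ?_
  rcases hs.eq_or_lt with rfl | hs'
  · have h1 := one_sub_mul_le_rpow_neg hp hst
    have h2 := one_sub_mul_le_rpow_neg hm hst
    simp only [neg_zero, rpow_zero]
    linarith
  have ht : 0 < t := hs'.trans_le hst
  have key : ∀ x : ℝ, 0 < x → x ^ (-s) ≤ 1 + s / t * (x ^ (-t) - 1) := fun x hx => by
    have h := rpow_one_add_le_one_add_mul_self (s := x ^ (-t) - 1) (p := s / t)
      (by have := rpow_pos_of_pos hx (-t); linarith) (by positivity) ((div_le_one ht).2 hst)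
    have e : (1 + (x ^ (-t) - 1)) ^ (s / t) = x ^ (-s) := by
      rw [add_sub_cancel, ← rpow_mul hx.le]; congr 1; field_simp
    rwa [e] at h
  have h1 := one_sub_mul_le_rpow_neg hp ht.le
  have h2 := one_sub_mul_le_rpow_neg hm ht.le
  have h3 := key _ hp
  have h4 := key _ hm
  have h5 : s / t ≤ 1 := (div_le_one ht).2 hst
  nlinarith [mul_nonneg (sub_nonneg.2 h5)
    (show (0 : ℝ) ≤ (1 + b) ^ (-t) + (1 - b) ^ (-t) - 2 by linarith)]

/-- Bonami's two-point comparison for the mean-one function `1 + bε`. -/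
lemma two_point_normalized {p q ρ : ℝ} (hq : 1 < q) (hqp : q ≤ p) (hp : p ≤ 2) (hρ0 : 0 ≤ ρ)
    (hρ1 : ρ ≤ 1) (hρ : ρ ^ 2 * (p - 1) = q - 1) {b : ℝ} (hb : |b| ≤ 1) :
    ((1 + ρ * b) ^ p + (1 - ρ * b) ^ p) / 2 ≤
      1 + p / q * (((1 + b) ^ q + (1 - b) ^ q) / 2 - 1) := by
  have hp1 : 1 < p := hq.trans_le hqp
  set D : ℝ → ℝ := fun b => 1 + p / q * (((1 + b) ^ q + (1 - b) ^ q) / 2 - 1) -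
    ((1 + ρ * b) ^ p + (1 - ρ * b) ^ p) / 2 with hD
  have bnd : ∀ x ∈ Set.Ioo (-1 : ℝ) 1, 0 < 1 + x ∧ 0 < 1 - x ∧ 0 < 1 + ρ * x ∧ 0 < 1 - ρ * x := by
    rintro x ⟨h1, h2⟩
    refine ⟨by linarith, by linarith, ?_, ?_⟩ <;> nlinarith
  have dpow : ∀ (c r x : ℝ), 0 < 1 + c * x →
      HasDerivAt (fun x : ℝ => (1 + c * x) ^ r) (c * r * (1 + c * x) ^ (r - 1)) x := by
    intro c r x hx
    have h : HasDerivAt (fun x : ℝ => 1 + c * x) c x := by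
      simpa using ((hasDerivAt_id x).const_mul c).const_add 1
    exact h.rpow_const (Or.inl hx.ne')
  set D' : ℝ → ℝ := fun b => p / q * ((1 * q * (1 + 1 * b) ^ (q - 1) +
      (-1) * q * (1 + (-1) * b) ^ (q - 1)) / 2) -
    (ρ * p * (1 + ρ * b) ^ (p - 1) + (-ρ) * p * (1 + (-ρ) * b) ^ (p - 1)) / 2 with hD'
  have eD : D = fun b => 1 + p / q * (((1 + 1 * b) ^ q + (1 + (-1) * b) ^ q) / 2 - 1) -
    ((1 + ρ * b) ^ p + (1 + (-ρ) * b) ^ p) / 2 := by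
    funext x; simp only [hD]; ring_nf
  have bnd' : ∀ x ∈ Set.Ioo (-1 : ℝ) 1,
      0 < 1 + 1 * x ∧ 0 < 1 + (-1) * x ∧ 0 < 1 + ρ * x ∧ 0 < 1 + (-ρ) * x := fun x hx => by
    obtain ⟨a, b, c, d⟩ := bnd x hx
    exact ⟨by linarith, by linarith, c, by linarith⟩
  have hD1 : ∀ x ∈ Set.Ioo (-1 : ℝ) 1, HasDerivAt D (D' x) x := by
    intro x hx
    obtain ⟨h1, h2, h3, h4⟩ := bnd' x hx
    rw [eD]
    exact ((((((dpow 1 q x h1).add (dpow (-1) q x h2)).div_const 2).sub_const 1).const_mul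
      (p / q)).const_add 1).sub (((dpow ρ p x h3).add (dpow (-ρ) p x h4)).div_const 2)
  have hD2 : ∀ x ∈ Set.Ioo (-1 : ℝ) 1, HasDerivAt D' (p * (q - 1) / 2 *
      (((1 + x) ^ (-(2 - q)) + (1 - x) ^ (-(2 - q))) -
        ((1 + ρ * x) ^ (-(2 - p)) + (1 - ρ * x) ^ (-(2 - p))))) x := by
    intro x hx
    obtain ⟨h1, h2, h3, h4⟩ := bnd' x hx
    have h := ((((((dpow 1 (q - 1) x h1).const_mul (1 * q)).add
      ((dpow (-1) (q - 1) x h2).const_mul (-1 * q))).div_const 2)).const_mul (p / q)).sub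
      ((((dpow ρ (p - 1) x h3).const_mul (ρ * p)).add
        ((dpow (-ρ) (p - 1) x h4).const_mul (-ρ * p))).div_const 2)
    refine h.congr_deriv ?_
    have e1 : q - 1 - 1 = -(2 - q) := by ring
    have e2 : p - 1 - 1 = -(2 - p) := by ring
    have e3 : (1 + 1 * x) = 1 + x := by ring
    have e4 : (1 + (-1) * x) = 1 - x := by ring
    have e5 : (1 + (-ρ) * x) = 1 - ρ * x := by ring
    rw [e1, e2, e3, e4, e5]
    generalize (1 + x) ^ (-(2 - q)) = A
    generalize (1 - x) ^ (-(2 - q)) = B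
    generalize (1 + ρ * x) ^ (-(2 - p)) = C
    generalize (1 - ρ * x) ^ (-(2 - p)) = F
    have : q ≠ 0 := by positivity
    field_simp
    linear_combination (-(C + F)) * hρ
  have hderiv : ∀ x ∈ Set.Ioo (-1 : ℝ) 1, deriv D x = D' x := fun x hx => (hD1 x hx).deriv
  have hderiv2 : ∀ x ∈ Set.Ioo (-1 : ℝ) 1, HasDerivAt (deriv D) (p * (q - 1) / 2 *
      (((1 + x) ^ (-(2 - q)) + (1 - x) ^ (-(2 - q))) -
        ((1 + ρ * x) ^ (-(2 - p)) + (1 - ρ * x) ^ (-(2 - p))))) x := fun x hx =>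
    (hD2 x hx).congr_of_eventuallyEq
      (Filter.eventuallyEq_of_mem (isOpen_Ioo.mem_nhds hx) hderiv)
  have hconv : ConvexOn ℝ (Set.Icc (-1 : ℝ) 1) D := by
    apply convexOn_of_deriv2_nonneg (convex_Icc _ _)
    · have c : ∀ (c r : ℝ), 0 ≤ r → Continuous fun x : ℝ => (1 + c * x) ^ r := fun c r hr =>
        Continuous.rpow_const (by fun_prop) fun _ => Or.inr hr
      have c1 := c 1 q (by linarith)
      have c2 := c (-1) q (by linarith)
      have c3 := c ρ p (by linarith)
      have c4 := c (-ρ) p (by linarith)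
      rw [eD]
      exact Continuous.continuousOn (by fun_prop)
    · rw [interior_Icc]
      exact fun x hx => (hD1 x hx).differentiableAt.differentiableWithinAt
    · rw [interior_Icc]
      exact fun x hx => (hderiv2 x hx).differentiableAt.differentiableWithinAt
    · rw [interior_Icc]
      intro x hx
      rw [Function.iterate_succ, Function.iterate_one, Function.comp_apply, (hderiv2 x hx).deriv]
      have h := rpow_neg_add_rpow_neg_le (b := x) (abs_lt.2 hx) hρ0 hρ1
        (s := 2 - p) (t := 2 - q) (by linarith) (by linarith)
      have : 0 ≤ p * (q - 1) / 2 := by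
        have : 0 ≤ q - 1 := by linarith
        positivity
      exact mul_nonneg this (sub_nonneg.2 h)
  obtain ⟨hb1, hb2⟩ := abs_le.1 hb
  have h := hconv.2 (x := b) (y := -b) ⟨hb1, hb2⟩ ⟨by linarith, by linarith⟩
    (show (0 : ℝ) ≤ 1 / 2 by norm_num) (show (0 : ℝ) ≤ 1 / 2 by norm_num) (by norm_num)
  have e0 : D 0 = 0 := by simp [hD]
  have even : D (-b) = D b := by simp only [hD]; ring_nf
  have e1 : (1 / 2 : ℝ) • b + (1 / 2 : ℝ) • (-b) = 0 := by simp
  rw [e1, e0, even] at h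
  simp only [smul_eq_mul] at h
  have : 0 ≤ D b := by linarith
  simp only [hD] at this
  linarith

/-- **Bonami's two-point inequality** in the range `1 < q ≤ p ≤ 2`. -/
lemma two_point_inequality {p q ρ : ℝ} (hq : 1 < q) (hqp : q ≤ p) (hp : p ≤ 2) (hρ0 : 0 ≤ ρ)
    (hρ1 : ρ ≤ 1) (hρ : ρ ^ 2 * (p - 1) = q - 1) {a b : ℝ} (ha : 0 ≤ a) (hb : 0 ≤ b) :
    ((((1 + ρ) / 2 * a + (1 - ρ) / 2 * b) ^ p + ((1 - ρ) / 2 * a + (1 + ρ) / 2 * b) ^ p) / 2)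
        ^ (1 / p) ≤ ((a ^ q + b ^ q) / 2) ^ (1 / q) := by
  have hp1 : 1 < p := hq.trans_le hqp
  have hp0 : 0 < p := by linarith
  have hq0 : 0 < q := by linarith
  rcases (add_nonneg ha hb).eq_or_lt with h0 | hpos
  · have ha' : a = 0 := by linarith
    have hb' : b = 0 := by linarith
    subst ha' hb'
    simp [zero_rpow hp0.ne', zero_rpow hq0.ne', hp0.ne', hq0.ne']
  set m := (a + b) / 2 with hm
  have hm0 : 0 < m := by positivity
  set t := (a - b) / (a + b) with ht
  have htm : m * t = (a - b) / 2 := by rw [hm, ht]; field_simp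
  have habs : |t| ≤ 1 := by
    rw [ht, abs_div, abs_of_pos hpos, div_le_one hpos, abs_le]
    constructor <;> linarith
  obtain ⟨ht1, ht2⟩ := abs_le.1 habs
  have ea : a = m * (1 + t) := by rw [mul_add, htm]; ring
  have eb : b = m * (1 - t) := by rw [mul_sub, htm]; ring
  have e1 : (1 + ρ) / 2 * a + (1 - ρ) / 2 * b = m * (1 + ρ * t) := by
    linear_combination (-ρ) * htm
  have e2 : (1 - ρ) / 2 * a + (1 + ρ) / 2 * b = m * (1 - ρ * t) := by
    linear_combination ρ * htm
  have n1 : 0 ≤ 1 + ρ * t := by nlinarith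
  have n2 : 0 ≤ 1 - ρ * t := by nlinarith
  have n3 : 0 ≤ 1 + t := by linarith
  have n4 : 0 ≤ 1 - t := by linarith
  rw [e1, e2]
  conv_rhs => rw [ea, eb]
  rw [mul_rpow hm0.le n1, mul_rpow hm0.le n2, mul_rpow hm0.le n3, mul_rpow hm0.le n4,
    ← mul_add, ← mul_add, mul_div_assoc, mul_div_assoc, mul_rpow (by positivity) (by positivity),
    mul_rpow (by positivity) (by positivity), ← rpow_mul hm0.le, ← rpow_mul hm0.le,
    mul_one_div_cancel hp0.ne', mul_one_div_cancel hq0.ne']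
  refine mul_le_mul_of_nonneg_left ?_ (by positivity)
  have h := two_point_normalized hq hqp hp hρ0 hρ1 hρ habs
  have hB : 0 ≤ ((1 + t) ^ q + (1 - t) ^ q) / 2 := by positivity
  have h' := one_add_mul_self_le_rpow_one_add (s := ((1 + t) ^ q + (1 - t) ^ q) / 2 - 1)
    (by linarith) (p := p / q) ((one_le_div hq0).2 hqp)
  rw [add_sub_cancel] at h'
  calc _ ≤ ((((1 + t) ^ q + (1 - t) ^ q) / 2) ^ (p / q)) ^ (1 / p) :=
        rpow_le_rpow (by positivity) (h.trans h') (by positivity)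
    _ = _ := by rw [← rpow_mul hB]; congr 1; field_simp

lemma two_point_bilinear {p q r ρ : ℝ} (hq : 1 < q) (hqp : q ≤ p) (hp : p ≤ 2) (hρ0 : 0 ≤ ρ)
    (hρ1 : ρ ≤ 1) (hρ : ρ ^ 2 * (p - 1) = q - 1) (hpr : p.HolderConjugate r) {a b c d : ℝ}
    (ha : 0 ≤ a) (hb : 0 ≤ b) (hc : 0 ≤ c) (hd : 0 ≤ d) :
    (1 + ρ) / 4 * (a * c + b * d) + (1 - ρ) / 4 * (a * d + b * c) ≤
      ((a ^ q + b ^ q) / 2) ^ (1 / q) * ((c ^ r + d ^ r) / 2) ^ (1 / r) := by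
  set A := (1 + ρ) / 2 * a + (1 - ρ) / 2 * b with hA
  set B := (1 - ρ) / 2 * a + (1 + ρ) / 2 * b with hB
  have h1ρ : 0 ≤ 1 - ρ := by linarith
  have hA0 : 0 ≤ A := by positivity
  have hB0 : 0 ≤ B := by positivity
  have h := Real.inner_le_Lp_mul_Lq (Finset.univ : Finset (Fin 2)) ![A, B] ![c, d] hpr
  simp only [Fin.sum_univ_two, Matrix.cons_val_zero, Matrix.cons_val_one,
    abs_of_nonneg hA0, abs_of_nonneg hB0, abs_of_nonneg hc, abs_of_nonneg hd] at h
  have half : (1 / 2 : ℝ) = (1 / 2) ^ (1 / p) * (1 / 2) ^ (1 / r) := by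
    rw [← rpow_add (by norm_num), one_div p, one_div r, hpr.inv_add_inv_eq_one, rpow_one]
  have two := two_point_inequality hq hqp hp hρ0 hρ1 hρ ha hb
  calc _ = 1 / 2 * (A * c + B * d) := by rw [hA, hB]; ring
    _ ≤ 1 / 2 * ((A ^ p + B ^ p) ^ (1 / p) * (c ^ r + d ^ r) ^ (1 / r)) := by gcongr
    _ = ((1 / 2) ^ (1 / p) * (A ^ p + B ^ p) ^ (1 / p)) *
          ((1 / 2) ^ (1 / r) * (c ^ r + d ^ r) ^ (1 / r)) := by
        conv_lhs => rw [half]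
        ring
    _ = ((A ^ p + B ^ p) / 2) ^ (1 / p) * ((c ^ r + d ^ r) / 2) ^ (1 / r) := by
        rw [← mul_rpow (by norm_num) (by positivity), ← mul_rpow (by norm_num) (by positivity)]
        ring_nf
    _ ≤ _ := mul_le_mul_of_nonneg_right two (by positivity)


/-- `X` and `Y` are hypercontractively correlated under `κ`:
`E f(X) g(Y) ≤ ‖f(X)‖_q ‖g(Y)‖_r` for all nonnegative measurable `f` and `g`. -/
def Hypercontractive {Ω A B : Type*} [MeasurableSpace Ω] [MeasurableSpace A] [MeasurableSpace B]
    (κ : Measure Ω) (X : Ω → A) (Y : Ω → B) (q r : ℝ) : Prop :=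
  ∀ (f : A → ℝ≥0∞) (g : B → ℝ≥0∞), Measurable f → Measurable g →
    ∫⁻ ω, f (X ω) * g (Y ω) ∂κ ≤
      (∫⁻ ω, f (X ω) ^ q ∂κ) ^ (1 / q) * (∫⁻ ω, g (Y ω) ^ r ∂κ) ^ (1 / r)

namespace Hypercontractive

variable {Ω Ω' A B A' B' : Type*} [MeasurableSpace Ω] [MeasurableSpace Ω'] [MeasurableSpace A]
  [MeasurableSpace B] [MeasurableSpace A'] [MeasurableSpace B'] {κ : Measure Ω} {κ' : Measure Ω'}
  {X : Ω → A} {Y : Ω → B} {X' : Ω' → A'} {Y' : Ω' → B'} {q r : ℝ}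

lemma symm (h : Hypercontractive κ X Y q r) : Hypercontractive κ Y X r q := fun f g hf hg => by
  simpa only [mul_comm] using h g f hg hf

lemma comp (h : Hypercontractive κ X Y q r) {φ : A → A'} {ψ : B → B'} (hφ : Measurable φ)
    (hψ : Measurable ψ) : Hypercontractive κ (φ ∘ X) (ψ ∘ Y) q r := fun f g hf hg =>
  h (f ∘ φ) (g ∘ ψ) (hf.comp hφ) (hg.comp hψ)

lemma map {T : Ω' → Ω} (hT : Measurable T) (hX : Measurable X) (hY : Measurable Y)
    (h : Hypercontractive κ' (X ∘ T) (Y ∘ T) q r) : Hypercontractive (κ'.map T) X Y q r :=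
  fun f g hf hg => by
    rw [lintegral_map (by fun_prop) hT, lintegral_map (by fun_prop) hT,
      lintegral_map (by fun_prop) hT]
    exact h f g hf hg

lemma prod [SFinite κ'] [SFinite κ] (hX : Measurable X) (hY : Measurable Y) (hX' : Measurable X')
    (hY' : Measurable Y') (hq : 0 < q) (hr : 0 < r) (h : Hypercontractive κ X Y q r)
    (h' : Hypercontractive κ' X' Y' q r) :
    Hypercontractive (κ.prod κ') (Prod.map X X') (Prod.map Y Y') q r := fun f g hf hg => by
  have hF : Measurable fun a => (∫⁻ ω', f (a, X' ω') ^ q ∂κ') ^ (1 / q) :=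
    (Measurable.lintegral_prod_right' (f := fun z : A × Ω' => f (z.1, X' z.2) ^ q)
      (by fun_prop)).pow_const _
  have hG : Measurable fun b => (∫⁻ ω', g (b, Y' ω') ^ r ∂κ') ^ (1 / r) :=
    (Measurable.lintegral_prod_right' (f := fun z : B × Ω' => g (z.1, Y' z.2) ^ r)
      (by fun_prop)).pow_const _
  rw [lintegral_prod _ (by fun_prop), lintegral_prod _ (by fun_prop),
    lintegral_prod _ (by fun_prop)]
  simp only [Prod.map_apply]
  calc _ ≤ ∫⁻ ω, (∫⁻ ω', f (X ω, X' ω') ^ q ∂κ') ^ (1 / q) *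
        (∫⁻ ω', g (Y ω, Y' ω') ^ r ∂κ') ^ (1 / r) ∂κ :=
        lintegral_mono fun ω => h' (fun a' => f (X ω, a')) (fun b' => g (Y ω, b'))
          (by fun_prop) (by fun_prop)
    _ ≤ _ := h _ _ hF hG
    _ = _ := by
        simp only [← ENNReal.rpow_mul, one_div_mul_cancel hq.ne', one_div_mul_cancel hr.ne',
          ENNReal.rpow_one]

lemma pi [IsProbabilityMeasure κ] (hX : Measurable X) (hY : Measurable Y)
    (hq : 0 < q) (hr : 0 < r) (h : Hypercontractive κ X Y q r) (n : ℕ) :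
    Hypercontractive (Measure.pi fun _ : Fin n => κ) (fun ω i => X (ω i)) (fun ω i => Y (ω i))
      q r := by
  induction n with
  | zero =>
    intro f g hf hg
    have hf' : ∀ ω : Fin 0 → Ω, f (fun i => X (ω i)) = f default := fun ω =>
      congrArg f (Subsingleton.elim _ _)
    have hg' : ∀ ω : Fin 0 → Ω, g (fun i => Y (ω i)) = g default := fun ω =>
      congrArg g (Subsingleton.elim _ _)
    simp only [hf', hg', lintegral_const, measure_univ, mul_one, ← ENNReal.rpow_mul,
      mul_one_div_cancel hq.ne', mul_one_div_cancel hr.ne', ENNReal.rpow_one, le_refl]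
  | succ n ih =>
    have e := (measurePreserving_piFinSuccAbove (fun _ : Fin (n + 1) => κ) 0).symm
    rw [← e.map_eq]
    refine map e.measurable (by fun_prop) (by fun_prop) ?_
    have hc := (h.prod hX hY (X' := fun (ω : Fin n → Ω) i => X (ω i))
      (Y' := fun (ω : Fin n → Ω) i => Y (ω i)) (by fun_prop) (by fun_prop) hq hr ih).comp
      (MeasurableEquiv.piFinSuccAbove (fun _ => A) 0).symm.measurable
      (MeasurableEquiv.piFinSuccAbove (fun _ => B) 0).symm.measurable
    convert hc using 1
    · funext ω i
      refine Fin.cases ?_ (fun j => ?_) i <;> simp [MeasurableEquiv.piFinSuccAbove]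
    · funext ω i
      refine Fin.cases ?_ (fun j => ?_) i <;> simp [MeasurableEquiv.piFinSuccAbove]

end Hypercontractive

/-- The law on `{±1}² ⊆ ℂ` of a pair of `ρ`-correlated signs. -/
def signPair (ρ : ℝ) : Measure ℂ :=
  ENNReal.ofReal ((1 + ρ) / 4) • (Measure.dirac ⟨1, 1⟩ + Measure.dirac ⟨-1, -1⟩) +
    ENNReal.ofReal ((1 - ρ) / 4) • (Measure.dirac ⟨1, -1⟩ + Measure.dirac ⟨-1, 1⟩)

lemma lintegral_signPair (ρ : ℝ) (F : ℂ → ℝ≥0∞) :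
    ∫⁻ z, F z ∂signPair ρ =
      ENNReal.ofReal ((1 + ρ) / 4) * (F ⟨1, 1⟩ + F ⟨-1, -1⟩) +
        ENNReal.ofReal ((1 - ρ) / 4) * (F ⟨1, -1⟩ + F ⟨-1, 1⟩) := by
  simp [signPair, mul_add]

lemma ofReal_weight_add {ρ : ℝ} (h0 : -1 ≤ ρ) (h1 : ρ ≤ 1) :
    ENNReal.ofReal ((1 + ρ) / 4) + ENNReal.ofReal ((1 - ρ) / 4) = ENNReal.ofReal (1 / 2) := by
  rw [← ENNReal.ofReal_add (by linarith) (by linarith)]; congr 1; ring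

lemma isProbabilityMeasure_signPair {ρ : ℝ} (h0 : -1 ≤ ρ) (h1 : ρ ≤ 1) :
    IsProbabilityMeasure (signPair ρ) := ⟨by
  have h := lintegral_signPair ρ fun _ => 1
  rw [lintegral_one] at h
  rw [h, ← add_mul, ofReal_weight_add h0 h1, one_add_one_eq_two, ← ENNReal.ofReal_ofNat 2,
    ← ENNReal.ofReal_mul (by norm_num)]
  norm_num⟩

lemma hypercontractive_signPair {p q r ρ : ℝ} (hq : 1 < q) (hqp : q ≤ p) (hp : p ≤ 2)
    (hρ0 : 0 ≤ ρ) (hρ1 : ρ ≤ 1) (hρ : ρ ^ 2 * (p - 1) = q - 1) (hpr : p.HolderConjugate r) :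
    Hypercontractive (signPair ρ) Complex.re Complex.im q r := by
  intro f g hf hg
  have hq0 : 0 < q := by linarith
  have hr0 : 0 < r := hpr.symm.pos
  have half0 : ENNReal.ofReal (1 / 2) ≠ 0 := by norm_num
  simp only [lintegral_signPair]
  have ef : ENNReal.ofReal ((1 + ρ) / 4) * (f 1 ^ q + f (-1) ^ q) +
      ENNReal.ofReal ((1 - ρ) / 4) * (f 1 ^ q + f (-1) ^ q) =
      ENNReal.ofReal (1 / 2) * (f 1 ^ q + f (-1) ^ q) := by
    rw [← add_mul, ofReal_weight_add (by linarith) hρ1]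
  have eg : ENNReal.ofReal ((1 + ρ) / 4) * (g 1 ^ r + g (-1) ^ r) +
      ENNReal.ofReal ((1 - ρ) / 4) * (g (-1) ^ r + g 1 ^ r) =
      ENNReal.ofReal (1 / 2) * (g 1 ^ r + g (-1) ^ r) := by
    rw [add_comm (g (-1) ^ r), ← add_mul, ofReal_weight_add (by linarith) hρ1]
  rw [ef, eg]
  generalize f 1 = a
  generalize f (-1) = b
  generalize g 1 = c
  generalize g (-1) = d
  by_cases hab : a = 0 ∧ b = 0
  · simp [hab.1, hab.2]
  by_cases hcd : c = 0 ∧ d = 0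
  · simp [hcd.1, hcd.2]
  have hab0 : (ENNReal.ofReal (1 / 2) * (a ^ q + b ^ q)) ^ (1 / q) ≠ 0 := by
    simp only [ne_eq, ENNReal.rpow_eq_zero_iff, mul_eq_zero, half0, add_eq_zero, hq0, hq0.not_gt,
      and_true, and_false, or_false, false_or, not_or, not_and]
    refine ⟨fun h => absurd h hab, fun _ h => ?_⟩
    linarith [one_div_pos.2 hq0]
  have hcd0 : (ENNReal.ofReal (1 / 2) * (c ^ r + d ^ r)) ^ (1 / r) ≠ 0 := by
    simp only [ne_eq, ENNReal.rpow_eq_zero_iff, mul_eq_zero, half0, add_eq_zero, hr0, hr0.not_gt,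
      and_true, and_false, or_false, false_or, not_or, not_and]
    refine ⟨fun h => absurd h hcd, fun _ h => ?_⟩
    linarith [one_div_pos.2 hr0]
  by_cases htop : a = ∞ ∨ b = ∞ ∨ c = ∞ ∨ d = ∞
  · have hR : (ENNReal.ofReal (1 / 2) * (a ^ q + b ^ q)) ^ (1 / q) *
        (ENNReal.ofReal (1 / 2) * (c ^ r + d ^ r)) ^ (1 / r) = ∞ := by
      rcases htop with h | h | h | h
      · rw [ENNReal.mul_eq_top]; right; refine ⟨?_, hcd0⟩
        simp [h, hq0, ENNReal.mul_top]
      · rw [ENNReal.mul_eq_top]; right; refine ⟨?_, hcd0⟩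
        simp [h, hq0, ENNReal.mul_top]
      · rw [ENNReal.mul_eq_top]; left; refine ⟨hab0, ?_⟩
        simp [h, hr0, ENNReal.mul_top]
      · rw [ENNReal.mul_eq_top]; left; refine ⟨hab0, ?_⟩
        simp [h, hr0, ENNReal.mul_top]
    rw [hR]; exact le_top
  push Not at htop
  obtain ⟨ha, hb, hc, hd⟩ := htop
  have h := two_point_bilinear hq hqp hp hρ0 hρ1 hρ hpr (a := a.toReal) (b := b.toReal)
    (c := c.toReal) (d := d.toReal) (by positivity) (by positivity) (by positivity) (by positivity)
  have h' := ENNReal.ofReal_le_ofReal h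
  have h1ρ : 0 ≤ 1 - ρ := by linarith
  rw [ENNReal.ofReal_add (by positivity) (by positivity), ENNReal.ofReal_mul (by positivity),
    ENNReal.ofReal_mul (by positivity), ENNReal.ofReal_add (by positivity) (by positivity),
    ENNReal.ofReal_add (by positivity) (by positivity), ENNReal.ofReal_mul (by positivity),
    ENNReal.ofReal_mul (by positivity), ENNReal.ofReal_mul (by positivity),
    ENNReal.ofReal_mul (by positivity), ENNReal.ofReal_mul (by positivity),
    ← ENNReal.ofReal_rpow_of_nonneg (by positivity) (by positivity),
    ← ENNReal.ofReal_rpow_of_nonneg (by positivity) (by positivity),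
    div_eq_inv_mul _ (2 : ℝ), div_eq_inv_mul _ (2 : ℝ), ← one_div (2 : ℝ),
    ENNReal.ofReal_mul (by positivity),
    ENNReal.ofReal_mul (by positivity), ENNReal.ofReal_add (by positivity) (by positivity),
    ENNReal.ofReal_add (by positivity) (by positivity),
    ← ENNReal.ofReal_rpow_of_nonneg (by positivity) (by positivity),
    ← ENNReal.ofReal_rpow_of_nonneg (by positivity) (by positivity),
    ← ENNReal.ofReal_rpow_of_nonneg (by positivity) (by positivity),
    ← ENNReal.ofReal_rpow_of_nonneg (by positivity) (by positivity),
    ENNReal.ofReal_toReal ha, ENNReal.ofReal_toReal hb, ENNReal.ofReal_toReal hc,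
    ENNReal.ofReal_toReal hd] at h'
  exact h'

lemma charFun_signPair {ρ : ℝ} (h0 : -1 ≤ ρ) (h1 : ρ ≤ 1) (t : ℂ) :
    charFun (signPair ρ) t =
      (((1 + ρ) / 2 * cos (t.re + t.im) + (1 - ρ) / 2 * cos (t.re - t.im) : ℝ) : ℂ) := by
  have hint : ∀ z : ℂ, Integrable (fun x : ℂ => Complex.exp (inner ℝ x t * Complex.I))
      (Measure.dirac z) := fun z => integrable_dirac (by simp)
  rw [charFun_apply, signPair, integral_add_measure, integral_smul_measure, integral_smul_measure,
    integral_add_measure (hint _) (hint _), integral_add_measure (hint _) (hint _)]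
  · simp only [integral_dirac, Complex.inner, ENNReal.toReal_ofReal (show 0 ≤ (1 + ρ) / 4 by linarith),
      ENNReal.toReal_ofReal (show 0 ≤ (1 - ρ) / 4 by linarith)]
    simp only [Complex.mul_re, Complex.conj_re, Complex.conj_im, Complex.real_smul]
    push_cast
    rw [Complex.cos, Complex.cos]
    ring_nf
  · exact ((hint _).add_measure (hint _)).smul_measure (by simp)
  · exact ((hint _).add_measure (hint _)).smul_measure (by simp)

/-- The law of the normalised sum of `N` independent pairs of `ρ`-correlated signs. -/
def signPairSum (ρ : ℝ) (N : ℕ) : Measure ℂ :=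
  (Measure.pi fun _ : Fin N => signPair ρ).map fun z => (√N)⁻¹ • ∑ i, z i

lemma hypercontractive_signPairSum {p q r ρ : ℝ} (hq : 1 < q) (hqp : q ≤ p) (hp : p ≤ 2)
    (hρ0 : 0 ≤ ρ) (hρ1 : ρ ≤ 1) (hρ : ρ ^ 2 * (p - 1) = q - 1) (hpr : p.HolderConjugate r)
    (N : ℕ) : Hypercontractive (signPairSum ρ N) Complex.re Complex.im q r := by
  have := isProbabilityMeasure_signPair (ρ := ρ) (by linarith) hρ1
  have h := ((hypercontractive_signPair hq hqp hp hρ0 hρ1 hρ hpr).pi Complex.measurable_re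
    Complex.measurable_im (by linarith) hpr.symm.pos N).comp
    (φ := fun v : Fin N → ℝ => (√N)⁻¹ * ∑ i, v i) (ψ := fun v : Fin N → ℝ => (√N)⁻¹ * ∑ i, v i)
    (by fun_prop) (by fun_prop)
  refine Hypercontractive.map (by fun_prop) Complex.measurable_re Complex.measurable_im ?_
  convert h using 1 <;>
    (funext z; simp only [Function.comp_apply, Complex.smul_re, Complex.smul_im, Complex.re_sum,
      Complex.im_sum, smul_eq_mul])

lemma charFun_signPairSum {ρ : ℝ} (h0 : -1 ≤ ρ) (h1 : ρ ≤ 1) (N : ℕ) (t : ℂ) :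
    charFun (signPairSum ρ N) t = charFun (signPair ρ) ((√N)⁻¹ • t) ^ N := by
  have := isProbabilityMeasure_signPair h0 h1
  have e : ∀ z : Fin N → ℂ, Complex.exp (inner ℝ ((√N)⁻¹ • ∑ i, z i) t * Complex.I) =
      ∏ i, Complex.exp (inner ℝ (z i) ((√N)⁻¹ • t) * Complex.I) := fun z => by
    rw [← Complex.exp_sum, ← Finset.sum_mul, real_inner_smul_left, sum_inner, Finset.mul_sum]
    simp only [real_inner_smul_right, Complex.ofReal_sum, Finset.sum_mul]
  rw [charFun_apply, signPairSum, integral_map (by fun_prop) (by fun_prop)]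
  simp_rw [e]
  rw [integral_fintype_prod_eq_pow (ι := Fin N) (fun z : ℂ =>
    Complex.exp (inner ℝ z ((√N)⁻¹ • t) * Complex.I)), Fintype.card_fin, charFun_apply]

/-- The law on `ℂ` of a `ρ`-correlated pair of standard Gaussian variables. -/
def gaussPair (ρ : ℝ) : Measure ℂ :=
  ((ProbabilityTheory.gaussianReal 0 1).prod (ProbabilityTheory.gaussianReal 0 1)).map
    fun z => ⟨z.1, ρ * z.1 + √(1 - ρ ^ 2) * z.2⟩

lemma measurable_complex_mk {α : Type*} [MeasurableSpace α] {f g : α → ℝ} (hf : Measurable f)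
    (hg : Measurable g) : Measurable fun x => (⟨f x, g x⟩ : ℂ) :=
  Complex.measurableEquivRealProd.symm.measurable.comp (hf.prodMk hg)

lemma charFun_gaussPair {ρ : ℝ} (hρ : ρ ^ 2 ≤ 1) (t : ℂ) :
    charFun (gaussPair ρ) t =
      ((rexp (-(t.re ^ 2 + 2 * ρ * (t.re * t.im) + t.im ^ 2) / 2) : ℝ) : ℂ) := by
  have e : ∀ z : ℝ × ℝ, Complex.exp (inner ℝ (⟨z.1, ρ * z.1 + √(1 - ρ ^ 2) * z.2⟩ : ℂ) t *
      Complex.I) = Complex.exp ((t.re + ρ * t.im : ℝ) * z.1 * Complex.I) *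
        Complex.exp ((√(1 - ρ ^ 2) * t.im : ℝ) * z.2 * Complex.I) := fun z => by
    rw [← Complex.exp_add, Complex.inner]
    simp only [Complex.mul_re, Complex.conj_re, Complex.conj_im]
    push_cast
    ring_nf
  rw [charFun_apply, gaussPair, integral_map
    (measurable_complex_mk (by fun_prop) (by fun_prop)).aemeasurable (by fun_prop)]
  simp_rw [e]
  rw [integral_prod_mul (fun x : ℝ => Complex.exp ((t.re + ρ * t.im : ℝ) * x * Complex.I))
    (fun x : ℝ => Complex.exp ((√(1 - ρ ^ 2) * t.im : ℝ) * x * Complex.I)),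
    ← charFun_apply_real, ← charFun_apply_real, ProbabilityTheory.charFun_gaussianReal,
    ProbabilityTheory.charFun_gaussianReal, ← Complex.exp_add]
  push_cast
  congr 1
  have hs : ((√(1 - ρ ^ 2) : ℝ) : ℂ) ^ 2 = 1 - ρ ^ 2 := by
    rw [← Complex.ofReal_pow, sq_sqrt (by linarith)]; push_cast; ring
  linear_combination (-(t.im : ℂ) ^ 2 / 2) * hs

lemma tendsto_natCast_mul_cos_sub_one (a : ℝ) :
    Tendsto (fun n : ℕ => (n : ℝ) * (cos ((√n)⁻¹ * a) - 1)) atTop (nhds (-a ^ 2 / 2)) := by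
  rw [tendsto_iff_norm_sub_tendsto_zero]
  have hlim : Tendsto (fun n : ℕ => a ^ 4 * (5 / 96) / (n : ℝ)) atTop (nhds 0) :=
    tendsto_const_div_atTop_nhds_zero_nat _
  refine squeeze_zero' (Eventually.of_forall fun _ => norm_nonneg _) ?_ hlim
  obtain ⟨M, hM⟩ := exists_nat_ge (a ^ 2 + 1)
  filter_upwards [eventually_ge_atTop M] with n hn
  have hn' : a ^ 2 + 1 ≤ n := hM.trans (by exact_mod_cast hn)
  have hn0 : (0 : ℝ) < n := by nlinarith [sq_nonneg a]
  have hs : (√(n : ℝ))⁻¹ ^ 2 = 1 / n := by rw [inv_pow, sq_sqrt hn0.le, one_div]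
  have hsq : ((√(n : ℝ))⁻¹ * a) ^ 2 = a ^ 2 / n := by rw [mul_pow, hs]; ring
  have habs : |(√(n : ℝ))⁻¹ * a| ≤ 1 := by
    rw [← sq_le_one_iff_abs_le_one, hsq, div_le_one hn0]; linarith
  have h := cos_bound habs
  have h4 : |(√(n : ℝ))⁻¹ * a| ^ 4 = a ^ 4 / n ^ 2 := by
    rw [show (4 : ℕ) = 2 * 2 from rfl, pow_mul, sq_abs, hsq]; ring
  rw [h4, hsq] at h
  have e : (n : ℝ) * (cos ((√n)⁻¹ * a) - 1) - -a ^ 2 / 2 =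
      n * (cos ((√n)⁻¹ * a) - (1 - a ^ 2 / n / 2)) := by field_simp; ring
  rw [e, norm_mul, Real.norm_of_nonneg hn0.le, Real.norm_eq_abs]
  calc _ ≤ (n : ℝ) * (a ^ 4 / n ^ 2 * (5 / 96)) := by gcongr
    _ = _ := by field_simp

lemma tendsto_charFun_signPairSum {ρ : ℝ} (h0 : -1 ≤ ρ) (h1 : ρ ≤ 1) (t : ℂ) :
    Tendsto (fun N => charFun (signPairSum ρ N) t) atTop (nhds (charFun (gaussPair ρ) t)) := by
  simp_rw [charFun_signPairSum h0 h1, charFun_signPair h0 h1]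
  rw [charFun_gaussPair (by nlinarith)]
  simp_rw [← Complex.ofReal_pow]
  refine (Complex.continuous_ofReal.tendsto _).comp ?_
  have hlim : Tendsto (fun n : ℕ => (n : ℝ) *
      ((1 + ρ) / 2 * (cos ((√n)⁻¹ * (t.re + t.im)) - 1) +
        (1 - ρ) / 2 * (cos ((√n)⁻¹ * (t.re - t.im)) - 1))) atTop
      (nhds (-(t.re ^ 2 + 2 * ρ * (t.re * t.im) + t.im ^ 2) / 2)) := by
    have h := ((tendsto_natCast_mul_cos_sub_one (t.re + t.im)).const_mul ((1 + ρ) / 2)).add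
      ((tendsto_natCast_mul_cos_sub_one (t.re - t.im)).const_mul ((1 - ρ) / 2))
    convert h using 2 <;> ring
  convert Real.tendsto_one_add_pow_exp_of_tendsto hlim using 2 with n
  simp only [Complex.smul_re, Complex.smul_im, smul_eq_mul]
  ring_nf

instance isProbabilityMeasure_gaussPair (ρ : ℝ) : IsProbabilityMeasure (gaussPair ρ) :=
  Measure.isProbabilityMeasure_map
    (measurable_complex_mk (by fun_prop) (by fun_prop)).aemeasurable

lemma isProbabilityMeasure_signPairSum {ρ : ℝ} (h0 : -1 ≤ ρ) (h1 : ρ ≤ 1) (N : ℕ) :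
    IsProbabilityMeasure (signPairSum ρ N) := by
  have := isProbabilityMeasure_signPair h0 h1
  exact Measure.isProbabilityMeasure_map (by fun_prop)

/-- Hypercontractivity of correlated Gaussian vectors, tested on bounded continuous functions. -/
lemma hypercontractive_gaussPair_bounded {p q r ρ : ℝ} (hq : 1 < q) (hqp : q ≤ p) (hp : p ≤ 2)
    (hρ0 : 0 ≤ ρ) (hρ1 : ρ ≤ 1) (hρ : ρ ^ 2 * (p - 1) = q - 1) (hpr : p.HolderConjugate r)
    {n : ℕ} {f g : (Fin n → ℝ) → NNReal} (hf : Continuous f) (hg : Continuous g) {M : NNReal}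
    (hfM : ∀ x, f x ≤ M) (hgM : ∀ x, g x ≤ M) :
    ∫⁻ z, f (fun i => (z i).re) * g (fun i => (z i).im) ∂Measure.pi (fun _ => gaussPair ρ) ≤
      (∫⁻ z, (f fun i => (z i).re) ^ q ∂Measure.pi fun _ => gaussPair ρ) ^ (1 / q) *
      (∫⁻ z, (g fun i => (z i).im) ^ r ∂Measure.pi fun _ => gaussPair ρ) ^ (1 / r) := by
  have hq0 : 0 < q := by linarith
  have hr0 : 0 < r := hpr.symm.pos
  let μ : ℕ → ProbabilityMeasure ℂ := fun N =>
    ⟨signPairSum ρ N, isProbabilityMeasure_signPairSum (by linarith) hρ1 N⟩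
  let μ₀ : ProbabilityMeasure ℂ := ⟨gaussPair ρ, inferInstance⟩
  have hμ : Tendsto μ atTop (nhds μ₀) :=
    ProbabilityMeasure.tendsto_of_tendsto_charFun
      (tendsto_charFun_signPairSum (by linarith) hρ1)
  have hpi : Tendsto (fun N => ProbabilityMeasure.pi fun _ : Fin n => μ N) atTop
      (nhds (ProbabilityMeasure.pi fun _ : Fin n => μ₀)) :=
    (ProbabilityMeasure.continuous_pi.tendsto (fun _ : Fin n => μ₀)).comp
      (tendsto_pi_nhds.2 fun _ => hμ)
  rw [ProbabilityMeasure.tendsto_iff_forall_lintegral_tendsto] at hpi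
  have lim : ∀ (F : (Fin n → ℂ) → NNReal), Continuous F → ∀ K : NNReal, (∀ z, F z ≤ K) →
      Tendsto (fun N => ∫⁻ z, F z ∂Measure.pi fun _ : Fin n => signPairSum ρ N) atTop
        (nhds (∫⁻ z, F z ∂Measure.pi fun _ : Fin n => gaussPair ρ)) := fun F hF K hK =>
    hpi ⟨⟨F, hF⟩, K + K, fun x y => by
      rw [NNReal.dist_eq, abs_le]
      have h1 : (F x : ℝ) ≤ K := hK x
      have h2 : (F y : ℝ) ≤ K := hK y
      constructor <;> simp <;> nlinarith [(F x).2, (F y).2]⟩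
  have hf' : Continuous fun z : Fin n → ℂ => f fun i => (z i).re := by fun_prop
  have hg' : Continuous fun z : Fin n → ℂ => g fun i => (z i).im := by fun_prop
  have l1 := lim (fun z => f (fun i => (z i).re) * g fun i => (z i).im) (hf'.mul hg') (M * M)
    fun z => mul_le_mul' (hfM _) (hgM _)
  have l2 := lim (fun z => f (fun i => (z i).re) ^ q)
    ((NNReal.continuous_rpow_const hq0.le).comp hf') (M ^ q)
    fun z => NNReal.rpow_le_rpow (hfM _) hq0.le
  have l3 := lim (fun z => g (fun i => (z i).im) ^ r)
    ((NNReal.continuous_rpow_const hr0.le).comp hg') (M ^ r)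
    fun z => NNReal.rpow_le_rpow (hgM _) hr0.le
  simp only [ENNReal.coe_mul, ENNReal.coe_rpow_of_nonneg _ hq0.le,
    ENNReal.coe_rpow_of_nonneg _ hr0.le] at l1 l2 l3
  have fin : ∀ F : (Fin n → ℂ) → ℝ≥0∞, ∀ K : NNReal, (∀ z, F z ≤ K) →
      ∫⁻ z, F z ∂Measure.pi (fun _ : Fin n => gaussPair ρ) ≠ ∞ := fun F K hK =>
    ((lintegral_mono hK).trans_lt (by simp)).ne
  refine le_of_tendsto_of_tendsto' l1 (ENNReal.Tendsto.mul
    ((ENNReal.continuous_rpow_const.tendsto _).comp l2) (Or.inr ?_)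
    ((ENNReal.continuous_rpow_const.tendsto _).comp l3) (Or.inr ?_)) fun N => ?_
  · refine ENNReal.rpow_ne_top_of_nonneg (by positivity) (fin _ (M ^ r) fun z => ?_)
    rw [ENNReal.coe_rpow_of_nonneg _ hr0.le]
    exact ENNReal.rpow_le_rpow (by exact_mod_cast hgM _) hr0.le
  · refine ENNReal.rpow_ne_top_of_nonneg (by positivity) (fin _ (M ^ q) fun z => ?_)
    rw [ENNReal.coe_rpow_of_nonneg _ hq0.le]
    exact ENNReal.rpow_le_rpow (by exact_mod_cast hfM _) hq0.le
  · have := isProbabilityMeasure_signPairSum (ρ := ρ) (by linarith) hρ1 N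
    exact (hypercontractive_signPairSum hq hqp hp hρ0 hρ1 hρ hpr N).pi Complex.measurable_re
      Complex.measurable_im hq0 hr0 n (fun x => f x) (fun x => g x) (by fun_prop) (by fun_prop)

instance isProbabilityMeasure_gauss (n : ℕ) : IsProbabilityMeasure (gauss n) := by
  unfold gauss; infer_instance

lemma lintegral_pi_map_prod {β : Type*} [MeasurableSpace β] {n : ℕ} {T : ℝ × ℝ → β}
    (hT : Measurable T) {Φ : (Fin n → β) → ℝ≥0∞} (hΦ : Measurable Φ) :
    ∫⁻ z, Φ z ∂Measure.pi (fun _ => ((ProbabilityTheory.gaussianReal 0 1).prod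
      (ProbabilityTheory.gaussianReal 0 1)).map T) =
      ∫⁻ x, ∫⁻ y, Φ (fun i => T (x i, y i)) ∂gauss n ∂gauss n := by
  have hm : Measurable fun (x : Fin n → ℝ × ℝ) i => T (x i) := by fun_prop
  have : IsProbabilityMeasure (((ProbabilityTheory.gaussianReal 0 1).prod
      (ProbabilityTheory.gaussianReal 0 1)).map T) :=
    Measure.isProbabilityMeasure_map hT.aemeasurable
  rw [← Measure.pi_map_pi fun _ => hT.aemeasurable, lintegral_map hΦ hm]
  have h := measurePreserving_arrowProdEquivProdArrow ℝ ℝ (Fin n)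
    (fun _ => ProbabilityTheory.gaussianReal 0 1) (fun _ => ProbabilityTheory.gaussianReal 0 1)
  have hm2 : Measurable fun w : (Fin n → ℝ) × (Fin n → ℝ) => Φ fun i => T (w.1 i, w.2 i) :=
    hΦ.comp (by fun_prop)
  have := h.lintegral_comp hm2
  rw [lintegral_prod _ hm2.aemeasurable] at this
  exact this

lemma lintegral_gauss_rotate {n : ℕ} {c s : ℝ} (hcs : c ^ 2 + s ^ 2 = 1)
    {Φ : (Fin n → ℝ) → (Fin n → ℝ) → ℝ≥0∞} (hΦ : Measurable (Function.uncurry Φ)) :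
    ∫⁻ x, ∫⁻ y, Φ (c • x + s • y) (-s • x + c • y) ∂gauss n ∂gauss n =
      ∫⁻ x, ∫⁻ y, Φ x y ∂gauss n ∂gauss n := by
  obtain ⟨θ, hc, hs⟩ : ∃ θ, cos θ = c ∧ sin θ = s := by
    have hn : ‖(⟨c, s⟩ : ℂ)‖ = 1 := by
      rw [Complex.norm_def, Complex.normSq_apply]
      simp only [← sq, hcs, sqrt_one]
    have h0 : (⟨c, s⟩ : ℂ) ≠ 0 := by
      intro h
      simp [h] at hn
    exact ⟨Complex.arg ⟨c, s⟩, by rw [Complex.cos_arg h0, hn, div_one],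
      by rw [Complex.sin_arg, hn, div_one]⟩
  have hrot := ProbabilityTheory.IsGaussian.map_rotation_eq_self
    (μ := ProbabilityTheory.gaussianReal 0 1) (by simp) θ
  have hm : Measurable fun z : Fin n → ℝ × ℝ => Φ (fun i => (z i).1) (fun i => (z i).2) :=
    hΦ.comp (f := fun z : Fin n → ℝ × ℝ => ((fun i => (z i).1, fun i => (z i).2) :
      (Fin n → ℝ) × (Fin n → ℝ))) (by fun_prop)
  have h1 := lintegral_pi_map_prod (ContinuousLinearMap.rotation θ).continuous.measurable hm
  have h2 := lintegral_pi_map_prod (n := n) measurable_id hm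
  rw [hrot] at h1
  rw [Measure.map_id, h1] at h2
  simp only [ContinuousLinearMap.rotation_apply, hc, hs] at h2
  exact h2

lemma map_swap_gaussPair {ρ : ℝ} (hρ : ρ ^ 2 ≤ 1) :
    (gaussPair ρ).map (fun z => (⟨z.im, z.re⟩ : ℂ)) = gaussPair ρ := by
  have hm : Measurable fun z : ℂ => (⟨z.im, z.re⟩ : ℂ) :=
    measurable_complex_mk (by fun_prop) (by fun_prop)
  have := Measure.isProbabilityMeasure_map (μ := gaussPair ρ) hm.aemeasurable
  refine Measure.ext_of_charFun (funext fun t => ?_)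
  rw [charFun_apply, integral_map hm.aemeasurable (by fun_prop)]
  have h := charFun_apply (μ := gaussPair ρ) (⟨t.im, t.re⟩ : ℂ)
  rw [charFun_gaussPair hρ] at h ⊢
  convert h.symm using 3
  · simp only [Complex.inner, Complex.mul_re, Complex.conj_re, Complex.conj_im]
    ring_nf
  · ring_nf

lemma lintegral_pi_gaussPair {n : ℕ} (ρ : ℝ) {Φ : (Fin n → ℝ) → (Fin n → ℝ) → ℝ≥0∞}
    (hΦ : Measurable (Function.uncurry Φ)) :
    ∫⁻ z, Φ (fun i => (z i).re) (fun i => (z i).im) ∂Measure.pi (fun _ => gaussPair ρ) =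
      ∫⁻ x, ∫⁻ y, Φ x (ρ • x + √(1 - ρ ^ 2) • y) ∂gauss n ∂gauss n := 
  lintegral_pi_map_prod (measurable_complex_mk (by fun_prop) (by fun_prop))
    (hΦ.comp (f := fun z : Fin n → ℂ => ((fun i => (z i).re, fun i => (z i).im) :
      (Fin n → ℝ) × (Fin n → ℝ))) (by fun_prop))

lemma lintegral_pi_gaussPair_swap {n : ℕ} {ρ : ℝ} (hρ : ρ ^ 2 ≤ 1)
    {Φ : (Fin n → ℝ) → (Fin n → ℝ) → ℝ≥0∞} (hΦ : Measurable (Function.uncurry Φ)) :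
    ∫⁻ z, Φ (fun i => (z i).im) (fun i => (z i).re) ∂Measure.pi (fun _ => gaussPair ρ) =
      ∫⁻ z, Φ (fun i => (z i).re) (fun i => (z i).im) ∂Measure.pi (fun _ => gaussPair ρ) := by
  have hm : Measurable fun z : ℂ => (⟨z.im, z.re⟩ : ℂ) :=
    measurable_complex_mk (by fun_prop) (by fun_prop)
  have := Measure.isProbabilityMeasure_map (μ := gaussPair ρ) hm.aemeasurable
  have h : (Measure.pi fun _ : Fin n => gaussPair ρ).map
      (fun z i => (⟨(z i).im, (z i).re⟩ : ℂ)) = Measure.pi fun _ => gaussPair ρ := by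
    rw [Measure.pi_map_pi fun _ => hm.aemeasurable, map_swap_gaussPair hρ]
  have hm' : Measurable fun (z : Fin n → ℂ) i => (⟨(z i).im, (z i).re⟩ : ℂ) :=
    measurable_pi_lambda _ fun i => hm.comp (measurable_pi_apply i)
  conv_rhs => rw [← h]
  exact (lintegral_map (hΦ.comp (f := fun z : Fin n → ℂ => ((fun i => (z i).re, fun i => (z i).im) :
      (Fin n → ℝ) × (Fin n → ℝ))) (by fun_prop)) hm').symm

lemma lintegral_pi_gaussPair_re {n : ℕ} (ρ : ℝ) {f : (Fin n → ℝ) → ℝ≥0∞} (hf : Measurable f) :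
    ∫⁻ z, f (fun i => (z i).re) ∂Measure.pi (fun _ => gaussPair ρ) = ∫⁻ x, f x ∂gauss n := by
  rw [lintegral_pi_gaussPair ρ (Φ := fun x _ => f x) (hf.comp measurable_fst)]
  simp

lemma lintegral_pi_gaussPair_im {n : ℕ} {ρ : ℝ} (hρ : ρ ^ 2 ≤ 1) {f : (Fin n → ℝ) → ℝ≥0∞}
    (hf : Measurable f) :
    ∫⁻ z, f (fun i => (z i).im) ∂Measure.pi (fun _ => gaussPair ρ) = ∫⁻ x, f x ∂gauss n := by
  rw [← lintegral_pi_gaussPair_re ρ hf]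
  exact lintegral_pi_gaussPair_swap hρ (Φ := fun x _ => f x) (hf.comp measurable_fst)

/-- Gaussian hypercontractivity, in bilinear form. -/
theorem gauss_hypercontractive {p q r ρ : ℝ} (hq : 1 < q) (hqp : q ≤ p) (hp : p ≤ 2 ∨ 2 ≤ q)
    (hρ0 : 0 ≤ ρ) (hρ1 : ρ ≤ 1) (hρ : ρ ^ 2 * (p - 1) = q - 1) (hpr : p.HolderConjugate r)
    {n : ℕ} {f g : (Fin n → ℝ) → NNReal} (hf : Continuous f) (hg : Continuous g) :
    ∫⁻ x, ∫⁻ y, f x * g (ρ • x + √(1 - ρ ^ 2) • y) ∂gauss n ∂gauss n ≤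
      (∫⁻ x, (f x : ℝ≥0∞) ^ q ∂gauss n) ^ (1 / q) *
      (∫⁻ x, (g x : ℝ≥0∞) ^ r ∂gauss n) ^ (1 / r) := by
  have hρ2 : ρ ^ 2 ≤ 1 := by nlinarith
  have bdd : ∀ (f g : (Fin n → ℝ) → NNReal), Continuous f → Continuous g → ∀ M : NNReal,
      (∀ x, f x ≤ M) → (∀ x, g x ≤ M) →
      ∫⁻ z, f (fun i => (z i).re) * g (fun i => (z i).im) ∂Measure.pi (fun _ => gaussPair ρ) ≤
      (∫⁻ x, (f x : ℝ≥0∞) ^ q ∂gauss n) ^ (1 / q) *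
      (∫⁻ x, (g x : ℝ≥0∞) ^ r ∂gauss n) ^ (1 / r) := by
    intro f g hf hg M hfM hgM
    have mf := hf.measurable
    have mg := hg.measurable
    rcases hp with hp | hp
    · have h := hypercontractive_gaussPair_bounded hq hqp hp hρ0 hρ1 hρ hpr hf hg hfM hgM
      rwa [lintegral_pi_gaussPair_re ρ (f := fun x => (f x : ℝ≥0∞) ^ q) (by fun_prop),
        lintegral_pi_gaussPair_im hρ2 (f := fun x => (g x : ℝ≥0∞) ^ r) (by fun_prop)] at h
    · have hqq : q.HolderConjugate (q / (q - 1)) := Real.HolderConjugate.conjExponent hq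
      have hrr : r = p / (p - 1) := hpr.conjugate_eq
      have hp1 : 0 < p - 1 := by linarith
      have hq1 : 0 < q - 1 := by linarith
      have h := hypercontractive_gaussPair_bounded (q := r) (p := q / (q - 1)) (r := q) (ρ := ρ)
        hpr.symm.lt (by rw [hrr, div_le_div_iff₀ hp1 hq1]; nlinarith)
        (by rw [div_le_iff₀ hq1]; linarith) hρ0 hρ1
        (by rw [hrr]; field_simp; linarith) hqq.symm hg hf hgM hfM
      rw [lintegral_pi_gaussPair_re ρ (f := fun x => (g x : ℝ≥0∞) ^ r) (by fun_prop),
        lintegral_pi_gaussPair_im hρ2 (f := fun x => (f x : ℝ≥0∞) ^ q) (by fun_prop),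
        mul_comm] at h
      refine le_trans (le_of_eq ?_) h
      rw [← lintegral_pi_gaussPair_swap hρ2 (Φ := fun x y => (f x : ℝ≥0∞) * g y) (by fun_prop)]
      simp_rw [mul_comm]
  have mf := hf.measurable
  have mg := hg.measurable
  rw [← lintegral_pi_gaussPair ρ (Φ := fun x y => (f x : ℝ≥0∞) * g y) (by fun_prop)]
  have hsup : ∀ z : Fin n → ℂ, (f (fun i => (z i).re) : ℝ≥0∞) * g (fun i => (z i).im) =
      ⨆ M : ℕ, ((min (f (fun i => (z i).re)) M : NNReal) : ℝ≥0∞) *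
        ((min (g (fun i => (z i).im)) M : NNReal) : ℝ≥0∞) := by
    intro z
    refine le_antisymm ?_ (iSup_le fun M => by gcongr <;> exact min_le_left _ _)
    obtain ⟨M, hM⟩ := exists_nat_ge (max (f fun i => (z i).re) (g fun i => (z i).im))
    refine le_trans (le_of_eq ?_) (le_iSup _ M)
    rw [min_eq_left ((le_max_left _ _).trans hM), min_eq_left ((le_max_right _ _).trans hM)]
  rw [lintegral_congr hsup]
  rw [lintegral_iSup (fun M => by fun_prop) (fun a b hab z => by
    have : (a : NNReal) ≤ b := by exact_mod_cast hab
    gcongr)]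
  refine iSup_le fun M => (bdd (fun x => min (f x) M) (fun x => min (g x) M) (by fun_prop)
    (by fun_prop) M (fun _ => min_le_right _ _) (fun _ => min_le_right _ _)).trans ?_
  have := hpr.symm.pos
  gcongr with x x <;> exact min_le_left _ _

lemma lintegral_le_lintegral_rpow {α : Type*} [MeasurableSpace α] {μ : Measure α}
    [IsProbabilityMeasure μ] {q : ℝ} (hq : 1 ≤ q) {F : α → ℝ≥0∞} (hF : AEMeasurable F μ) :
    ∫⁻ x, F x ∂μ ≤ (∫⁻ x, F x ^ q ∂μ) ^ (1 / q) := by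
  rcases hq.eq_or_lt with rfl | hq
  · simp
  · have h := ENNReal.lintegral_mul_le_Lp_mul_Lq μ (Real.HolderConjugate.conjExponent hq) hF
      (aemeasurable_const (b := (1 : ℝ≥0∞)))
    simpa using h

/-- The Ornstein-Uhlenbeck type smoothing estimate at a fixed angle. -/
lemma lintegral_gauss_mul_rotated_le {n : ℕ} {H : (Fin n → ℝ) → (Fin n → ℝ) → NNReal}
    {g : (Fin n → ℝ) → NNReal} (hH : Continuous (Function.uncurry H)) (hg : Continuous g)
    {c s l m p q r : ℝ} (hs : 0 ≤ s) (hcs : c ^ 2 + s ^ 2 = 1) (hl : 0 < l)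
    (hm : 0 ≤ m) (hlm : l ^ 2 + m ^ 2 = 1) (hp1 : 1 < p)
    (hq : q = p - m ^ 2 * (p - 1) * s ^ 2) (hp : p ≤ 2 ∨ 2 ≤ q) (hpr : p.HolderConjugate r) :
    ∫⁻ x, ∫⁻ y, ∫⁻ w, H (c • x + s • y) (l • (-s • x + c • y) + m • w) * g x
        ∂gauss n ∂gauss n ∂gauss n ≤
      (∫⁻ x, ∫⁻ y, (H x y : ℝ≥0∞) ^ q ∂gauss n ∂gauss n) ^ (1 / q) *
        (∫⁻ x, (g x : ℝ≥0∞) ^ r ∂gauss n) ^ (1 / r) := by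
  have hH' : ∀ {α : Type} [TopologicalSpace α] {a b : α → (Fin n → ℝ)}, Continuous a →
      Continuous b → Continuous fun z => (H (a z) (b z) : ℝ≥0∞) := fun ha hb =>
    ENNReal.continuous_coe.comp (hH.comp (ha.prodMk hb))
  have hg' : ∀ {α : Type} [TopologicalSpace α] {a : α → (Fin n → ℝ)}, Continuous a →
      Continuous fun z => (g (a z) : ℝ≥0∞) := fun ha => ENNReal.continuous_coe.comp (hg.comp ha)
  set ρ := √(c ^ 2 + s ^ 2 * l ^ 2) with hρ
  have hpos : 0 < c ^ 2 + s ^ 2 * l ^ 2 := by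
    rcases hs.eq_or_lt with h | h
    · rw [← h] at hcs ⊢; nlinarith
    · have := sq_nonneg c; positivity
  have hρ2 : ρ ^ 2 = c ^ 2 + s ^ 2 * l ^ 2 := sq_sqrt hpos.le
  have hρpos : 0 < ρ := sqrt_pos.2 hpos
  have hρ1 : ρ ≤ 1 := by
    have : s ^ 2 * l ^ 2 ≤ s ^ 2 := by nlinarith [sq_nonneg s, sq_nonneg m]
    nlinarith
  have hsm : √(1 - ρ ^ 2) = s * m := by
    rw [hρ2, show 1 - (c ^ 2 + s ^ 2 * l ^ 2) = (s * m) ^ 2 by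
      linear_combination -hcs - s ^ 2 * hlm]
    exact sqrt_sq (by positivity)
  have hqρ : ρ ^ 2 * (p - 1) = q - 1 := by
    rw [hρ2, hq]
    have h1 : m ^ 2 = 1 - l ^ 2 := by linarith
    have h2 : c ^ 2 = 1 - s ^ 2 := by linarith
    rw [h1, h2]; ring
  have hq1 : 1 < q := by nlinarith [mul_pos hpos (sub_pos.2 hp1)]
  have hqp : q ≤ p := by
    have := mul_nonneg (mul_nonneg (sq_nonneg m) (sub_nonneg.2 hp1.le)) (sq_nonneg s)
    linarith
  set a := c / ρ with ha
  set b := -(s * l) / ρ with hb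
  have hab : a ^ 2 + b ^ 2 = 1 := by
    rw [ha, hb, div_pow, div_pow, ← add_div, hρ2, div_eq_one_iff_eq hpos.ne']
    ring
  have hρa : ρ * a = c := by rw [ha]; field_simp
  have hρb : ρ * b = -(s * l) := by rw [hb]; field_simp
  have hc' : Continuous fun z : ((Fin n → ℝ) × (Fin n → ℝ)) × (Fin n → ℝ) =>
      (H z.1.1 (l • z.1.2 + m • z.2) : ℝ≥0∞) := hH' (by fun_prop) (by fun_prop)
  calc ∫⁻ x, ∫⁻ y, ∫⁻ w, H (c • x + s • y) (l • (-s • x + c • y) + m • w) * g x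
        ∂gauss n ∂gauss n ∂gauss n
      = ∫⁻ u, ∫⁻ v, ∫⁻ w, H u (l • v + m • w) * g (c • u - s • v) ∂gauss n ∂gauss n ∂gauss n := by
        rw [← lintegral_gauss_rotate hcs (Φ := fun u v => ∫⁻ w, H u (l • v + m • w) *
          g (c • u - s • v) ∂gauss n)]
        · congr! 9 with x y w
          ext i
          simp only [Pi.sub_apply, Pi.add_apply, Pi.smul_apply, smul_eq_mul]
          linear_combination (-x i) * hcs
        · refine Measurable.lintegral_prod_right' (f := fun z : ((Fin n → ℝ) × (Fin n → ℝ)) ×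
            (Fin n → ℝ) => (H z.1.1 (l • z.1.2 + m • z.2) : ℝ≥0∞) * g (c • z.1.1 - s • z.1.2)) ?_
          exact (hH' (by fun_prop) (by fun_prop)).measurable.mul (hg' (by fun_prop)).measurable
    _ = ∫⁻ u, ∫⁻ v, ∫⁻ w, H u v * g (c • u - s • (l • v - m • w)) ∂gauss n ∂gauss n ∂gauss n := by
        refine lintegral_congr fun u => ?_
        rw [← lintegral_gauss_rotate hlm (Φ := fun v w => H u v *
          g (c • u - s • (l • v - m • w)))]
        · congr! 9 with x y
          ext i
          simp only [Pi.sub_apply, Pi.add_apply, Pi.smul_apply, smul_eq_mul]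
          linear_combination (-x i) * hlm
        · exact (hH' (by fun_prop) (by fun_prop)).measurable.mul (hg' (by fun_prop)).measurable
    _ = ∫⁻ z, ∫⁻ z', ∫⁻ w, H (a • z - b • z') (b • z + a • z') * g (ρ • z + (s * m) • w)
          ∂gauss n ∂gauss n ∂gauss n := by
        rw [← lintegral_gauss_rotate hab (Φ := fun z z' => ∫⁻ w, H (a • z - b • z') (b • z + a • z')
          * g (ρ • z + (s * m) • w) ∂gauss n)]
        · congr! 9 with x y w
          · ext i
            simp only [Pi.sub_apply, Pi.add_apply, Pi.smul_apply, smul_eq_mul]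
            linear_combination (-x i) * hab
          · ext i
            simp only [Pi.add_apply, Pi.smul_apply, smul_eq_mul]
            linear_combination (-y i) * hab
          · ext i
            simp only [Pi.sub_apply, Pi.add_apply, Pi.smul_apply, smul_eq_mul]
            linear_combination (-x i) * hρa - y i * hρb
        · refine Measurable.lintegral_prod_right' (f := fun z : ((Fin n → ℝ) × (Fin n → ℝ)) ×
            (Fin n → ℝ) => (H (a • z.1.1 - b • z.1.2) (b • z.1.1 + a • z.1.2) : ℝ≥0∞) *
              g (ρ • z.1.1 + (s * m) • z.2)) ?_
          exact (hH' (by fun_prop) (by fun_prop)).measurable.mul (hg' (by fun_prop)).measurable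
    _ = ∫⁻ z', ∫⁻ z, ∫⁻ w, H (a • z - b • z') (b • z + a • z') * g (ρ • z + (s * m) • w)
          ∂gauss n ∂gauss n ∂gauss n := by
        refine lintegral_lintegral_swap (Measurable.aemeasurable ?_)
        refine Measurable.lintegral_prod_right' (f := fun z : ((Fin n → ℝ) × (Fin n → ℝ)) ×
            (Fin n → ℝ) => (H (a • z.1.1 - b • z.1.2) (b • z.1.1 + a • z.1.2) : ℝ≥0∞) *
              g (ρ • z.1.1 + (s * m) • z.2)) ?_
        exact (hH' (by fun_prop) (by fun_prop)).measurable.mul (hg' (by fun_prop)).measurable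
    _ ≤ ∫⁻ z', (∫⁻ z, (H (a • z - b • z') (b • z + a • z') : ℝ≥0∞) ^ q ∂gauss n) ^ (1 / q) *
          (∫⁻ x, (g x : ℝ≥0∞) ^ r ∂gauss n) ^ (1 / r) ∂gauss n := by
        refine lintegral_mono fun z' => ?_
        rw [← hsm]
        exact gauss_hypercontractive hq1 hqp hp hρpos.le hρ1 hqρ hpr
          (f := fun z => H (a • z - b • z') (b • z + a • z'))
          (hH.comp (by fun_prop : Continuous fun z => (a • z - b • z', b • z + a • z'))) hg
    _ = (∫⁻ z', (∫⁻ z, (H (a • z - b • z') (b • z + a • z') : ℝ≥0∞) ^ q ∂gauss n) ^ (1 / q)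
          ∂gauss n) * (∫⁻ x, (g x : ℝ≥0∞) ^ r ∂gauss n) ^ (1 / r) := by
        refine lintegral_mul_const _ (Measurable.pow_const ?_ _)
        refine Measurable.lintegral_prod_right' (f := fun z : (Fin n → ℝ) × (Fin n → ℝ) =>
          (H (a • z.2 - b • z.1) (b • z.2 + a • z.1) : ℝ≥0∞) ^ q) ?_
        exact (hH' (by fun_prop) (by fun_prop)).measurable.pow_const _
    _ ≤ (∫⁻ z', ∫⁻ z, (H (a • z - b • z') (b • z + a • z') : ℝ≥0∞) ^ q ∂gauss n
          ∂gauss n) ^ (1 / q) * (∫⁻ x, (g x : ℝ≥0∞) ^ r ∂gauss n) ^ (1 / r) := by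
        gcongr
        refine (lintegral_le_lintegral_rpow hq1.le (Measurable.aemeasurable
          (Measurable.pow_const (Measurable.lintegral_prod_right'
          (f := fun z : (Fin n → ℝ) × (Fin n → ℝ) =>
          (H (a • z.2 - b • z.1) (b • z.2 + a • z.1) : ℝ≥0∞) ^ q)
          ((hH' (by fun_prop) (by fun_prop)).measurable.pow_const _)) _))).trans (le_of_eq ?_)
        congr 1
        refine lintegral_congr fun z => ?_
        rw [← ENNReal.rpow_mul, one_div_mul_cancel (by linarith), ENNReal.rpow_one]
    _ = _ := by
        congr 2
        rw [lintegral_lintegral_swap (Measurable.aemeasurable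
          ((hH' (a := fun z : (Fin n → ℝ) × (Fin n → ℝ) => a • z.2 - b • z.1)
            (by fun_prop) (by fun_prop)).measurable.pow_const _))]
        have h := lintegral_gauss_rotate (n := n) (c := a) (s := -b) (by rw [neg_sq]; exact hab)
          (Φ := fun x y => (H x y : ℝ≥0∞) ^ q)
          ((hH' (by fun_prop) (by fun_prop)).measurable.pow_const _)
        simpa only [neg_smul, neg_neg, ← sub_eq_add_neg] using h

section Deviation

variable {F : Type*} [NormedAddCommGroup F] [NormedSpace ℝ F] {n : ℕ}

lemma lintegral_gauss_neg {φ : (Fin n → ℝ) → ℝ≥0∞} (hφ : Measurable φ) :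
    ∫⁻ x, φ (-x) ∂gauss n = ∫⁻ x, φ x ∂gauss n := by
  have h := lintegral_gauss_rotate (n := n) (c := -1) (s := 0) (by norm_num)
    (Φ := fun x _ => φ x) (hφ.comp measurable_fst)
  simpa using h

lemma enorm_apply_le_lintegral_gauss (T : (Fin n → ℝ) →L[ℝ] F) {l : ℝ} (hl : 0 < l) (m : ℝ)
    (v : Fin n → ℝ) :
    ‖T v‖ₑ ≤ ENNReal.ofReal l⁻¹ * ∫⁻ w, ‖T (l • v + m • w)‖ₑ ∂gauss n := by
  have hmeas : Measurable fun w => ‖T (l • v + m • w)‖ₑ :=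
    (Continuous.enorm (by fun_prop)).measurable
  have key : 2 * (ENNReal.ofReal l * ‖T v‖ₑ) ≤ 2 * ∫⁻ w, ‖T (l • v + m • w)‖ₑ ∂gauss n := by
    calc 2 * (ENNReal.ofReal l * ‖T v‖ₑ)
        = ∫⁻ _, 2 * (ENNReal.ofReal l * ‖T v‖ₑ) ∂gauss n := by simp
      _ ≤ ∫⁻ w, (‖T (l • v + m • w)‖ₑ + ‖T (l • v + m • -w)‖ₑ) ∂gauss n := by
          refine lintegral_mono fun w => ?_
          refine le_trans (le_of_eq ?_) (enorm_add_le _ _)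
          rw [← map_add, show l • v + m • w + (l • v + m • -w) = (2 * l) • v by module, map_smul,
            enorm_smul, Real.enorm_of_nonneg (by positivity), ENNReal.ofReal_mul (by norm_num)]
          simp [mul_assoc]
      _ = 2 * ∫⁻ w, ‖T (l • v + m • w)‖ₑ ∂gauss n := by
          rw [lintegral_add_left hmeas, lintegral_gauss_neg hmeas, two_mul]
  rw [ENNReal.mul_le_mul_iff_right (by norm_num) (by norm_num)] at key
  rw [ENNReal.ofReal_inv_of_pos hl, mul_comm, ← div_eq_mul_inv, ENNReal.le_div_iff_mul_le
    (Or.inl (by simpa using hl)) (Or.inl ENNReal.ofReal_ne_top), mul_comm]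
  exact key

lemma enorm_sub_le_lintegral_rotate [CompleteSpace F] {f : (Fin n → ℝ) → F}
    (hf : ContDiff ℝ 1 f) (x y : Fin n → ℝ) :
    ‖f x - f y‖ₑ ≤ ∫⁻ θ in Set.Ioc 0 (π / 2),
      ‖fderiv ℝ f (cos θ • x + sin θ • y) (-sin θ • x + cos θ • y)‖ₑ := by
  have hd : ∀ θ : ℝ, HasDerivAt (fun θ : ℝ => f (cos θ • x + sin θ • y))
      (fderiv ℝ f (cos θ • x + sin θ • y) (-sin θ • x + cos θ • y)) θ := fun θ =>
    (hf.differentiable (by norm_num) _).hasFDerivAt.comp_hasDerivAt θ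
      (((hasDerivAt_cos θ).smul_const x).add ((hasDerivAt_sin θ).smul_const y))
  have hcont : Continuous fun θ : ℝ =>
      fderiv ℝ f (cos θ • x + sin θ • y) (-sin θ • x + cos θ • y) :=
    ((hf.continuous_fderiv (by norm_num)).comp (by fun_prop)).clm_apply (by fun_prop)
  have h := intervalIntegral.integral_eq_sub_of_hasDerivAt (fun θ _ => hd θ)
    (hcont.intervalIntegrable 0 (π / 2))
  simp only [cos_pi_div_two, sin_pi_div_two, cos_zero, sin_zero, zero_smul, one_smul, zero_add,
    add_zero] at h
  rw [← enorm_neg, neg_sub, ← h, intervalIntegral.integral_of_le (by positivity)]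
  exact enorm_integral_le_lintegral_enorm _

theorem lintegral_enorm_sub_integral_rpow_le [CompleteSpace F] {f : (Fin n → ℝ) → F}
    (hf : ContDiff ℝ 1 f) (hint : Integrable f (gauss n)) {p l m : ℝ} (hp1 : 1 < p) (hl : 0 < l)
    (hm : 0 ≤ m) (hlm : l ^ 2 + m ^ 2 = 1) (hp : p ≤ 2 ∨ 2 ≤ p - m ^ 2 * (p - 1))
    (hfin : ∫⁻ x, ‖f x - ∫ y, f y ∂gauss n‖ₑ ^ p ∂gauss n ≠ ∞) :
    (∫⁻ x, ‖f x - ∫ y, f y ∂gauss n‖ₑ ^ p ∂gauss n) ^ (1 / p) ≤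
      ENNReal.ofReal l⁻¹ * ∫⁻ θ in Set.Ioc 0 (π / 2),
        (∫⁻ x, ∫⁻ y, ‖fderiv ℝ f x y‖ₑ ^ (p - m ^ 2 * (p - 1) * sin θ ^ 2)
          ∂gauss n ∂gauss n) ^ (1 / (p - m ^ 2 * (p - 1) * sin θ ^ 2)) := by
  set a := ∫ y, f y ∂gauss n with ha
  set I := ∫⁻ x, ‖f x - a‖ₑ ^ p ∂gauss n with hI
  set N : ℝ → ℝ≥0∞ := fun θ => (∫⁻ x, ∫⁻ y, ‖fderiv ℝ f x y‖ₑ ^ (p - m ^ 2 * (p - 1) * sin θ ^ 2)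
          ∂gauss n ∂gauss n) ^ (1 / (p - m ^ 2 * (p - 1) * sin θ ^ 2)) with hN
  have hp0 : 0 < p := by linarith
  have hp1' : 0 < p - 1 := by linarith
  have hpr : p.HolderConjugate (p / (p - 1)) := Real.HolderConjugate.conjExponent hp1
  set r := p / (p - 1) with hr
  have hfc : Continuous f := hf.continuous
  have hDc : Continuous fun z : (Fin n → ℝ) × (Fin n → ℝ) => fderiv ℝ f z.1 z.2 :=
    ((hf.continuous_fderiv (by norm_num)).comp continuous_fst).clm_apply continuous_snd
  set g : (Fin n → ℝ) → NNReal := fun x => ‖f x - a‖₊ ^ (p - 1) with hg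
  have hgc : Continuous g :=
    (NNReal.continuous_rpow_const hp1'.le).comp (hfc.sub continuous_const).nnnorm
  have hgE : ∀ x, (g x : ℝ≥0∞) = ‖f x - a‖ₑ ^ (p - 1) := fun x =>
    ENNReal.coe_rpow_of_nonneg _ hp1'.le
  have hgr : ∫⁻ x, (g x : ℝ≥0∞) ^ r ∂gauss n = I := by
    refine lintegral_congr fun x => ?_
    rw [hgE, ← ENNReal.rpow_mul, hr, mul_div_cancel₀ _ hp1'.ne']
  have hdev : ∀ x, ‖f x - a‖ₑ ≤ ∫⁻ y, ‖f x - f y‖ₑ ∂gauss n := fun x => by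
    have : f x - a = ∫ y, (f x - f y) ∂gauss n := by
      rw [integral_sub (integrable_const _) hint]; simp [ha]
    rw [this]
    exact enorm_integral_le_lintegral_enorm _
  have hmain : I ≤ (ENNReal.ofReal l⁻¹ * ∫⁻ θ in Set.Ioc 0 (π / 2), N θ) * I ^ (1 / r) := by
    set K : (Fin n → ℝ) → ℝ → (Fin n → ℝ) → ℝ≥0∞ := fun x θ y => ∫⁻ w,
      ‖fderiv ℝ f (cos θ • x + sin θ • y) (l • (-sin θ • x + cos θ • y) + m • w)‖ₑ * g x
        ∂gauss n with hK
    have hKm : Measurable fun z : ((Fin n → ℝ) × ℝ) × (Fin n → ℝ) => K z.1.1 z.1.2 z.2 := by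
      refine Measurable.lintegral_prod_right' (f := fun z :
        (((Fin n → ℝ) × ℝ) × (Fin n → ℝ)) × (Fin n → ℝ) =>
        ‖fderiv ℝ f (cos z.1.1.2 • z.1.1.1 + sin z.1.1.2 • z.1.2)
          (l • (-sin z.1.1.2 • z.1.1.1 + cos z.1.1.2 • z.1.2) + m • z.2)‖ₑ * g z.1.1.1) ?_
      have h1 := (hDc.comp (f := fun z : (((Fin n → ℝ) × ℝ) × (Fin n → ℝ)) × (Fin n → ℝ) =>
          (cos z.1.1.2 • z.1.1.1 + sin z.1.1.2 • z.1.2,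
          l • (-sin z.1.1.2 • z.1.1.1 + cos z.1.1.2 • z.1.2) + m • z.2)) (by fun_prop)).enorm
      have h2 := ENNReal.continuous_coe.comp (hgc.comp (f := fun z :
        (((Fin n → ℝ) × ℝ) × (Fin n → ℝ)) × (Fin n → ℝ) => z.1.1.1) (by fun_prop))
      exact h1.measurable.mul h2.measurable
    calc I = ∫⁻ x, ‖f x - a‖ₑ * g x ∂gauss n := by
          refine lintegral_congr fun x => ?_
          rw [hgE]
          nth_rewrite 2 [← ENNReal.rpow_one ‖f x - a‖ₑ]
          rw [← ENNReal.rpow_add_of_nonneg _ _ zero_le_one hp1'.le]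
          congr 1; ring
      _ ≤ ∫⁻ x, ∫⁻ y, (∫⁻ θ in Set.Ioc 0 (π / 2), ENNReal.ofReal l⁻¹ * K x θ y)
            ∂gauss n ∂gauss n := by
          refine lintegral_mono fun x => ?_
          grw [hdev x]
          rw [← lintegral_mul_const' _ _ ENNReal.coe_ne_top]
          refine lintegral_mono fun y => ?_
          dsimp only
          grw [enorm_sub_le_lintegral_rotate hf x y]
          rw [← lintegral_mul_const' _ _ ENNReal.coe_ne_top]
          refine lintegral_mono fun θ => ?_
          rw [hK]
          dsimp only
          rw [lintegral_mul_const' _ _ ENNReal.coe_ne_top, ← mul_assoc]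
          gcongr
          exact enorm_apply_le_lintegral_gauss _ hl m _
      _ = ∫⁻ x, (∫⁻ θ in Set.Ioc 0 (π / 2), ENNReal.ofReal l⁻¹ * ∫⁻ y, K x θ y ∂gauss n)
            ∂gauss n := by
          refine lintegral_congr fun x => ?_
          rw [lintegral_lintegral_swap (Measurable.aemeasurable ?_)]
          · simp_rw [lintegral_const_mul' _ _ ENNReal.ofReal_ne_top]
          · exact (hKm.comp (f := fun z : (Fin n → ℝ) × ℝ => ((x, z.2), z.1))
              (by fun_prop)).const_mul _
      _ = ∫⁻ θ in Set.Ioc 0 (π / 2), ENNReal.ofReal l⁻¹ * ∫⁻ x, ∫⁻ y, K x θ y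
            ∂gauss n ∂gauss n := by
          rw [lintegral_lintegral_swap (Measurable.aemeasurable ?_)]
          · simp_rw [lintegral_const_mul' _ _ ENNReal.ofReal_ne_top]
          · exact (Measurable.lintegral_prod_right' hKm).const_mul _
      _ ≤ ∫⁻ θ in Set.Ioc 0 (π / 2), ENNReal.ofReal l⁻¹ * (N θ * I ^ (1 / r)) := by
          refine setLIntegral_mono' measurableSet_Ioc fun θ hθ => ?_
          have hs : 0 ≤ sin θ := sin_nonneg_of_nonneg_of_le_pi hθ.1.le (by linarith [hθ.2, pi_pos])
          gcongr
          rw [← hgr]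
          refine lintegral_gauss_mul_rotated_le (H := fun x y => ‖fderiv ℝ f x y‖₊) hDc.nnnorm hgc
            hs (cos_sq_add_sin_sq θ) hl hm hlm hp1 rfl (hp.imp_right fun h => h.trans ?_) hpr
          have : sin θ ^ 2 ≤ 1 := sin_sq_le_one θ
          have h2 : 0 ≤ m ^ 2 * (p - 1) := by positivity
          nlinarith
      _ = _ := by
          rw [lintegral_const_mul' _ _ ENNReal.ofReal_ne_top,
            lintegral_mul_const' _ _ (ENNReal.rpow_ne_top_of_nonneg (by have := hpr.symm.pos; positivity) hfin),
            mul_assoc]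
  rcases eq_or_ne I 0 with h0 | h0
  · rw [h0, ENNReal.zero_rpow_of_pos (by positivity)]
    exact zero_le
  · have hr0 := hpr.symm.pos
    have e : I = I ^ (1 / p) * I ^ (1 / r) := by
      rw [← ENNReal.rpow_add _ _ h0 hfin, hpr.one_div_add_one_div, div_one, ENNReal.rpow_one]
    nth_rewrite 1 [e] at hmain
    exact (ENNReal.mul_le_mul_iff_left (by simp [h0, hfin])
      (ENNReal.rpow_ne_top_of_nonneg (by positivity) hfin)).1 hmain

end Deviation

lemma memLp_id_gauss (n : ℕ) {p : ℝ≥0∞} (hp : p ≠ ∞) :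
    MemLp (fun x : Fin n → ℝ => x) p (gauss n) := by
  refine MemLp.of_eval fun i => ?_
  have hmp : MeasurePreserving (Function.eval i) (gauss n)
      (ProbabilityTheory.gaussianReal 0 1) :=
    measurePreserving_eval (fun _ : Fin n => ProbabilityTheory.gaussianReal 0 1) i
  have hid := ProbabilityTheory.memLp_id_gaussianReal' (μ := 0) (v := 1) p hp
  exact hid.comp_measurePreserving hmp

lemma integrable_one_add_norm_rpow_gauss (n : ℕ) {s : ℝ} (hs : 0 ≤ s) :
    Integrable (fun x : Fin n → ℝ => (1 + ‖x‖) ^ s) (gauss n) := by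
  have h : MemLp (fun x : Fin n → ℝ => 1 + ‖x‖) (ENNReal.ofReal s) (gauss n) :=
    (memLp_const (1 : ℝ)).add (memLp_id_gauss n ENNReal.ofReal_ne_top).norm
  have h2 := h.integrable_norm_rpow'
  rw [ENNReal.toReal_ofReal hs] at h2
  have e : ∀ x : Fin n → ℝ, ‖1 + ‖x‖‖ = 1 + ‖x‖ := fun x =>
    Real.norm_of_nonneg (by positivity)
  simpa only [e] using h2

lemma lintegral_rpow_le_exp_log {α : Type*} [MeasurableSpace α] {μ : Measure α}
    {h : α → ℝ≥0∞} (hh : AEMeasurable h μ) {p a P Q : ℝ} (hp : 1 < p) (ha0 : 0 ≤ a) (ha1 : a ≤ 1)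
    (hQ : 0 < Q) (hQP : Q ≤ P) (h1 : ∫⁻ x, h x ∂μ = ENNReal.ofReal Q)
    (h2 : ∫⁻ x, h x ^ p ∂μ = ENNReal.ofReal (P ^ p)) :
    (∫⁻ x, h x ^ (p - a * (p - 1)) ∂μ) ^ (1 / (p - a * (p - 1))) ≤
      ENNReal.ofReal (P * exp (-(a / p * log (P / Q)))) := by
  have hP : 0 < P := hQ.trans_le hQP
  have hq1 : 1 ≤ p - a * (p - 1) := by nlinarith
  set q := p - a * (p - 1) with hq
  have hqp : q ≤ p := by nlinarith
  have hq0 : 0 < q := by linarith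
  have hint : ∫⁻ x, h x ^ q ∂μ ≤ ENNReal.ofReal (Q ^ a * (P ^ p) ^ (1 - a)) := by
    have key := ENNReal.lintegral_mul_norm_pow_le hh (hh.pow_const p) ha0 (sub_nonneg.2 ha1)
      (by ring)
    rw [h1, h2, ENNReal.ofReal_rpow_of_nonneg hQ.le ha0,
      ENNReal.ofReal_rpow_of_nonneg (by positivity) (sub_nonneg.2 ha1),
      ← ENNReal.ofReal_mul (by positivity)] at key
    refine le_trans (le_of_eq (lintegral_congr fun x => ?_)) key
    rw [← ENNReal.rpow_mul, ← ENNReal.rpow_add_of_nonneg _ _ ha0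
      (mul_nonneg (by linarith) (sub_nonneg.2 ha1))]
    congr 1
    rw [hq]; ring
  grw [hint]
  rw [ENNReal.ofReal_rpow_of_nonneg (by positivity) (by positivity)]
  refine ENNReal.ofReal_le_ofReal ?_
  have hlog : 0 ≤ log (P / Q) := log_nonneg ((one_le_div hQ).2 hQP)
  have e : (Q ^ a * (P ^ p) ^ (1 - a)) ^ (1 / q) = P * exp (-(a / q * log (P / Q))) := by
    rw [log_div hP.ne' hQ.ne', ← rpow_mul hP.le, rpow_def_of_pos hQ, rpow_def_of_pos hP,
      ← Real.exp_add, ← Real.exp_mul]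
    nth_rewrite 2 [← exp_log hP]
    rw [← Real.exp_add]
    congr 1
    field_simp
    rw [hq]; ring
  rw [e]
  gcongr

lemma setLIntegral_exp_neg_mul_sq_le {κ L : ℝ} (hκ : 0 < κ) (hL : 0 ≤ L) :
    ∫⁻ θ in Set.Ioc 0 (π / 2), ENNReal.ofReal (exp (-(κ * L) * θ ^ 2)) ≤
      ENNReal.ofReal ((π / 2 + √(π / κ) / 2) / (1 + √L)) := by
  have b1 : ∫⁻ θ in Set.Ioc 0 (π / 2), ENNReal.ofReal (exp (-(κ * L) * θ ^ 2)) ≤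
      ENNReal.ofReal (π / 2) := by
    calc _ ≤ ∫⁻ θ in Set.Ioc 0 (π / 2), 1 := by
          refine lintegral_mono fun θ => ?_
          rw [← ENNReal.ofReal_one]
          refine ENNReal.ofReal_le_ofReal (exp_le_one_iff.2 ?_)
          have : 0 ≤ κ * L * θ ^ 2 := by positivity
          linarith
      _ = _ := by simp
  rcases hL.eq_or_lt with rfl | hL
  · refine b1.trans (ENNReal.ofReal_le_ofReal ?_)
    simp only [sqrt_zero, add_zero, div_one]
    have := sqrt_nonneg (π / κ)
    linarith
  have b2 : ∫⁻ θ in Set.Ioc 0 (π / 2), ENNReal.ofReal (exp (-(κ * L) * θ ^ 2)) ≤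
      ENNReal.ofReal (√(π / κ) / 2 / √L) := by
    calc _ ≤ ∫⁻ θ in Set.Ioi 0, ENNReal.ofReal (exp (-(κ * L) * θ ^ 2)) :=
          lintegral_mono_set fun x hx => hx.1
      _ = _ := by
          rw [← ofReal_integral_eq_lintegral_ofReal
            (integrable_exp_neg_mul_sq (by positivity)).integrableOn
            (ae_of_all _ fun _ => (exp_pos _).le), integral_gaussian_Ioi]
          congr 1
          rw [← div_div, sqrt_div (by positivity)]
          ring
  have hs : 0 < √L := sqrt_pos.2 hL
  set J := ∫⁻ θ in Set.Ioc 0 (π / 2), ENNReal.ofReal (exp (-(κ * L) * θ ^ 2)) with hJ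
  have hJt : J ≠ ∞ := ne_top_of_le_ne_top ENNReal.ofReal_ne_top b1
  rw [← ENNReal.ofReal_toReal hJt]
  have c1 := ENNReal.toReal_le_of_le_ofReal (by positivity) b1
  have c2 := ENNReal.toReal_le_of_le_ofReal (by positivity) b2
  refine ENNReal.ofReal_le_ofReal ?_
  rw [le_div_iff₀ (by positivity)]
  rw [le_div_iff₀ hs] at c2
  linarith

section PolyGrowth

variable {F : Type*} [NormedAddCommGroup F] {n : ℕ}

lemma gaussLp_eq_toReal {φ : (Fin n → ℝ) → F} {p : ℝ} (hp : 0 < p) (hφ : Continuous φ) :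
    gaussLp p φ = ((∫⁻ x, ‖φ x‖ₑ ^ p ∂gauss n) ^ (1 / p)).toReal := by
  rw [gaussLp, integral_eq_lintegral_of_nonneg_ae (ae_of_all _ fun _ => by positivity)
    (hφ.norm.rpow_const fun _ => Or.inr hp.le).aestronglyMeasurable, ENNReal.toReal_rpow]
  simp_rw [← ENNReal.ofReal_rpow_of_nonneg (norm_nonneg _) hp.le, ofReal_norm]

lemma integrable_norm_rpow_gauss_of_le {φ : (Fin n → ℝ) → F} (hφ : Continuous φ) {c : ℝ} {k : ℕ}
    (h : ∀ x, ‖φ x‖ ≤ c * (1 + ‖x‖) ^ k) {p : ℝ} (hp : 0 ≤ p) :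
    Integrable (fun x => ‖φ x‖ ^ p) (gauss n) := by
  refine ((integrable_one_add_norm_rpow_gauss n
    (show 0 ≤ k * p by positivity)).const_mul (|c| ^ p)).mono'
    (hφ.norm.rpow_const fun _ => Or.inr hp).aestronglyMeasurable (ae_of_all _ fun x => ?_)
  rw [Real.norm_of_nonneg (by positivity), rpow_mul (by positivity), rpow_natCast,
    ← mul_rpow (abs_nonneg _) (by positivity)]
  refine rpow_le_rpow (norm_nonneg _) ((h x).trans ?_) hp
  gcongr
  exact le_abs_self c

variable [NormedSpace ℝ F] {f : (Fin n → ℝ) → F}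

lemma PolyGrowth.norm_le (hf : PolyGrowth f) : ∃ (c : ℝ) (k : ℕ), ∀ x, ‖f x‖ ≤ c * (1 + ‖x‖) ^ k := by
  simpa using hf 0

lemma PolyGrowth.norm_fderiv_le (hf : PolyGrowth f) :
    ∃ (c : ℝ) (k : ℕ), ∀ x, ‖fderiv ℝ f x‖ ≤ c * (1 + ‖x‖) ^ k := by
  simpa only [norm_iteratedFDeriv_one] using hf 1

lemma integrable_norm_fderiv_rpow (hf : PolyGrowth f) (hf1 : ContDiff ℝ 1 f) {p : ℝ}
    (hp : 0 ≤ p) :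
    Integrable (fun z : (Fin n → ℝ) × (Fin n → ℝ) => ‖fderiv ℝ f z.1 z.2‖ ^ p)
      ((gauss n).prod (gauss n)) := by
  obtain ⟨c, k, h⟩ := hf.norm_fderiv_le
  have hDc : Continuous fun z : (Fin n → ℝ) × (Fin n → ℝ) => fderiv ℝ f z.1 z.2 :=
    ((hf1.continuous_fderiv (by norm_num)).comp continuous_fst).clm_apply continuous_snd
  refine ((integrable_norm_rpow_gauss_of_le (hf1.continuous_fderiv (by norm_num)) h hp).mul_prod
    (integrable_one_add_norm_rpow_gauss n hp)).mono'
    (hDc.norm.rpow_const fun _ => Or.inr hp).aestronglyMeasurable (ae_of_all _ fun z => ?_)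
  rw [Real.norm_of_nonneg (by positivity), ← mul_rpow (by positivity) (by positivity)]
  refine rpow_le_rpow (norm_nonneg _) (((fderiv ℝ f z.1).le_opNorm z.2).trans ?_) hp
  gcongr
  linarith

lemma lintegral_enorm_fderiv_rpow (hf : PolyGrowth f) (hf1 : ContDiff ℝ 1 f) {p : ℝ}
    (hp : 0 < p) :
    ∫⁻ x, ∫⁻ y, ‖fderiv ℝ f x y‖ₑ ^ p ∂gauss n ∂gauss n = ENNReal.ofReal (gaussGradLp p f ^ p) := by
  have hint := integrable_norm_fderiv_rpow hf hf1 hp.le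
  have hDc : Continuous fun z : (Fin n → ℝ) × (Fin n → ℝ) => fderiv ℝ f z.1 z.2 :=
    ((hf1.continuous_fderiv (by norm_num)).comp continuous_fst).clm_apply continuous_snd
  have e : ∀ x y : Fin n → ℝ, ∑ i, y i • fderiv ℝ f x (Pi.single i 1) = fderiv ℝ f x y := by
    intro x y
    conv_rhs => rw [pi_eq_sum_univ' y, map_sum]
    simp_rw [map_smul]
  have hnn : 0 ≤ ∫ y, ∫ x, ‖fderiv ℝ f x y‖ ^ p ∂gauss n ∂gauss n :=
    integral_nonneg fun _ => integral_nonneg fun _ => by positivity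
  rw [gaussGradLp]
  simp_rw [e]
  rw [← rpow_mul hnn, one_div_mul_cancel hp.ne', rpow_one]
  rw [← integral_prod_symm _ hint, ofReal_integral_eq_lintegral_ofReal hint
    (ae_of_all _ fun _ => by positivity), lintegral_prod _
    (hDc.norm.rpow_const fun _ => Or.inr hp.le).measurable.ennreal_ofReal.aemeasurable]
  simp_rw [← ENNReal.ofReal_rpow_of_nonneg (norm_nonneg _) hp.le, ofReal_norm]

end PolyGrowth

lemma exists_smoothing_parameter (p : ℝ) :
    ∃ ε : ℝ, 0 < ε ∧ ε < 1 ∧ (p ≤ 2 ∨ 2 ≤ p - ε * (p - 1)) := by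
  rcases le_or_gt p 2 with h | h
  · exact ⟨1 / 2, by norm_num, by norm_num, Or.inl h⟩
  · have h1 : 0 < p - 1 := by linarith
    refine ⟨(p - 2) / (p - 1), div_pos (by linarith) h1, ?_, Or.inr ?_⟩
    · rw [div_lt_one h1]; linarith
    · rw [div_mul_cancel₀ _ h1.ne']; linarith

section PolyGrowth

variable {F : Type*} [NormedAddCommGroup F] [NormedSpace ℝ F] {n : ℕ} {f : (Fin n → ℝ) → F}

lemma gaussGradLp_nonneg (p : ℝ) (f : (Fin n → ℝ) → F) : 0 ≤ gaussGradLp p f :=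
  rpow_nonneg (integral_nonneg fun _ => integral_nonneg fun _ => by positivity) _

lemma PolyGrowth.integrable (hf : PolyGrowth f) (hc : Continuous f) :
    Integrable f (gauss n) := by
  obtain ⟨c, k, h⟩ := hf.norm_le
  have := integrable_norm_rpow_gauss_of_le hc h zero_le_one
  simp only [rpow_one] at this
  exact (integrable_norm_iff hc.aestronglyMeasurable).1 this

lemma PolyGrowth.lintegral_enorm_sub_rpow_ne_top (hf : PolyGrowth f) (hc : Continuous f) (a : F)
    {p : ℝ} (hp : 0 ≤ p) : ∫⁻ x, ‖f x - a‖ₑ ^ p ∂gauss n ≠ ∞ := by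
  obtain ⟨c, k, h⟩ := hf.norm_le
  have hb : ∀ x, ‖f x - a‖ ≤ (c + ‖a‖) * (1 + ‖x‖) ^ k := fun x => by
    have h1 : 1 ≤ (1 + ‖x‖) ^ k := one_le_pow₀ (by linarith [norm_nonneg x])
    have h2 := mul_le_mul_of_nonneg_left h1 (norm_nonneg a)
    linarith [norm_sub_le (f x) a, h x]
  have hi := integrable_norm_rpow_gauss_of_le (hc.sub continuous_const) hb hp
  have := hi.lintegral_lt_top
  simp_rw [← ENNReal.ofReal_rpow_of_nonneg (norm_nonneg _) hp, ofReal_norm] at this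
  exact this.ne

/-- The estimate with an explicit constant, depending on a smoothing parameter `ε`. -/
theorem gaussLp_sub_integral_le [CompleteSpace F] (hf : PolyGrowth f) (hf1 : ContDiff ℝ 1 f)
    {p ε : ℝ} (hp : 1 < p) (hε0 : 0 < ε) (hε1 : ε < 1) (hε : p ≤ 2 ∨ 2 ≤ p - ε * (p - 1)) :
    gaussLp p (fun x => f x - ∫ y, f y ∂gauss n) ≤
      (√(1 - ε))⁻¹ * (π / 2 + √(π / (4 * ε / (p * π ^ 2))) / 2) *
        (gaussGradLp p f / (1 + √(log (gaussGradLp p f / gaussGradLp 1 f)))) := by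
  have hp0 : 0 < p := by linarith
  have hl : 0 < √(1 - ε) := sqrt_pos.2 (by linarith)
  have hm2 : √ε ^ 2 = ε := sq_sqrt hε0.le
  have hmain := lintegral_enorm_sub_integral_rpow_le hf1 (hf.integrable hf1.continuous) hp hl
    (sqrt_nonneg ε) (by rw [hm2, sq_sqrt (by linarith)]; ring) (by rwa [hm2])
    (hf.lintegral_enorm_sub_rpow_ne_top hf1.continuous _ hp0.le)
  have hP0 := gaussGradLp_nonneg p f
  have hQ0 := gaussGradLp_nonneg 1 f
  have hP := lintegral_enorm_fderiv_rpow hf hf1 hp0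
  have hQ := lintegral_enorm_fderiv_rpow hf hf1 one_pos
  set P := gaussGradLp p f
  set Q := gaussGradLp 1 f
  rw [gaussLp_eq_toReal hp0 (by have := hf1.continuous; fun_prop)]
  refine ENNReal.toReal_le_of_le_ofReal (by positivity) (hmain.trans ?_)
  set ν := (gauss n).prod (gauss n)
  have hDc : Continuous fun z : (Fin n → ℝ) × (Fin n → ℝ) => fderiv ℝ f z.1 z.2 :=
    ((hf1.continuous_fderiv (by norm_num)).comp continuous_fst).clm_apply continuous_snd
  have hhm : Measurable fun z : (Fin n → ℝ) × (Fin n → ℝ) => ‖fderiv ℝ f z.1 z.2‖ₑ :=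
    hDc.enorm.measurable
  have hprod : ∀ s : ℝ, ∫⁻ x, ∫⁻ y, ‖fderiv ℝ f x y‖ₑ ^ s ∂gauss n ∂gauss n =
      ∫⁻ z, ‖fderiv ℝ f z.1 z.2‖ₑ ^ s ∂ν := fun s =>
    (lintegral_prod _ (hhm.pow_const s).aemeasurable).symm
  rw [hprod] at hP hQ
  simp only [ENNReal.rpow_one, rpow_one] at hQ
  simp_rw [hprod]
  rw [hm2]
  have hexp : ∀ θ, 0 < p - ε * (p - 1) * sin θ ^ 2 := fun θ => by
    have h1 : ε * sin θ ^ 2 ≤ 1 := by nlinarith [sin_sq_le_one θ, sq_nonneg (sin θ)]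
    nlinarith
  rcases hQ0.eq_or_lt with hQz | hQpos
  · rw [← hQz, ENNReal.ofReal_zero, lintegral_eq_zero_iff hhm] at hQ
    have hz : ∀ s : ℝ, 0 < s → ∫⁻ z, ‖fderiv ℝ f z.1 z.2‖ₑ ^ s ∂ν = 0 := fun s hs => by
      rw [lintegral_eq_zero_iff (hhm.pow_const s)]
      filter_upwards [hQ] with z hz
      simp only [Pi.zero_apply] at hz ⊢
      rw [hz, ENNReal.zero_rpow_of_pos hs]
    have : ∀ θ, (∫⁻ z, ‖fderiv ℝ f z.1 z.2‖ₑ ^ (p - ε * (p - 1) * sin θ ^ 2) ∂ν) ^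
        (1 / (p - ε * (p - 1) * sin θ ^ 2)) = 0 := fun θ => by
      rw [hz _ (hexp θ), ENNReal.zero_rpow_of_pos (one_div_pos.2 (hexp θ))]
    simp only [this, lintegral_zero, mul_zero, zero_le]
  have hQP : Q ≤ P := by
    have h := lintegral_le_lintegral_rpow (μ := ν) hp.le hhm.aemeasurable
    rw [hP, hQ, ENNReal.ofReal_rpow_of_nonneg (by positivity) (by positivity), ← rpow_mul hP0,
      mul_one_div_cancel hp0.ne', rpow_one] at h
    exact (ENNReal.ofReal_le_ofReal_iff hP0).1 h
  have hL : 0 ≤ log (P / Q) := log_nonneg ((one_le_div hQpos).2 hQP)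
  set L := log (P / Q)
  set κ := 4 * ε / (p * π ^ 2) with hκ
  have hκ0 : 0 < κ := by positivity
  have hpt : ∀ θ ∈ Set.Ioc 0 (π / 2),
      (∫⁻ z, ‖fderiv ℝ f z.1 z.2‖ₑ ^ (p - ε * (p - 1) * sin θ ^ 2) ∂ν) ^
        (1 / (p - ε * (p - 1) * sin θ ^ 2)) ≤
      ENNReal.ofReal P * ENNReal.ofReal (exp (-(κ * L) * θ ^ 2)) := fun θ hθ => by
    have h := lintegral_rpow_le_exp_log (a := ε * sin θ ^ 2) hhm.aemeasurable hp (by positivity)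
      (by nlinarith [sin_sq_le_one θ, sq_nonneg (sin θ)]) hQpos hQP hQ hP
    rw [show ε * sin θ ^ 2 * (p - 1) = ε * (p - 1) * sin θ ^ 2 by ring] at h
    refine h.trans ?_
    rw [← ENNReal.ofReal_mul hP0]
    refine ENNReal.ofReal_le_ofReal (mul_le_mul_of_nonneg_left (exp_le_exp.2 ?_) hP0)
    have hsin : (2 / π * θ) ^ 2 ≤ sin θ ^ 2 :=
      pow_le_pow_left₀ (by have := hθ.1; positivity) (mul_le_sin hθ.1.le hθ.2) 2
    have e : κ * L * θ ^ 2 = ε * (2 / π * θ) ^ 2 / p * L := by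
      rw [hκ]; field_simp; ring
    have : ε * (2 / π * θ) ^ 2 / p * L ≤ ε * sin θ ^ 2 / p * L := by gcongr
    linarith
  grw [setLIntegral_mono' measurableSet_Ioc hpt]
  rw [lintegral_const_mul' _ _ ENNReal.ofReal_ne_top]
  grw [setLIntegral_exp_neg_mul_sq_le hκ0 hL]
  rw [← ENNReal.ofReal_mul hP0, ← ENNReal.ofReal_mul (by positivity)]
  refine ENNReal.ofReal_le_ofReal (le_of_eq ?_)
  ring

end PolyGrowth

/-- **Gaussian `L_1 - L_p` inequality for arbitrary Banach targets** (Theorem 12).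
For every `p ∈ (1,∞)` there exists `C_p ∈ (0,∞)`, depending only on `p`, such that for every
complex Banach space `E` and every smooth `f : ℝ^n → E` of polynomial growth (together with all
its derivatives), `‖f - E_{γ_n} f‖_p ≤ C_p ‖∇f‖_p / (1 + √(log(‖∇f‖_p/‖∇f‖₁)))`.
(When `∇f ≡ 0` the right-hand side is automatically `0`.) -/
theorem gaussian_l1_lp_inequality (p : ℝ) (hp : 1 < p) :
    ∃ Cp : ℝ, 0 < Cp ∧
      ∀ (E : Type*) [NormedAddCommGroup E] [NormedSpace ℂ E] [CompleteSpace E],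
        ∀ (n : ℕ) (f : (Fin n → ℝ) → E), ContDiff ℝ (⊤ : ℕ∞) f → PolyGrowth f →
          gaussLp p (fun x => f x - ∫ y, f y ∂gauss n)
            ≤ Cp * (gaussGradLp p f /
                (1 + Real.sqrt (Real.log (gaussGradLp p f / gaussGradLp 1 f)))) := by
  obtain ⟨ε, hε0, hε1, hε⟩ := exists_smoothing_parameter p
  refine ⟨(√(1 - ε))⁻¹ * (π / 2 + √(π / (4 * ε / (p * π ^ 2))) / 2), ?_, ?_⟩
  · have : 0 < √(1 - ε) := sqrt_pos.2 (by linarith)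
    positivity
  · intro E _ _ _ n f hf hfp
    exact gaussLp_sub_integral_le hfp (hf.of_le (by exact_mod_cast le_top)) hp hε0 hε1 hε

end
end
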